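/- arXiv:2010.04982 — 2 statements merged into one kernel-verified Lean document; each statement's English description precedes it below -/
import Mathlib

section
/- For every sufficiently large constant C_0 > 2, the set Ω = Ω(C_0) has asymptotic density e^{−γ}·3/(5π²·C_0), where γ is the Euler–Mascheroni constant; that is, |Ω ∩ [1,X]|/X → e^{−γ}·3/(5π²·C_0) as X → ∞. -/
open Finset

/-- Membership in the set `Ω(C₀)` (apart from the "sufficiently large" cutoff):
`M` is square-free, `0.9 log log M < ω(M) < 1.1 log log M`, and `M = A·m` with
`3 ≤ A ≤ (log M)^0.1` and every prime divisor of `m` exceeding `(log M)^C₀`. -/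
def inOmega (C₀ : ℝ) (M : ℕ) : Prop :=
  Squarefree M ∧
  0.9 * Real.log (Real.log M) < (M.primeFactors.card : ℝ) ∧
  (M.primeFactors.card : ℝ) < 1.1 * Real.log (Real.log M) ∧
  ∃ A m : ℕ, M = A * m ∧ 3 ≤ A ∧ (A : ℝ) ≤ Real.log M ^ (0.1 : ℝ) ∧
    ∀ p : ℕ, p.Prime → p ∣ m → Real.log M ^ C₀ < (p : ℝ)

open Filter Topology

lemma log_factorial_eq_sum_primesLE (n : ℕ) :
    Real.log (n.factorial : ℝ) =
      ∑ p ∈ Nat.primesLE n, (n.factorial.factorization p : ℝ) * Real.log p := by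
  rw [Real.log_nat_eq_sum_factorization, Finsupp.sum]
  refine Finset.sum_subset ?_ ?_
  · intro p hp
    have hp' := Nat.prime_of_mem_primeFactors (by simpa using hp)
    have : p ∣ n.factorial := Nat.dvd_of_mem_primeFactors (by simpa using hp)
    exact Nat.mem_primesLE.2 ⟨(hp'.dvd_factorial).1 this, hp'⟩
  · intro p _ hp
    simp [Finsupp.notMem_support_iff.1 hp]

lemma div_le_factorization_factorial {n p : ℕ} (hp : p.Prime) :
    n / p ≤ n.factorial.factorization p := by
  rw [Nat.factorization_factorial hp (b := Nat.log p n + 2) (by omega)]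
  calc n / p = n / p ^ 1 := by simp
    _ ≤ _ := Finset.single_le_sum (f := fun i => n / p ^ i) (fun _ _ => Nat.zero_le _)
      (by simp)

lemma log_div_mul_sub_one_le {p : ℕ} (hp : 2 ≤ p) :
    Real.log p / (p * (p - 1) : ℝ) ≤ 4 * (1 / (p : ℝ) ^ (3 / 2 : ℝ)) := by
  have hp2 : (2 : ℝ) ≤ p := by exact_mod_cast hp
  have h1 : Real.log p ≤ 2 * (p : ℝ) ^ (1 / 2 : ℝ) := by
    have := Real.log_le_rpow_div (x := p) (by positivity) (ε := 1 / 2) (by norm_num)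
    linarith
  have h3 : (p : ℝ) ^ (3 / 2 : ℝ) * (p : ℝ) ^ (1 / 2 : ℝ) = p * p := by
    rw [← Real.rpow_add (by positivity)]; norm_num; ring
  have h4 : 0 < (p : ℝ) ^ (3 / 2 : ℝ) := by positivity
  rw [mul_one_div, div_le_div_iff₀ (by nlinarith) h4]
  calc Real.log p * (p : ℝ) ^ (3 / 2 : ℝ) ≤ 2 * (p : ℝ) ^ (1 / 2 : ℝ) * (p : ℝ) ^ (3 / 2 : ℝ) := by
        gcongr
    _ = 2 * (p * p) := by rw [← h3]; ring
    _ ≤ 4 * (p * (p - 1)) := by nlinarith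

/-- **Mertens' first theorem**. -/
theorem abs_sum_log_div_sub_log_le :
    ∃ C : ℝ, ∀ n : ℕ, 1 ≤ n →
      |∑ p ∈ Nat.primesLE n, Real.log p / p - Real.log n| ≤ C := by
  have hsum : Summable fun p : ℕ => 4 * (1 / (p : ℝ) ^ (3 / 2 : ℝ)) :=
    (Real.summable_one_div_nat_rpow.2 (by norm_num)).mul_left 4
  set K := ∑' p : ℕ, 4 * (1 / (p : ℝ) ^ (3 / 2 : ℝ)) with hK
  have hK0 : 0 ≤ K := tsum_nonneg fun _ => by positivity
  refine ⟨Real.log 4 + 1 + K, fun n hn => ?_⟩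
  have hn0 : (0 : ℝ) < n := by exact_mod_cast hn
  have hlog4 : 0 ≤ Real.log 4 := Real.log_nonneg (by norm_num)
  have hup : n * ∑ p ∈ Nat.primesLE n, Real.log p / p ≤ n * Real.log n + Real.log 4 * n := by
    have h1 : n * ∑ p ∈ Nat.primesLE n, Real.log p / p
        ≤ Real.log (n.factorial : ℝ) + ∑ p ∈ Nat.primesLE n, Real.log p := by
      rw [log_factorial_eq_sum_primesLE, Finset.mul_sum, ← Finset.sum_add_distrib]
      refine Finset.sum_le_sum fun p hp => ?_
      have hp' := Nat.prime_of_mem_primesLE hp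
      have hlp : 0 ≤ Real.log p := Real.log_natCast_nonneg p
      have h2 : (n : ℝ) / p ≤ n.factorial.factorization p + 1 := by
        have := Nat.lt_floor_add_one ((n : ℝ) / p)
        rw [Nat.floor_div_natCast, Nat.floor_natCast] at this
        have h3 : ((n / p : ℕ) : ℝ) ≤ n.factorial.factorization p := by
          exact_mod_cast div_le_factorization_factorial hp'
        linarith
      calc n * (Real.log p / p) = (n / p) * Real.log p := by ring
        _ ≤ (n.factorial.factorization p + 1) * Real.log p := by gcongr
        _ = _ := by ring
    have h2 : ∑ p ∈ Nat.primesLE n, Real.log p ≤ Real.log 4 * n := by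
      rw [← Chebyshev.theta_eq_sum_primesLE_log]
      exact Chebyshev.theta_le_log4_mul_x hn0.le
    have h3 : Real.log (n.factorial : ℝ) ≤ n * Real.log n := by
      rw [← Real.log_pow]
      exact Real.log_le_log (by positivity) (by exact_mod_cast Nat.factorial_le_pow n)
    linarith
  have hlow : n * Real.log n - n ≤ n * ∑ p ∈ Nat.primesLE n, Real.log p / p + n * K := by
    have h1 : Real.log (n.factorial : ℝ) ≤ n * ∑ p ∈ Nat.primesLE n, Real.log p / p
        + n * ∑ p ∈ Nat.primesLE n, Real.log p / (p * (p - 1) : ℝ) := by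
      rw [log_factorial_eq_sum_primesLE, Finset.mul_sum, Finset.mul_sum, ← Finset.sum_add_distrib]
      refine Finset.sum_le_sum fun p hp => ?_
      have hp' := Nat.prime_of_mem_primesLE hp
      have hp2 : (2 : ℝ) ≤ p := by exact_mod_cast hp'.two_le
      have hlp : 0 ≤ Real.log p := Real.log_natCast_nonneg p
      have h2 : (n.factorial.factorization p : ℝ) ≤ n / (p - 1) := by
        have h3 : (n.factorial.factorization p : ℝ) ≤ ((n / (p - 1) : ℕ) : ℝ) := by
          exact_mod_cast Nat.factorization_factorial_le_div_pred hp' n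
        refine h3.trans (Nat.cast_div_le.trans ?_)
        rw [Nat.cast_sub hp'.one_le, Nat.cast_one]
      calc (n.factorial.factorization p : ℝ) * Real.log p ≤ n / (p - 1) * Real.log p := by gcongr
        _ = _ := by
          have : (p : ℝ) - 1 ≠ 0 := by linarith
          have : (p : ℝ) ≠ 0 := by linarith
          field_simp
          ring
    have h2 : ∑ p ∈ Nat.primesLE n, Real.log p / (p * (p - 1) : ℝ) ≤ K :=
      (Finset.sum_le_sum fun p hp =>
        log_div_mul_sub_one_le (Nat.two_le_of_mem_primesLE hp)).trans
        (hsum.sum_le_tsum _ fun _ _ => by positivity)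
    have h3 := Stirling.le_log_factorial_stirling (n := n) (by omega)
    have h4 : 0 ≤ Real.log n := Real.log_natCast_nonneg n
    have h5 : 0 ≤ Real.log (2 * Real.pi) := Real.log_nonneg (by linarith [Real.pi_gt_three])
    have := mul_le_mul_of_nonneg_left h2 hn0.le
    linarith
  have hup' : ∑ p ∈ Nat.primesLE n, Real.log p / p ≤ Real.log n + Real.log 4 :=
    le_of_mul_le_mul_left (by linarith) hn0
  have hlow' : Real.log n - 1 ≤ ∑ p ∈ Nat.primesLE n, Real.log p / p + K :=
    le_of_mul_le_mul_left (by linarith) hn0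
  rw [abs_le]
  constructor <;> linarith

lemma sum_mul_sub_eq_sum_by_parts (g v : ℕ → ℝ) (L : ℝ) (hv : v 0 = 1) (N : ℕ) :
    ∑ k ∈ range (N + 1), g k * v k - L =
      v N * (∑ k ∈ range (N + 1), g k - L) +
        ∑ k ∈ range N, (v k - v (k + 1)) * (∑ j ∈ range (k + 1), g j - L) := by
  induction N with
  | zero => simp [hv]
  | succ N ih =>
    rw [sum_range_succ (n := N + 1), add_sub_right_comm, ih, 
      sum_range_succ (fun k => (v k - v (k + 1)) * (∑ j ∈ range (k + 1), g j - L)) N,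
      sum_range_succ g (N + 1)]
    ring

lemma abs_sum_mul_sub_le {g v : ℕ → ℝ} {L ε K : ℝ} {T N : ℕ} (hv : v 0 = 1) (hva : Antitone v)
    (hv0 : ∀ k, 0 ≤ v k) (hK : ∀ n, |∑ k ∈ range n, g k - L| ≤ K)
    (hε : ∀ n ≥ T, |∑ k ∈ range (n + 1), g k - L| ≤ ε) (hN : T ≤ N) :
    |∑ k ∈ range (N + 1), g k * v k - L| ≤ ε + K * (1 - v T) := by
  have hK0 : 0 ≤ K := (abs_nonneg _).trans (hK 0)
  have hε0 : 0 ≤ ε := (abs_nonneg _).trans (hε T le_rfl)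
  rw [sum_mul_sub_eq_sum_by_parts g v L hv]
  have h1 : |v N * (∑ k ∈ range (N + 1), g k - L)| ≤ v N * ε := by
    rw [abs_mul, abs_of_nonneg (hv0 N)]
    exact mul_le_mul_of_nonneg_left (hε N hN) (hv0 N)
  have h2 : |∑ k ∈ range N, (v k - v (k + 1)) * (∑ j ∈ range (k + 1), g j - L)| ≤
      ε * (1 - v N) + K * (1 - v T) := by
    have hd : ∀ k, 0 ≤ v k - v (k + 1) := fun k => sub_nonneg.2 (hva (Nat.le_succ k))
    calc _ ≤ ∑ k ∈ range N, |(v k - v (k + 1)) * (∑ j ∈ range (k + 1), g j - L)| :=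
          abs_sum_le_sum_abs _ _
      _ = ∑ k ∈ range T, |(v k - v (k + 1)) * (∑ j ∈ range (k + 1), g j - L)| +
          ∑ k ∈ Ico T N, |(v k - v (k + 1)) * (∑ j ∈ range (k + 1), g j - L)| :=
          (sum_range_add_sum_Ico _ hN).symm
      _ ≤ ∑ k ∈ range T, (v k - v (k + 1)) * K + ∑ k ∈ Ico T N, (v k - v (k + 1)) * ε := by
          gcongr with k _ k hk
          · rw [abs_mul, abs_of_nonneg (hd k)]
            exact mul_le_mul_of_nonneg_left (hK _) (hd k)
          · rw [abs_mul, abs_of_nonneg (hd k)]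
            exact mul_le_mul_of_nonneg_left (hε _ (mem_Ico.1 hk).1) (hd k)
      _ ≤ ∑ k ∈ range T, (v k - v (k + 1)) * K + ∑ k ∈ range N, (v k - v (k + 1)) * ε := by
          gcongr
          · intro k _ _
            exact mul_nonneg (hd k) hε0
          · intro k hk
            exact mem_range.2 (mem_Ico.1 hk).2
      _ = _ := by
          rw [← sum_mul, ← sum_mul, sum_range_sub', sum_range_sub', hv]
          ring
  calc _ ≤ v N * ε + (ε * (1 - v N) + K * (1 - v T)) := (abs_add_le _ _).trans (add_le_add h1 h2)
    _ = _ := by ring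

/-- Abel's theorem for Dirichlet series on the real axis. -/
theorem tendsto_tsum_mul_rpow_neg {c : ℕ → ℝ} {L : ℝ} (hc : c 0 = 0)
    (h : Tendsto (fun n => ∑ k ∈ range n, c k) atTop (𝓝 L))
    (hs : ∀ s : ℝ, 0 < s → Summable fun k : ℕ => c k * (k : ℝ) ^ (-s)) :
    Tendsto (fun s : ℝ => ∑' k : ℕ, c k * (k : ℝ) ^ (-s)) (𝓝[>] 0) (𝓝 L) := by
  set g : ℕ → ℝ := fun k => c (k + 1) with hg
  have hgL : Tendsto (fun n => ∑ k ∈ range n, g k) atTop (𝓝 L) := by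
    refine ((tendsto_add_atTop_iff_nat 1).2 h).congr fun n => ?_
    rw [sum_range_succ', hc, add_zero]
  obtain ⟨K, hK⟩ : ∃ K, ∀ n, |∑ k ∈ range n, g k - L| ≤ K := by
    obtain ⟨K, hK⟩ := (hgL.sub_const L).abs.bddAbove_range
    exact ⟨K, fun n => hK ⟨n, rfl⟩⟩
  rw [Metric.tendsto_nhds]
  intro ε hε
  obtain ⟨T, hT⟩ := Metric.tendsto_atTop.1 hgL (ε / 3) (by positivity)
  have hlim : Tendsto (fun s : ℝ => K * (1 - ((T : ℝ) + 1) ^ (-s))) (𝓝[>] 0) (𝓝 0) := by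
    have : Tendsto (fun s : ℝ => K * (1 - ((T : ℝ) + 1) ^ (-s))) (𝓝 0)
        (𝓝 (K * (1 - ((T : ℝ) + 1) ^ (-(0 : ℝ))))) := by
      have hT0 : (T : ℝ) + 1 ≠ 0 := by positivity
      exact Continuous.tendsto (by fun_prop (disch := exact Or.inl hT0)) 0
    simp only [neg_zero, Real.rpow_zero, sub_self, mul_zero] at this
    exact this.mono_left nhdsWithin_le_nhds
  filter_upwards [self_mem_nhdsWithin, hlim.eventually_lt_const (show 0 < ε / 3 by positivity)]
    with s hs0 hsK
  have hs0 : 0 < s := hs0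
  have hva : Antitone fun k : ℕ => ((k : ℝ) + 1) ^ (-s) := by
    intro a b hab
    have : (a : ℝ) ≤ b := by exact_mod_cast hab
    exact Real.rpow_le_rpow_of_nonpos (by positivity) (by linarith) (by linarith)
  have hlimN : Tendsto (fun N => ∑ k ∈ range (N + 1), g k * ((k : ℝ) + 1) ^ (-s)) atTop
      (𝓝 (∑' k : ℕ, c k * (k : ℝ) ^ (-s))) := by
    refine ((tendsto_add_atTop_iff_nat 2).2 (hs s hs0).hasSum.tendsto_sum_nat).congr fun n => ?_
    rw [sum_range_succ', hc, zero_mul, add_zero]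
    simp [hg]
  have hb : |∑' k : ℕ, c k * (k : ℝ) ^ (-s) - L| ≤ ε / 3 + K * (1 - ((T : ℝ) + 1) ^ (-s)) := by
    refine le_of_tendsto (hlimN.sub_const L).abs ?_
    filter_upwards [eventually_ge_atTop T] with N hN
    refine abs_sum_mul_sub_le (v := fun k : ℕ => ((k : ℝ) + 1) ^ (-s)) (by simp) hva
      (fun k => by positivity) hK (fun n hn => ?_) hN
    have := hT (n + 1) (by omega)
    rw [Real.dist_eq] at this
    exact this.le
  rw [Real.dist_eq]
  linarith

lemma sum_primesLE_succ_eq_sum_range (f : ℕ → ℝ) (n : ℕ) :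
    ∑ p ∈ Nat.primesLE (n + 1), f p = ∑ i ∈ range n, if (i + 2).Prime then f (i + 2) else 0 := by
  rw [Nat.primesLE_eq_filter_range, sum_filter, sum_range_succ', sum_range_succ']
  simp [Nat.not_prime_one, Nat.not_prime_zero]

lemma abs_log_mul_log_log_sub_le {k : ℕ} (hk : 2 ≤ k) :
    |Real.log k * (Real.log (Real.log (k + 1)) - Real.log (Real.log k)) -
      (Real.log (k + 1) - Real.log k)| ≤ 1 / (k : ℝ) ^ 2 := by
  have hk2 : (2 : ℝ) ≤ k := by exact_mod_cast hk
  have h0 : 0 < Real.log k := Real.log_pos (by linarith)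
  have h01 : Real.log k ≤ Real.log (k + 1) := Real.log_le_log (by linarith) (by linarith)
  have h1 : 1 ≤ Real.log (k + 1) := by
    rw [Real.le_log_iff_exp_le (by linarith)]
    linarith [Real.exp_one_lt_d9]
  have hΔ : Real.log (k + 1) - Real.log k ≤ 1 / k := by
    rw [← Real.log_div (by linarith) (by linarith)]
    refine (Real.log_le_sub_one_of_pos (by positivity)).trans (le_of_eq ?_)
    field_simp; ring
  set a := Real.log k
  set b := Real.log (k + 1)
  rw [← Real.log_div (by linarith) (by linarith)]
  have hu : a * Real.log (b / a) ≤ b - a := by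
    have := mul_le_mul_of_nonneg_left
      (Real.log_le_sub_one_of_pos (show 0 < b / a by positivity)) h0.le
    refine this.trans (le_of_eq ?_)
    field_simp
  have hl : b - a - (b - a) ^ 2 ≤ a * Real.log (b / a) := by
    have := mul_le_mul_of_nonneg_left
      (Real.one_sub_inv_le_log_of_pos (show 0 < b / a by positivity)) h0.le
    refine le_trans ?_ this
    rw [inv_div, show a * (1 - a / b) = a * (b - a) / b by field_simp,
      le_div_iff₀ (by linarith)]
    nlinarith [mul_nonneg (sq_nonneg (b - a)) (sub_nonneg.2 h1)]
  have hsq : (b - a) ^ 2 ≤ 1 / (k : ℝ) ^ 2 := by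
    rw [← one_div_pow]
    exact pow_le_pow_left₀ (by linarith) hΔ 2
  rw [abs_le]
  constructor <;> linarith [sq_nonneg (b - a), show 0 ≤ 1 / (k : ℝ) ^ 2 by positivity]

lemma tendsto_log_log_succ_sub :
    Tendsto (fun n : ℕ => Real.log (Real.log ((n + 1 : ℕ) : ℝ)) - Real.log (Real.log n))
      atTop (𝓝 0) := by
  refine squeeze_zero_norm' (a := fun n : ℕ => (Real.log 2)⁻¹ * (2 / (n : ℝ))) ?_ ?_
  · filter_upwards [eventually_ge_atTop 2] with n hn
    have h := abs_log_mul_log_log_sub_le hn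
    have hn2 : (2 : ℝ) ≤ n := by exact_mod_cast hn
    have h0 : 0 < Real.log 2 := Real.log_pos (by norm_num)
    have h02 : Real.log 2 ≤ Real.log n := Real.log_le_log (by norm_num) hn2
    have hΔ : Real.log (n + 1) - Real.log n ≤ 1 / n := by
      rw [← Real.log_div (by linarith) (by linarith)]
      refine (Real.log_le_sub_one_of_pos (by positivity)).trans (le_of_eq ?_)
      field_simp; ring
    have hm : 0 ≤ Real.log (Real.log (n + 1)) - Real.log (Real.log n) :=
      sub_nonneg.2 (Real.log_le_log (by linarith) (Real.log_le_log (by linarith) (by linarith)))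
    have hsq : 1 / (n : ℝ) ^ 2 ≤ 1 / n :=
      one_div_le_one_div_of_le (by linarith) (by nlinarith)
    push_cast
    rw [Real.norm_eq_abs, abs_of_nonneg hm, ← div_eq_inv_mul, le_div_iff₀ h0]
    have := (abs_le.1 h).2
    have h2 : (2 : ℝ) / n = 1 / n + 1 / n := by ring
    nlinarith
  · have : Tendsto (fun n : ℕ => (2 : ℝ) / n) atTop (𝓝 0) :=
      tendsto_const_div_atTop_nhds_zero_nat 2
    simpa using this.const_mul (Real.log 2)⁻¹

/-- **Mertens' second theorem**, without identification of the constant. -/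
theorem exists_tendsto_sum_inv_primes_sub_log_log :
    ∃ L : ℝ, Tendsto (fun n : ℕ => ∑ p ∈ Nat.primesLE n, 1 / (p : ℝ) - Real.log (Real.log n))
      atTop (𝓝 L) := by
  obtain ⟨C, hC⟩ := abs_sum_log_div_sub_log_le
  set e : ℕ → ℝ := fun k => Real.log (Real.log ((k + 1 : ℕ) : ℝ)) - Real.log (Real.log k) with he
  set f : ℕ → ℝ := fun i => 1 / Real.log ((i + 2 : ℕ) : ℝ) with hf
  set z : ℕ → ℝ := fun i => (if (i + 2).Prime then Real.log ((i + 2 : ℕ) : ℝ) / ((i + 2 : ℕ) : ℝ)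
    else 0) - Real.log ((i + 2 : ℕ) : ℝ) * e (i + 2) with hz
  have hpos : ∀ i : ℕ, 0 < Real.log ((i + 2 : ℕ) : ℝ) := fun i =>
    Real.log_pos (by push_cast; linarith [(Nat.cast_nonneg i : (0 : ℝ) ≤ i)])
  have hfa : Antitone f := by
    intro i j hij
    refine one_div_le_one_div_of_le (hpos i) (Real.log_le_log (by positivity) ?_)
    exact_mod_cast Nat.add_le_add_right hij 2
  have hf0 : Tendsto f atTop (𝓝 0) := by
    have h1 : Tendsto (fun i : ℕ => Real.log ((i + 2 : ℕ) : ℝ)) atTop atTop :=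
      Real.tendsto_log_atTop.comp
        (tendsto_natCast_atTop_atTop.comp (tendsto_add_atTop_nat 2))
    simp only [hf, one_div]
    exact h1.inv_tendsto_atTop
  have hsq : Summable fun k : ℕ => 1 / (k : ℝ) ^ 2 := Real.summable_one_div_nat_pow.2 (by norm_num)
  set K := ∑' i : ℕ, 1 / ((i + 2 : ℕ) : ℝ) ^ 2 with hKdef
  have hsq2 : Summable fun i : ℕ => 1 / ((i + 2 : ℕ) : ℝ) ^ 2 := (summable_nat_add_iff 2).2 hsq
  have hzb : ∀ n, ‖∑ i ∈ range n, z i‖ ≤ C + K + (1 + Real.log 2) := by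
    intro n
    have h1 : ∑ i ∈ range n, z i =
        (∑ p ∈ Nat.primesLE (n + 1), Real.log p / p - Real.log ((n + 1 : ℕ) : ℝ)) -
        ∑ i ∈ range n, (Real.log ((i + 2 : ℕ) : ℝ) * e (i + 2) -
          (Real.log (((i + 1) + 2 : ℕ) : ℝ) - Real.log ((i + 2 : ℕ) : ℝ))) -
        (Real.log ((n + 2 : ℕ) : ℝ) - Real.log ((n + 1 : ℕ) : ℝ) - Real.log 2) := by
      rw [sum_primesLE_succ_eq_sum_range (fun p => Real.log p / p), sum_sub_distrib,
        sum_sub_distrib, sum_range_sub fun i : ℕ => Real.log ((i + 2 : ℕ) : ℝ)]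
      push_cast
      ring
    have h2 : |∑ i ∈ range n, (Real.log ((i + 2 : ℕ) : ℝ) * e (i + 2) -
          (Real.log (((i + 1) + 2 : ℕ) : ℝ) - Real.log ((i + 2 : ℕ) : ℝ)))| ≤ K := by
      refine (abs_sum_le_sum_abs _ _).trans (le_trans (sum_le_sum fun i _ => ?_)
        (hsq2.sum_le_tsum (range n) fun _ _ => by positivity))
      have := abs_log_mul_log_log_sub_le (k := i + 2) (by omega)
      simp only [he]
      push_cast at this ⊢
      rw [show (i : ℝ) + 1 + 2 = i + 2 + 1 by ring]
      exact this
    have h3 : |Real.log ((n + 2 : ℕ) : ℝ) - Real.log ((n + 1 : ℕ) : ℝ) - Real.log 2| ≤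
        1 + Real.log 2 := by
      have hn : (0 : ℝ) ≤ n := Nat.cast_nonneg n
      have hl2 : 0 ≤ Real.log 2 := Real.log_nonneg (by norm_num)
      have ha : 0 ≤ Real.log ((n + 2 : ℕ) : ℝ) - Real.log ((n + 1 : ℕ) : ℝ) := by
        refine sub_nonneg.2 (Real.log_le_log (by positivity) ?_)
        push_cast; linarith
      have hb : Real.log ((n + 2 : ℕ) : ℝ) - Real.log ((n + 1 : ℕ) : ℝ) ≤ 1 := by
        rw [← Real.log_div (by positivity) (by positivity)]
        refine (Real.log_le_sub_one_of_pos (by positivity)).trans ?_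
        rw [sub_le_iff_le_add, div_le_iff₀ (by positivity)]
        push_cast; linarith
      rw [abs_le]
      constructor <;> linarith
    rw [Real.norm_eq_abs, h1]
    have h4 := hC (n + 1) (by omega)
    exact (abs_sub _ _).trans (add_le_add ((abs_sub _ _).trans (add_le_add h4 h2)) h3)
  obtain ⟨L, hL⟩ := cauchySeq_tendsto_of_complete
    (hfa.cauchySeq_series_mul_of_tendsto_zero_of_bounded hf0 hzb)
  have hS : ∀ n, ∑ i ∈ range n, f i • z i = ∑ p ∈ Nat.primesLE (n + 1), 1 / (p : ℝ) -
      Real.log (Real.log ((n + 2 : ℕ) : ℝ)) + Real.log (Real.log 2) := by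
    intro n
    rw [sum_primesLE_succ_eq_sum_range (fun p => 1 / (p : ℝ)), sub_add]
    have : Real.log (Real.log ((n + 2 : ℕ) : ℝ)) - Real.log (Real.log 2) =
        ∑ i ∈ range n, e (i + 2) := by
      have := sum_range_sub (fun i : ℕ => Real.log (Real.log ((i + 2 : ℕ) : ℝ))) n
      simp only [zero_add, Nat.cast_ofNat] at this
      rw [← this]
    rw [this, ← sum_sub_distrib]
    refine sum_congr rfl fun i _ => ?_
    simp only [hf, hz, smul_eq_mul, mul_sub, mul_ite, mul_zero]
    have := (hpos i).ne'
    congr 1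
    · split_ifs
      · field_simp
      · rfl
    · field_simp
  refine ⟨L - Real.log (Real.log 2) + 0, (tendsto_add_atTop_iff_nat 1).1 ?_⟩
  have h5 := (tendsto_add_atTop_iff_nat 1).2 tendsto_log_log_succ_sub
  refine ((hL.sub_const (Real.log (Real.log 2))).add h5).congr fun n => ?_
  rw [hS]
  ring

/-- The quantity `-log (1 - x) - x`. -/
noncomputable def logDefect (x : ℝ) : ℝ := -Real.log (1 - x) - x

lemma logDefect_nonneg {x : ℝ} (hx : x < 1) : 0 ≤ logDefect x := by
  have := Real.log_le_sub_one_of_pos (show 0 < 1 - x by linarith)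
  unfold logDefect
  linarith

lemma logDefect_le {x : ℝ} (hx0 : 0 ≤ x) (hx : x ≤ 1 / 2) : logDefect x ≤ 2 * x ^ 2 := by
  have h := Real.abs_log_sub_add_sum_range_le (x := x) (by rw [abs_of_nonneg hx0]; linarith) 1
  simp only [range_one, sum_singleton, zero_add, pow_one, Nat.cast_zero, div_one,
    abs_of_nonneg hx0] at h
  have h2 : x ^ (1 + 1) / (1 - x) ≤ 2 * x ^ 2 := by
    rw [div_le_iff₀ (by linarith)]
    have := mul_nonneg (sq_nonneg x) (show 0 ≤ 1 - 2 * x by linarith)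
    ring_nf at this ⊢
    linarith
  unfold logDefect
  linarith [(abs_le.1 h).1]

lemma rpow_neg_one_add_le {n : ℕ} (hn : 1 ≤ n) {s : ℝ} (hs : 0 ≤ s) :
    (n : ℝ) ^ (-(1 + s)) ≤ 1 / n := by
  rw [one_div, ← Real.rpow_neg_one]
  exact Real.rpow_le_rpow_of_exponent_le (by exact_mod_cast hn) (by linarith)

lemma logDefect_prime_le {p : ℕ} (hp : p.Prime) {s : ℝ} (hs : 0 ≤ s) :
    logDefect ((p : ℝ) ^ (-(1 + s))) ≤ 2 * (1 / (p : ℝ) ^ 2) := by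
  have h1 := rpow_neg_one_add_le hp.one_le hs
  have h2 : (1 : ℝ) / p ≤ 1 / 2 := one_div_le_one_div_of_le (by norm_num) (by exact_mod_cast hp.two_le)
  have h0 : 0 ≤ (p : ℝ) ^ (-(1 + s)) := by positivity
  refine (logDefect_le h0 (h1.trans h2)).trans ?_
  rw [← one_div_pow]
  gcongr

lemma summable_ite_prime_logDefect :
    Summable fun n : ℕ => if n.Prime then logDefect (1 / (n : ℝ)) else 0 := by
  refine Summable.of_nonneg_of_le (fun n => ?_) (fun n => ?_)
    ((Real.summable_one_div_nat_pow.2 one_lt_two).mul_left 2)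
  · split_ifs with hn
    · refine logDefect_nonneg ?_
      rw [div_lt_one (by exact_mod_cast hn.pos)]
      exact_mod_cast hn.one_lt
    · rfl
  · split_ifs with hn
    · have := logDefect_prime_le hn (s := 0) le_rfl
      rwa [add_zero, Real.rpow_neg_one, ← one_div] at this
    · positivity

lemma hasSum_ite_prime_neg_log {s : ℝ} (hs : 0 < s) :
    HasSum (fun n : ℕ => if n.Prime then -Real.log (1 - (n : ℝ) ^ (-(1 + s))) else 0)
      (Real.log (∑' n : ℕ, 1 / (n : ℝ) ^ (1 + s))) := by
  have hsum : Summable fun n : ℕ => 1 / (n : ℝ) ^ (1 + s) :=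
    Real.summable_one_div_nat_rpow.2 (by linarith)
  set Z := ∑' n : ℕ, 1 / (n : ℝ) ^ (1 + s) with hZ
  have hZpos : 0 < Z := hsum.tsum_pos (fun _ => by positivity) 1 (by simp)
  let f : ℕ →*₀ ℝ :=
    { toFun := fun n => (n : ℝ) ^ (-(1 + s))
      map_zero' := by
        show ((0 : ℕ) : ℝ) ^ (-(1 + s)) = 0
        rw [Nat.cast_zero, Real.zero_rpow (by linarith)]
      map_one' := by simp
      map_mul' := fun m n => by
        simp [Real.mul_rpow (Nat.cast_nonneg m) (Nat.cast_nonneg n)] }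
  have hf : ∀ n : ℕ, f n = 1 / (n : ℝ) ^ (1 + s) := fun n => by
    show (n : ℝ) ^ (-(1 + s)) = _
    rw [Real.rpow_neg (Nat.cast_nonneg n), one_div]
  have hfs : Summable fun n => ‖f n‖ := by
    refine hsum.congr fun n => ?_
    rw [hf, Real.norm_of_nonneg (by positivity)]
  have hprod := EulerProduct.eulerProduct_completely_multiplicative_hasProd hfs
  rw [Nat.Primes.hasProd_iff_hasProd_ite (fun n => (1 - f n)⁻¹),
    show ∑' n, f n = Z from tsum_congr hf] at hprod
  have hlog := (Real.continuousAt_log hZpos.ne').tendsto.comp hprod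
  refine hlog.congr fun t => ?_
  have hlt : ∀ n : ℕ, n.Prime → 0 < 1 - f n := fun n hn => by
    show 0 < 1 - (n : ℝ) ^ (-(1 + s))
    have h1 := rpow_neg_one_add_le hn.one_le hs.le
    have h2 : (1 : ℝ) / n ≤ 1 / 2 :=
      one_div_le_one_div_of_le (by norm_num) (by exact_mod_cast hn.two_le)
    linarith
  rw [Function.comp_apply, Real.log_prod]
  · refine sum_congr rfl fun n _ => ?_
    show Real.log (if n.Prime then (1 - f n)⁻¹ else 1) =
      if n.Prime then -Real.log (1 - (n : ℝ) ^ (-(1 + s))) else 0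
    split_ifs
    · rw [Real.log_inv]; rfl
    · simp
  · intro n _
    split_ifs with hn
    · exact inv_ne_zero (hlt n hn).ne'
    · exact one_ne_zero

lemma tendsto_log_tsum_add_log :
    Tendsto (fun s : ℝ => Real.log (∑' n : ℕ, 1 / (n : ℝ) ^ (1 + s)) + Real.log s)
      (𝓝[>] 0) (𝓝 0) := by
  have h1 : Tendsto (fun s : ℝ => 1 + s) (𝓝[>] 0) (𝓝[>] 1) := by
    refine tendsto_nhdsWithin_iff.2 ⟨?_, ?_⟩
    · have : Tendsto (fun s : ℝ => 1 + s) (𝓝 0) (𝓝 (1 + 0)) := by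
        exact Continuous.tendsto (by fun_prop) 0
      rw [add_zero] at this
      exact this.mono_left nhdsWithin_le_nhds
    · filter_upwards [self_mem_nhdsWithin] with s hs
      have : 0 < s := hs
      show 1 < 1 + s
      linarith
  have h2 := (Real.continuousAt_log one_ne_zero).tendsto.comp
    (tendsto_sub_mul_tsum_nat_rpow.comp h1)
  rw [Real.log_one] at h2
  refine h2.congr' ?_
  filter_upwards [self_mem_nhdsWithin] with s hs
  have hs : 0 < s := hs
  have hsum : Summable fun n : ℕ => 1 / (n : ℝ) ^ (1 + s) :=
    Real.summable_one_div_nat_rpow.2 (by linarith)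
  have hZpos := hsum.tsum_pos (fun _ => by positivity) 1 (by simp)
  simp only [Function.comp_apply, add_sub_cancel_left]
  rw [Real.log_mul hs.ne' hZpos.ne', add_comm]

lemma ite_prime_mul_rpow (s : ℝ) (n : ℕ) :
    (if n.Prime then 1 / (n : ℝ) else 0) * (n : ℝ) ^ (-s) =
      if n.Prime then (n : ℝ) ^ (-(1 + s)) else 0 := by
  split_ifs with hn
  · have : (0 : ℝ) < n := by exact_mod_cast hn.pos
    rw [neg_add, Real.rpow_add this, Real.rpow_neg_one, one_div]
  · simp

lemma summable_ite_prime_mul_rpow {s : ℝ} (hs : 0 < s) :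
    Summable fun n : ℕ => (if n.Prime then 1 / (n : ℝ) else 0) * (n : ℝ) ^ (-s) := by
  refine Summable.of_nonneg_of_le (fun n => by positivity) (fun n => ?_)
    (Real.summable_nat_rpow.2 (show -(1 + s) < -1 by linarith))
  rw [ite_prime_mul_rpow]
  split_ifs
  · rfl
  · positivity

lemma tendsto_tsum_ite_prime_logDefect :
    Tendsto (fun s : ℝ => ∑' n : ℕ, if n.Prime then logDefect ((n : ℝ) ^ (-(1 + s))) else 0)
      (𝓝[>] 0) (𝓝 (∑' n : ℕ, if n.Prime then logDefect (1 / (n : ℝ)) else 0)) := by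
  refine tendsto_tsum_of_dominated_convergence
    ((Real.summable_one_div_nat_pow.2 one_lt_two).mul_left 2) (fun n => ?_) ?_
  · split_ifs with hn
    · have hn0 : (n : ℝ) ≠ 0 := by exact_mod_cast hn.ne_zero
      have h1 : Tendsto (fun s : ℝ => (n : ℝ) ^ (-(1 + s))) (𝓝[>] 0) (𝓝 (1 / (n : ℝ))) := by
        have : Tendsto (fun s : ℝ => (n : ℝ) ^ (-(1 + s))) (𝓝 0) (𝓝 ((n : ℝ) ^ (-(1 + (0 : ℝ))))) :=
          Continuous.tendsto (by fun_prop (disch := exact Or.inl hn0)) 0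
        rw [add_zero, Real.rpow_neg_one, ← one_div] at this
        exact this.mono_left nhdsWithin_le_nhds
      have h2 : ContinuousAt logDefect (1 / (n : ℝ)) := by
        have : 1 - 1 / (n : ℝ) ≠ 0 := by
          have : (1 : ℝ) / n < 1 := by
            rw [div_lt_one (by exact_mod_cast hn.pos)]
            exact_mod_cast hn.one_lt
          linarith
        unfold logDefect
        fun_prop (disch := assumption)
      exact h2.tendsto.comp h1
    · exact tendsto_const_nhds
  · filter_upwards [self_mem_nhdsWithin] with s hs n
    have hs : 0 < s := hs
    split_ifs with hn
    · have h1 := rpow_neg_one_add_le hn.one_le hs.le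
      have h2 : (1 : ℝ) / n ≤ 1 / 2 :=
        one_div_le_one_div_of_le (by norm_num) (by exact_mod_cast hn.two_le)
      rw [Real.norm_of_nonneg (logDefect_nonneg (by linarith))]
      exact logDefect_prime_le hn hs.le
    · rw [norm_zero]; positivity

theorem tendsto_tsum_ite_prime_add_log :
    Tendsto (fun s : ℝ => ∑' n : ℕ, (if n.Prime then 1 / (n : ℝ) else 0) * (n : ℝ) ^ (-s) +
      Real.log s) (𝓝[>] 0)
      (𝓝 (-∑' n : ℕ, if n.Prime then logDefect (1 / (n : ℝ)) else 0)) := by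
  have h := tendsto_log_tsum_add_log.sub tendsto_tsum_ite_prime_logDefect
  rw [zero_sub] at h
  refine h.congr' ?_
  filter_upwards [self_mem_nhdsWithin] with s hs
  have hs : 0 < s := hs
  have h1 := hasSum_ite_prime_neg_log hs
  have h2 := (summable_ite_prime_mul_rpow hs).hasSum
  have h3 : ∑' n : ℕ, (if n.Prime then logDefect ((n : ℝ) ^ (-(1 + s))) else 0) =
      Real.log (∑' n : ℕ, 1 / (n : ℝ) ^ (1 + s)) -
        ∑' n : ℕ, (if n.Prime then 1 / (n : ℝ) else 0) * (n : ℝ) ^ (-s) := by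
    rw [← (h1.sub h2).tsum_eq]
    refine tsum_congr fun n => ?_
    rw [ite_prime_mul_rpow]
    split_ifs
    · rfl
    · simp
  rw [h3]
  ring

/-- The least integer which is at least `exp (m + 1)`. -/
noncomputable def ceilExp (m : ℕ) : ℕ := ⌈Real.exp (m + 1)⌉₊

lemma exp_le_ceilExp (m : ℕ) : Real.exp (m + 1) ≤ ceilExp m := Nat.le_ceil _

lemma ceilExp_strictMono : StrictMono ceilExp := by
  refine strictMono_nat_of_lt_succ fun m => ?_
  have h1 : (ceilExp m : ℝ) < Real.exp (m + 1) + 1 := Nat.ceil_lt_add_one (Real.exp_pos _).le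
  have h2 := exp_le_ceilExp (m + 1)
  have h3 : Real.exp (m + 1) + 1 ≤ Real.exp ((m + 1 : ℕ) + 1) := by
    push_cast
    rw [Real.exp_add (m + 1 : ℝ) 1]
    have h4 : 1 ≤ Real.exp (m + 1) := Real.one_le_exp (by positivity)
    have h5 := Real.exp_one_gt_d9
    nlinarith
  exact_mod_cast (h1.trans_le h3).trans_le h2

/-- The weight `1 / m` placed at the least integer which is at least `exp m`. -/
noncomputable def expWeight : ℕ → ℝ := Function.extend ceilExp (fun m => 1 / ((m : ℝ) + 1)) 0

lemma sum_range_expWeight {n : ℕ} (hn : 1 ≤ n) :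
    ∑ k ∈ range (n + 1), expWeight k = harmonic ⌊Real.log n⌋₊ := by
  have hinj := ceilExp_strictMono.injective
  have hmem : ∀ m, ceilExp m ≤ n ↔ m < ⌊Real.log n⌋₊ := by
    intro m
    have hn0 : (0 : ℝ) < n := by exact_mod_cast hn
    rw [ceilExp, Nat.ceil_le, ← Real.le_log_iff_exp_le hn0, ← Nat.succ_le_iff,
      Nat.le_floor_iff (Real.log_natCast_nonneg n)]
    simp
  have h1 : ∑ k ∈ (range ⌊Real.log n⌋₊).image ceilExp, expWeight k =
      ∑ k ∈ range (n + 1), expWeight k := by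
    refine sum_subset ?_ ?_
    · intro k hk
      obtain ⟨m, hm, rfl⟩ := mem_image.1 hk
      exact mem_range.2 (Nat.lt_succ_iff.2 ((hmem m).2 (mem_range.1 hm)))
    · intro k hk hk'
      refine Function.extend_apply' _ _ _ ?_
      rintro ⟨m, rfl⟩
      exact hk' (mem_image_of_mem _ (mem_range.2 ((hmem m).1 (Nat.lt_succ_iff.1 (mem_range.1 hk)))))
  rw [← h1, sum_image hinj.injOn, harmonic]
  push_cast
  refine sum_congr rfl fun m _ => ?_
  rw [expWeight, hinj.extend_apply, one_div]

lemma expWeight_zero : expWeight 0 = 0 := by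
  refine Function.extend_apply' _ _ _ ?_
  rintro ⟨m, hm⟩
  have := exp_le_ceilExp m
  rw [hm] at this
  have := Real.exp_pos (m + 1 : ℝ)
  simp at *
  linarith

lemma hasSum_expWeight_iff {s a : ℝ} :
    HasSum (fun k : ℕ => expWeight k * (k : ℝ) ^ (-s)) a ↔
      HasSum (fun m : ℕ => 1 / ((m : ℝ) + 1) * (ceilExp m : ℝ) ^ (-s)) a := by
  have hinj := ceilExp_strictMono.injective
  have : (fun k : ℕ => expWeight k * (k : ℝ) ^ (-s)) =
      Function.extend ceilExp (fun m : ℕ => 1 / ((m : ℝ) + 1) * (ceilExp m : ℝ) ^ (-s)) 0 := by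
    funext k
    by_cases hk : ∃ m, ceilExp m = k
    · obtain ⟨m, rfl⟩ := hk
      rw [expWeight, hinj.extend_apply, hinj.extend_apply]
    · rw [expWeight, Function.extend_apply' _ _ _ hk, Function.extend_apply' _ _ _ hk]
      simp
  rw [this, hasSum_extend_zero hinj]

lemma exp_neg_sub_ceilExp_rpow {s : ℝ} (hs : 0 < s) (m : ℕ) :
    (ceilExp m : ℝ) ^ (-s) ≤ Real.exp (-s) ^ (m + 1) ∧
      Real.exp (-s) ^ (m + 1) - (ceilExp m : ℝ) ^ (-s) ≤ s * Real.exp (-1) ^ (m + 1) := by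
  have he := exp_le_ceilExp m
  have hpos : (0 : ℝ) < ceilExp m := (Real.exp_pos _).trans_le he
  have h1 : (m + 1 : ℝ) ≤ Real.log (ceilExp m) := (Real.le_log_iff_exp_le hpos).2 he
  have h2 : Real.log (ceilExp m) - (m + 1) ≤ Real.exp (-1) ^ (m + 1) := by
    have h3 : Real.log (ceilExp m) - (m + 1) =
        Real.log (ceilExp m * Real.exp (-(m + 1))) := by
      rw [Real.log_mul hpos.ne' (Real.exp_pos _).ne', Real.log_exp]
      ring
    have h4 : (ceilExp m : ℝ) < Real.exp (m + 1) + 1 := Nat.ceil_lt_add_one (Real.exp_pos _).le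
    have h5 : Real.exp (m + 1) * Real.exp (-(m + 1)) = 1 := by
      rw [← Real.exp_add]; simp
    have h6 : Real.exp (-1) ^ (m + 1) = Real.exp (-(m + 1)) := by
      rw [← Real.exp_nat_mul]; push_cast; ring_nf
    rw [h3, h6]
    refine (Real.log_le_sub_one_of_pos (mul_pos hpos (Real.exp_pos _))).trans ?_
    nlinarith [Real.exp_pos (-(m + 1 : ℝ))]
  have h7 : (ceilExp m : ℝ) ^ (-s) = Real.exp (-(s * Real.log (ceilExp m))) := by
    rw [Real.rpow_def_of_pos hpos]; ring_nf
  have h8 : Real.exp (-s) ^ (m + 1) = Real.exp (-(s * (m + 1))) := by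
    rw [← Real.exp_nat_mul]; push_cast; ring_nf
  refine ⟨?_, ?_⟩
  · rw [h7, h8, Real.exp_le_exp, neg_le_neg_iff]
    gcongr
  · set δ := Real.log (ceilExp m) - (m + 1) with hδ
    have h9 : Real.exp (-(s * Real.log (ceilExp m))) =
        Real.exp (-(s * (m + 1))) * Real.exp (-(s * δ)) := by
      rw [← Real.exp_add, hδ]; ring_nf
    have h10 : Real.exp (-(s * (m + 1))) ≤ 1 := by
      rw [Real.exp_le_one_iff, neg_nonpos]
      positivity
    have h11 := Real.add_one_le_exp (-(s * δ))
    have h12 : 0 ≤ δ := by linarith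
    rw [h7, h8, h9]
    calc Real.exp (-(s * (m + 1))) - Real.exp (-(s * (m + 1))) * Real.exp (-(s * δ))
        = Real.exp (-(s * (m + 1))) * (1 - Real.exp (-(s * δ))) := by ring
      _ ≤ Real.exp (-(s * (m + 1))) * (s * δ) := by gcongr; linarith
      _ ≤ 1 * (s * δ) := by gcongr
      _ ≤ _ := by rw [one_mul]; gcongr

lemma tendsto_neg_log_one_sub_exp_add_log :
    Tendsto (fun s : ℝ => -Real.log (1 - Real.exp (-s)) + Real.log s) (𝓝[>] 0) (𝓝 0) := by
  have h1 : HasDerivAt (fun s : ℝ => 1 - Real.exp (-s)) 1 0 := by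
    have := ((hasDerivAt_neg (0 : ℝ)).exp).const_sub 1
    simpa using this
  have h2 := (hasDerivAt_iff_tendsto_slope.1 h1).mono_left
    (nhdsWithin_mono 0 (fun x (hx : 0 < x) => (ne_of_gt hx : x ≠ 0)))
  have h3 := ((Real.continuousAt_log one_ne_zero).tendsto.comp h2).neg
  rw [Real.log_one, neg_zero] at h3
  refine h3.congr' ?_
  filter_upwards [self_mem_nhdsWithin] with s hs
  have hs : 0 < s := hs
  have h4 : 0 < 1 - Real.exp (-s) := by
    have := Real.exp_lt_one_iff.2 (show -s < 0 by linarith)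
    linarith
  simp only [Function.comp_apply, slope_def_field, neg_zero, Real.exp_zero, sub_self, sub_zero]
  rw [Real.log_div h4.ne' hs.ne']
  ring

lemma summable_and_tendsto_tsum_expWeight :
    (∀ s : ℝ, 0 < s → Summable fun k : ℕ => expWeight k * (k : ℝ) ^ (-s)) ∧
    Tendsto (fun s : ℝ => ∑' k : ℕ, expWeight k * (k : ℝ) ^ (-s) + Real.log s)
      (𝓝[>] 0) (𝓝 0) := by
  have hE : Summable fun m : ℕ => Real.exp (-1) ^ (m + 1) :=
    (summable_nat_add_iff 1).2 (summable_geometric_of_lt_one (Real.exp_pos _).le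
      (Real.exp_lt_one_iff.2 (by norm_num)))
  have hlog : ∀ s : ℝ, 0 < s →
      HasSum (fun m : ℕ => Real.exp (-s) ^ (m + 1) / ((m : ℝ) + 1))
        (-Real.log (1 - Real.exp (-s))) := fun s hs =>
    Real.hasSum_pow_div_log_of_abs_lt_one (by
      rw [abs_of_pos (Real.exp_pos _)]
      exact Real.exp_lt_one_iff.2 (by linarith))
  have hsum : ∀ s : ℝ, 0 < s →
      Summable fun m : ℕ => 1 / ((m : ℝ) + 1) * (ceilExp m : ℝ) ^ (-s) := fun s hs =>
    Summable.of_nonneg_of_le (fun m => by positivity) (fun m => by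
      rw [one_div_mul_eq_div]
      gcongr
      exact (exp_neg_sub_ceilExp_rpow hs m).1) (hlog s hs).summable
  refine ⟨fun s hs => (hasSum_expWeight_iff.2 (hsum s hs).hasSum).summable, ?_⟩
  have hdiff : Tendsto (fun s : ℝ => -Real.log (1 - Real.exp (-s)) -
      ∑' k : ℕ, expWeight k * (k : ℝ) ^ (-s)) (𝓝[>] 0) (𝓝 0) := by
    have h0 : Tendsto (fun s : ℝ => s * ∑' m : ℕ, Real.exp (-1) ^ (m + 1)) (𝓝[>] 0) (𝓝 0) := by
      have : Tendsto (fun s : ℝ => s * ∑' m : ℕ, Real.exp (-1) ^ (m + 1)) (𝓝 0)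
          (𝓝 (0 * ∑' m : ℕ, Real.exp (-1) ^ (m + 1))) := Continuous.tendsto (by fun_prop) 0
      rw [zero_mul] at this
      exact this.mono_left nhdsWithin_le_nhds
    refine squeeze_zero' ?_ ?_ h0
    all_goals
      filter_upwards [self_mem_nhdsWithin] with s hs
      have hs : 0 < s := hs
      have h1 := hlog s hs
      have h2 := (hsum s hs).hasSum
      have h3 := h1.sub h2
      rw [(hasSum_expWeight_iff.2 h2).tsum_eq]
    · refine h3.nonneg fun m => sub_nonneg.2 ?_
      rw [one_div_mul_eq_div]
      gcongr
      exact (exp_neg_sub_ceilExp_rpow hs m).1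
    · refine hasSum_le (fun m => ?_) h3 (hE.hasSum.mul_left s)
      rw [one_div_mul_eq_div, ← sub_div]
      refine (div_le_self (sub_nonneg.2 (exp_neg_sub_ceilExp_rpow hs m).1) (by simp)).trans ?_
      exact (exp_neg_sub_ceilExp_rpow hs m).2
  have := tendsto_neg_log_one_sub_exp_add_log.sub hdiff
  rw [sub_zero] at this
  refine this.congr fun s => ?_
  ring

lemma tendsto_harmonic_floor_log_sub :
    Tendsto (fun n : ℕ => (harmonic ⌊Real.log n⌋₊ : ℝ) - Real.log (Real.log n)) atTop
      (𝓝 Real.eulerMascheroniConstant) := by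
  have hl : Tendsto (fun n : ℕ => Real.log n) atTop atTop :=
    Real.tendsto_log_atTop.comp tendsto_natCast_atTop_atTop
  have h1 := Real.tendsto_harmonic_sub_log.comp ((tendsto_nat_floor_atTop (α := ℝ)).comp hl)
  have h2 := ((Real.continuousAt_log one_ne_zero).tendsto.comp
    (tendsto_nat_floor_div_atTop (R := ℝ))).comp hl
  have h3 := h1.add h2
  rw [Real.log_one, add_zero] at h3
  refine h3.congr' ?_
  filter_upwards [hl.eventually_ge_atTop 1] with n hn
  have : (⌊Real.log n⌋₊ : ℝ) ≠ 0 := by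
    have := Nat.floor_pos.2 hn
    positivity
  simp only [Function.comp_apply]
  rw [Real.log_div this (by linarith)]
  ring

/-- **Mertens' second theorem**. -/
theorem tendsto_sum_inv_primes_sub_log_log :
    Tendsto (fun n : ℕ => ∑ p ∈ Nat.primesLE n, 1 / (p : ℝ) - Real.log (Real.log n)) atTop
      (𝓝 (Real.eulerMascheroniConstant -
        ∑' n : ℕ, if n.Prime then logDefect (1 / (n : ℝ)) else 0)) := by
  obtain ⟨L, hL⟩ := exists_tendsto_sum_inv_primes_sub_log_log
  obtain ⟨hws, hwt⟩ := summable_and_tendsto_tsum_expWeight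
  set M := ∑' n : ℕ, if n.Prime then logDefect (1 / (n : ℝ)) else 0
  set c : ℕ → ℝ := fun k => (if k.Prime then 1 / (k : ℝ) else 0) - expWeight k with hc
  have hpart : Tendsto (fun n => ∑ k ∈ range n, c k) atTop
      (𝓝 (L - Real.eulerMascheroniConstant)) := by
    refine (tendsto_add_atTop_iff_nat 1).1 ?_
    refine (hL.sub tendsto_harmonic_floor_log_sub).congr' ?_
    filter_upwards [eventually_ge_atTop 1] with n hn
    rw [hc, sum_sub_distrib, sum_range_expWeight hn, Nat.primesLE_eq_filter_range, sum_filter]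
    ring
  have hcs : ∀ s : ℝ, 0 < s → Summable fun k : ℕ => c k * (k : ℝ) ^ (-s) := fun s hs => by
    simp only [hc, sub_mul]
    exact (summable_ite_prime_mul_rpow hs).sub (hws s hs)
  have h1 := tendsto_tsum_mul_rpow_neg (by simp [hc, expWeight_zero]) hpart hcs
  have h2 : Tendsto (fun s : ℝ => ∑' k : ℕ, c k * (k : ℝ) ^ (-s)) (𝓝[>] 0) (𝓝 (-M - 0)) := by
    refine (tendsto_tsum_ite_prime_add_log.sub hwt).congr' ?_
    filter_upwards [self_mem_nhdsWithin] with s hs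
    simp only [hc, sub_mul]
    rw [(summable_ite_prime_mul_rpow hs).tsum_sub (hws s hs)]
    ring
  have h3 := tendsto_nhds_unique h1 h2
  rwa [show Real.eulerMascheroniConstant - M = L by linarith]

/-- **Mertens' third theorem**. -/
theorem tendsto_log_mul_prod_one_sub_inv :
    Tendsto (fun n : ℕ => Real.log n * ∏ p ∈ Nat.primesLE n, (1 - 1 / (p : ℝ))) atTop
      (𝓝 (Real.exp (-Real.eulerMascheroniConstant))) := by
  have h1 : Tendsto (fun n : ℕ => ∑ p ∈ Nat.primesLE n, logDefect (1 / (p : ℝ))) atTop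
      (𝓝 (∑' n : ℕ, if n.Prime then logDefect (1 / (n : ℝ)) else 0)) := by
    refine ((tendsto_add_atTop_iff_nat 1).2
      summable_ite_prime_logDefect.hasSum.tendsto_sum_nat).congr fun n => ?_
    rw [Nat.primesLE_eq_filter_range, sum_filter]
  have h2 := (Real.continuous_exp.tendsto _).comp (tendsto_sum_inv_primes_sub_log_log.add h1).neg
  rw [sub_add_cancel] at h2
  refine h2.congr' ?_
  filter_upwards [eventually_ge_atTop 2] with n hn
  have hlog : 0 < Real.log n := Real.log_pos (by exact_mod_cast hn)
  have h3 : ∀ p ∈ Nat.primesLE n, 0 < 1 - 1 / (p : ℝ) := fun p hp => by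
    have : (2 : ℝ) ≤ p := by exact_mod_cast Nat.two_le_of_mem_primesLE hp
    rw [sub_pos, div_lt_one (by linarith)]
    linarith
  have h4 : ∑ p ∈ Nat.primesLE n, logDefect (1 / (p : ℝ)) =
      -Real.log (∏ p ∈ Nat.primesLE n, (1 - 1 / (p : ℝ))) - ∑ p ∈ Nat.primesLE n, 1 / (p : ℝ) := by
    rw [Real.log_prod fun p hp => (h3 p hp).ne', ← sum_neg_distrib, ← sum_sub_distrib]
    rfl
  rw [Function.comp_apply, h4]
  rw [show ∀ a b c : ℝ, -(a - b + (-c - a)) = b + c by intros; ring, Real.exp_add,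
    Real.exp_log hlog, Real.exp_log (prod_pos h3)]

lemma eq_and_eq_of_sq_mul_eq_sq_mul {a b d e : ℕ} (ha : Squarefree a) (hb : Squarefree b)
    (hd : d ≠ 0) (he : e ≠ 0) (h : d ^ 2 * a = e ^ 2 * b) : d = e ∧ a = b := by
  have hab : a = b := by
    refine Nat.eq_of_factorization_eq ha.ne_zero hb.ne_zero fun p => ?_
    have h1 := congrArg (fun n => n.factorization p) h
    simp only [Nat.factorization_mul (pow_ne_zero 2 hd) ha.ne_zero,
      Nat.factorization_mul (pow_ne_zero 2 he) hb.ne_zero, Nat.factorization_pow,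
      Finsupp.add_apply, Finsupp.smul_apply, smul_eq_mul] at h1
    have h2 := ha.natFactorization_le_one p
    have h3 := hb.natFactorization_le_one p
    omega
  subst hab
  refine ⟨?_, rfl⟩
  have := Nat.eq_of_mul_eq_mul_right (Nat.pos_of_ne_zero ha.ne_zero) h
  exact Nat.pow_left_injective (n := 2) (by norm_num) this

lemma harmonic_le_sum_squarefree_mul (N : ℕ) :
    (harmonic N : ℝ) ≤
      (∑ a ∈ Icc 1 N with Squarefree a, 1 / (a : ℝ)) * (Real.pi ^ 2 / 6) := by
  have hex : ∀ n : ℕ, ∃ q : ℕ × ℕ, q.1 ^ 2 * q.2 = n ∧ Squarefree q.2 := fun n => by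
    obtain ⟨a, b, h1, h2⟩ := Nat.sq_mul_squarefree n
    exact ⟨(b, a), h1, h2⟩
  choose f hf hsq using hex
  have hinj : Function.Injective f := fun m n h => by rw [← hf m, ← hf n, h]
  have h1 : (harmonic N : ℝ) = ∑ q ∈ (Icc 1 N).image f, 1 / ((q.1 : ℝ) ^ 2 * q.2) := by
    rw [sum_image hinj.injOn, harmonic_eq_sum_Icc]
    push_cast
    refine sum_congr rfl fun n _ => ?_
    conv_lhs => rw [← hf n]
    push_cast
    rw [one_div]
  have h2 : (Icc 1 N).image f ⊆ Icc 1 N ×ˢ (Icc 1 N).filter Squarefree := by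
    intro q hq
    obtain ⟨n, hn, rfl⟩ := mem_image.1 hq
    rw [mem_Icc] at hn
    have h3 : (f n).1 ^ 2 * (f n).2 ≠ 0 := by rw [hf]; omega
    have h4 : 1 ≤ (f n).1 := Nat.pos_of_ne_zero fun h => h3 (by rw [h]; simp)
    have h5 : 1 ≤ (f n).2 := Nat.pos_of_ne_zero fun h => h3 (by rw [h]; simp)
    have h6 := hf n
    rw [mem_product, mem_filter, mem_Icc, mem_Icc]
    refine ⟨⟨h4, ?_⟩, ⟨h5, ?_⟩, hsq n⟩
    · nlinarith [Nat.mul_le_mul (Nat.pow_le_pow_left h4 2) h5]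
    · nlinarith [Nat.pow_le_pow_left h4 2]
  rw [h1]
  refine (sum_le_sum_of_subset_of_nonneg h2 fun _ _ _ => by positivity).trans ?_
  rw [mul_comm, sum_product]
  have h3 : ∑ d ∈ Icc 1 N, 1 / (d : ℝ) ^ 2 ≤ Real.pi ^ 2 / 6 :=
    sum_le_hasSum _ (fun _ _ => by positivity) hasSum_zeta_two
  refine le_trans (le_of_eq ?_) (mul_le_mul_of_nonneg_right h3 (sum_nonneg fun _ _ => by positivity))
  rw [sum_mul_sum]
  exact sum_congr rfl fun d _ => sum_congr rfl fun a _ => by rw [one_div_mul_one_div]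

lemma sum_squarefree_mul_le_harmonic (N D : ℕ) :
    (∑ a ∈ Icc 1 N with Squarefree a, 1 / (a : ℝ)) * ∑ d ∈ Icc 1 D, 1 / (d : ℝ) ^ 2 ≤
      (harmonic (D ^ 2 * N) : ℝ) := by
  rw [mul_comm, sum_mul_sum, ← sum_product', harmonic_eq_sum_Icc]
  push_cast
  have hinj : Set.InjOn (fun q : ℕ × ℕ => q.1 ^ 2 * q.2)
      (Icc 1 D ×ˢ (Icc 1 N).filter Squarefree : Finset (ℕ × ℕ)) := by
    intro q hq r hr h
    simp only [mem_coe, mem_product, mem_filter, mem_Icc] at hq hr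
    obtain ⟨h1, h2⟩ := eq_and_eq_of_sq_mul_eq_sq_mul hq.2.2 hr.2.2 (by omega) (by omega) h
    exact Prod.ext h1 h2
  have h1 : ∑ q ∈ Icc 1 D ×ˢ (Icc 1 N).filter Squarefree, 1 / (q.1 : ℝ) ^ 2 * (1 / (q.2 : ℝ)) =
      ∑ n ∈ (Icc 1 D ×ˢ (Icc 1 N).filter Squarefree).image
        (fun q : ℕ × ℕ => q.1 ^ 2 * q.2), (n : ℝ)⁻¹ := by
    rw [sum_image hinj]
    refine sum_congr rfl fun q _ => ?_
    push_cast
    rw [one_div_mul_one_div, one_div]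
  rw [h1]
  refine sum_le_sum_of_subset_of_nonneg ?_ fun _ _ _ => by positivity
  intro n hn
  obtain ⟨q, hq, rfl⟩ := mem_image.1 hn
  simp only [mem_product, mem_filter, mem_Icc] at hq ⊢
  refine ⟨Nat.mul_pos (pow_pos hq.1.1 2) hq.2.1.1, ?_⟩
  exact Nat.mul_le_mul (Nat.pow_le_pow_left hq.1.2 2) hq.2.1.2

/-- The logarithmic density of the squarefree numbers is `6 / π ^ 2`. -/
theorem tendsto_sum_squarefree_div_log :
    Tendsto (fun N : ℕ => (∑ a ∈ Icc 1 N with Squarefree a, 1 / (a : ℝ)) / Real.log N) atTop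
      (𝓝 (6 / Real.pi ^ 2)) := by
  have hl : Tendsto (fun n : ℕ => Real.log n) atTop atTop :=
    Real.tendsto_log_atTop.comp tendsto_natCast_atTop_atTop
  have hfl : Tendsto (fun n : ℕ => ⌊Real.log n⌋₊) atTop atTop :=
    (tendsto_nat_floor_atTop (α := ℝ)).comp hl
  have hz : Tendsto (fun D : ℕ => ∑ d ∈ Icc 1 D, 1 / (d : ℝ) ^ 2) atTop
      (𝓝 (Real.pi ^ 2 / 6)) := by
    refine ((tendsto_add_atTop_iff_nat 1).2 hasSum_zeta_two.tendsto_sum_nat).congr fun D => ?_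
    rw [range_eq_Ico, sum_eq_sum_Ico_succ_bot (by omega)]
    simp
    rfl
  have hu : Tendsto (fun n : ℕ => (1 / Real.log n + 1 + 2 * (Real.log (Real.log n) / Real.log n)) /
      ∑ d ∈ Icc 1 ⌊Real.log n⌋₊, 1 / (d : ℝ) ^ 2) atTop (𝓝 (6 / Real.pi ^ 2)) := by
    have h1 : Tendsto (fun n : ℕ => 1 / Real.log n) atTop (𝓝 0) := by
      simpa [Pi.inv_def] using hl.inv_tendsto_atTop
    have h2 : Tendsto (fun n : ℕ => Real.log (Real.log n) / Real.log n) atTop (𝓝 0) :=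
      (Real.isLittleO_log_id_atTop.tendsto_div_nhds_zero).comp hl
    have h3 := ((h1.add_const 1).add (h2.const_mul 2)).div (hz.comp hfl) (by positivity)
    simpa [Pi.div_def, Function.comp_def] using h3
  refine tendsto_of_tendsto_of_tendsto_of_le_of_le' tendsto_const_nhds hu ?_ ?_
  · filter_upwards [eventually_ge_atTop 2] with n hn
    have hlog : 0 < Real.log n := Real.log_pos (by exact_mod_cast hn)
    have h1 := harmonic_le_sum_squarefree_mul n
    have h2 : Real.log n ≤ harmonic n := by
      have := log_le_harmonic_floor n (by positivity)
      rwa [Nat.floor_natCast] at this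
    rw [le_div_iff₀ hlog, div_mul_eq_mul_div, div_le_iff₀ (by positivity)]
    linarith
  · filter_upwards [hl.eventually_ge_atTop 1, eventually_ge_atTop 1] with n hn hn1
    have hD : 1 ≤ ⌊Real.log n⌋₊ := Nat.floor_pos.2 hn
    have hDle := Nat.floor_le (show 0 ≤ Real.log n by linarith)
    set D := ⌊Real.log n⌋₊
    have hS : 0 < ∑ d ∈ Icc 1 D, 1 / (d : ℝ) ^ 2 :=
      sum_pos (fun d hd => by have := (mem_Icc.1 hd).1; positivity) ⟨1, by simp [hD]⟩
    have hDN : (1 : ℝ) ≤ ((D ^ 2 * n : ℕ) : ℝ) := by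
      exact_mod_cast Nat.mul_pos (pow_pos hD 2) hn1
    have h1 := sum_squarefree_mul_le_harmonic n D
    have h2 := harmonic_floor_le_one_add_log _ hDN
    rw [Nat.floor_natCast] at h2
    have hD0 : (0 : ℝ) < D := by exact_mod_cast hD
    have hn0 : (0 : ℝ) < n := by exact_mod_cast hn1
    have h3 : Real.log ((D ^ 2 * n : ℕ) : ℝ) ≤ 2 * Real.log (Real.log n) + Real.log n := by
      push_cast
      rw [Real.log_mul (by positivity) (by positivity), Real.log_pow]
      push_cast
      have := Real.log_le_log hD0 hDle
      linarith
    rw [le_div_iff₀ hS, div_mul_eq_mul_div, div_le_iff₀ (by linarith)]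
    have h4 : (1 / Real.log n + 1 + 2 * (Real.log (Real.log n) / Real.log n)) * Real.log n =
        1 + Real.log n + 2 * Real.log (Real.log n) := by
      field_simp
    linarith

lemma card_filter_not_dvd_insert {q : ℕ} {s : Finset ℕ} (hq : q.Prime) (hqs : q ∉ s)
    (hs : ∀ p ∈ s, p.Prime) (N : ℕ) :
    #{m ∈ Icc 1 N | ∀ p ∈ insert q s, ¬p ∣ m} + #{m ∈ Icc 1 (N / q) | ∀ p ∈ s, ¬p ∣ m} =
      #{m ∈ Icc 1 N | ∀ p ∈ s, ¬p ∣ m} := by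
  have h1 : #{m ∈ Icc 1 (N / q) | ∀ p ∈ s, ¬p ∣ m} =
      #{m ∈ {m ∈ Icc 1 N | ∀ p ∈ s, ¬p ∣ m} | q ∣ m} := by
    refine card_bij (fun m _ => q * m) ?_ (fun a _ b _ h => Nat.eq_of_mul_eq_mul_left hq.pos h) ?_
    · intro m hm
      simp only [mem_filter, mem_Icc] at hm ⊢
      refine ⟨⟨⟨Nat.mul_pos hq.pos hm.1.1, ?_⟩, fun p hp h => ?_⟩, dvd_mul_right _ _⟩
      · rw [mul_comm]
        exact (Nat.le_div_iff_mul_le hq.pos).1 hm.1.2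
      · rcases (hs p hp).dvd_mul.1 h with h | h
        · rw [(Nat.prime_dvd_prime_iff_eq (hs p hp) hq).1 h] at hp
          exact hqs hp
        · exact hm.2 p hp h
    · intro m hm
      simp only [mem_filter, mem_Icc] at hm
      obtain ⟨k, rfl⟩ := hm.2
      refine ⟨k, ?_, rfl⟩
      simp only [mem_filter, mem_Icc]
      refine ⟨⟨Nat.pos_of_mul_pos_left hm.1.1.1, ?_⟩, fun p hp h => hm.1.2 p hp (h.mul_left q)⟩
      rw [Nat.le_div_iff_mul_le hq.pos, mul_comm]
      exact hm.1.1.2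
  have h2 : ({m ∈ Icc 1 N | ∀ p ∈ insert q s, ¬p ∣ m} : Finset ℕ) =
      {m ∈ {m ∈ Icc 1 N | ∀ p ∈ s, ¬p ∣ m} | ¬q ∣ m} := by
    ext m
    simp only [mem_filter, forall_mem_insert]
    tauto
  rw [h1, h2, add_comm, card_filter_add_card_filter_not]

/-- The sieve of Eratosthenes with Rankin's trick in the error term. -/
theorem abs_card_filter_not_dvd_sub_le {δ : ℝ} (hδ0 : 0 ≤ δ) (hδ1 : δ < 1) (s : Finset ℕ)
    (hs : ∀ p ∈ s, p.Prime) {T : ℝ} (hT : 0 ≤ T) :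
    |(#{m ∈ Icc 1 ⌊T⌋₊ | ∀ p ∈ s, ¬p ∣ m} : ℝ) - T * ∏ p ∈ s, (1 - 1 / (p : ℝ))| ≤
      T ^ (1 - δ) * ∏ p ∈ s, (1 + (p : ℝ) ^ (δ - 1)) := by
  induction s using Finset.induction_on generalizing T with
  | empty =>
    simp only [notMem_empty, IsEmpty.forall_iff, implies_true, filter_true, Nat.card_Icc,
      add_tsub_cancel_right, prod_empty, mul_one]
    have h1 := Nat.floor_le hT
    have h2 := Nat.lt_floor_add_one T
    rw [abs_sub_comm, abs_of_nonneg (by linarith)]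
    rcases le_or_gt 1 T with h | h
    · exact (by linarith : T - ⌊T⌋₊ ≤ 1).trans (Real.one_le_rpow h (by linarith))
    · rw [Nat.floor_eq_zero.2 h, Nat.cast_zero, sub_zero]
      exact Real.self_le_rpow_of_le_one hT h.le (by linarith)
  | insert q s hqs ih =>
    have hq := hs q (mem_insert_self q s)
    have hs' : ∀ p ∈ s, p.Prime := fun p hp => hs p (mem_insert_of_mem hp)
    have h1 := card_filter_not_dvd_insert hq hqs hs' ⌊T⌋₊
    have h2 := ih hs' hT
    have h3 := ih hs' (show 0 ≤ T / q by positivity)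
    rw [Nat.floor_div_natCast] at h3
    have hq0 : (0 : ℝ) < q := by exact_mod_cast hq.pos
    rw [prod_insert hqs, prod_insert hqs]
    rw [← h1] at h2
    push_cast at h2 ⊢
    have h4 : (T / q) ^ (1 - δ) = T ^ (1 - δ) * (q : ℝ) ^ (δ - 1) := by
      rw [Real.div_rpow hT hq0.le, div_eq_mul_inv, ← Real.rpow_neg hq0.le, neg_sub]
    rw [h4] at h3
    rw [abs_le] at *
    set P := ∏ p ∈ s, (1 - 1 / (p : ℝ))
    have h5 : T * ((1 - 1 / (q : ℝ)) * P) = T * P - T / q * P := by ring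
    rw [h5]
    constructor <;> linarith [h2.1, h2.2, h3.1, h3.2]

lemma prod_one_add_rpow_le {δ : ℝ} (hδ : 0 ≤ δ) {z : ℕ} (hz : 1 ≤ z) :
    ∏ p ∈ Nat.primesLE z, (1 + (p : ℝ) ^ (δ - 1)) ≤
      Real.exp ((z : ℝ) ^ δ * (1 + Real.log z)) := by
  have h1 : ∏ p ∈ Nat.primesLE z, (1 + (p : ℝ) ^ (δ - 1)) ≤
      Real.exp (∑ p ∈ Nat.primesLE z, (p : ℝ) ^ (δ - 1)) := by
    rw [Real.exp_sum]
    refine prod_le_prod (fun p _ => by positivity) fun p _ => ?_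
    rw [add_comm]
    exact Real.add_one_le_exp _
  refine h1.trans (Real.exp_le_exp.2 ?_)
  calc ∑ p ∈ Nat.primesLE z, (p : ℝ) ^ (δ - 1)
      ≤ ∑ p ∈ Nat.primesLE z, (z : ℝ) ^ δ * (p : ℝ)⁻¹ := by
        refine sum_le_sum fun p hp => ?_
        have hp' := Nat.mem_primesLE.1 hp
        have : (0 : ℝ) < p := by exact_mod_cast hp'.2.pos
        rw [Real.rpow_sub_one this.ne', div_eq_mul_inv]
        gcongr
        exact hp'.1
    _ ≤ ∑ n ∈ Icc 1 z, (z : ℝ) ^ δ * (n : ℝ)⁻¹ := by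
        refine sum_le_sum_of_subset_of_nonneg (fun p hp => ?_) fun _ _ _ => by positivity
        have hp' := Nat.mem_primesLE.1 hp
        exact mem_Icc.2 ⟨hp'.2.one_le, hp'.1⟩
    _ = (z : ℝ) ^ δ * harmonic z := by
        rw [← mul_sum, harmonic_eq_sum_Icc]
        push_cast
        rfl
    _ ≤ _ := by
        gcongr
        have := harmonic_floor_le_one_add_log z (by exact_mod_cast hz)
        rwa [Nat.floor_natCast] at this

lemma card_filter_not_squarefree_le {N z : ℕ} (hz : 1 ≤ z) :
    (#{m ∈ Icc 1 N | (∀ p ∈ Nat.primesLE z, ¬p ∣ m) ∧ ¬Squarefree m} : ℝ) ≤ N / z := by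
  rcases le_total N z with hN | hN
  · have : ({m ∈ Icc 1 N | (∀ p ∈ Nat.primesLE z, ¬p ∣ m) ∧ ¬Squarefree m} : Finset ℕ) = ∅ := by
      refine filter_eq_empty_iff.2 fun m hm h => h.2 ?_
      rw [mem_Icc] at hm
      by_contra hsq
      have h1 : m ≠ 1 := fun h => hsq (h ▸ squarefree_one)
      refine h.1 m.minFac (Nat.mem_primesLE.2 ⟨?_, Nat.minFac_prime h1⟩) (Nat.minFac_dvd m)
      exact (Nat.minFac_le hm.1).trans (hm.2.trans hN)
    rw [this, card_empty, Nat.cast_zero]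
    positivity
  have h1 : ({m ∈ Icc 1 N | (∀ p ∈ Nat.primesLE z, ¬p ∣ m) ∧ ¬Squarefree m} : Finset ℕ) ⊆
      (Ioc z N).biUnion fun n => {m ∈ Ioc 0 N | n ^ 2 ∣ m} := by
    intro m hm
    simp only [mem_filter, mem_Icc, mem_biUnion, mem_Ioc] at hm ⊢
    obtain ⟨⟨hm1, hmN⟩, hp, hsq⟩ := hm
    rw [Nat.squarefree_iff_prime_squarefree] at hsq
    push Not at hsq
    obtain ⟨p, hpp, hpm⟩ := hsq
    have hpm' : p ∣ m := (dvd_mul_right p p).trans hpm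
    refine ⟨p, ⟨?_, (Nat.le_of_dvd hm1 hpm').trans hmN⟩, ⟨hm1, hmN⟩, by rwa [sq]⟩
    by_contra h
    exact hp p (Nat.mem_primesLE.2 ⟨not_lt.1 h, hpp⟩) hpm'
  calc (#{m ∈ Icc 1 N | (∀ p ∈ Nat.primesLE z, ¬p ∣ m) ∧ ¬Squarefree m} : ℝ)
      ≤ ∑ n ∈ Ioc z N, (#{m ∈ Ioc 0 N | n ^ 2 ∣ m} : ℝ) := by
        exact_mod_cast (card_le_card h1).trans card_biUnion_le
    _ ≤ ∑ n ∈ Ioc z N, N * ((n : ℝ) ^ 2)⁻¹ := by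
        refine sum_le_sum fun n _ => ?_
        rw [Nat.Ioc_filter_dvd_card_eq_div, ← div_eq_mul_inv]
        exact_mod_cast Nat.cast_div_le (α := ℝ) (m := N) (n := n ^ 2)
    _ ≤ N * ((z : ℝ)⁻¹ - (N : ℝ)⁻¹) := by
        rw [← mul_sum]
        gcongr
        exact sum_Ioc_inv_sq_le_sub (by omega) hN
    _ ≤ N / z := by
        rw [div_eq_mul_inv]
        gcongr
        simp

/-- The number of squarefree integers up to `T` all of whose prime factors exceed `z`. -/
theorem abs_card_filter_squarefree_not_dvd_sub_le {δ : ℝ} (hδ0 : 0 ≤ δ) (hδ1 : δ < 1) {z : ℕ}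
    (hz : 1 ≤ z) {T : ℝ} (hT : 0 ≤ T) :
    |(#{m ∈ Icc 1 ⌊T⌋₊ | (∀ p ∈ Nat.primesLE z, ¬p ∣ m) ∧ Squarefree m} : ℝ) -
        T * ∏ p ∈ Nat.primesLE z, (1 - 1 / (p : ℝ))| ≤
      T ^ (1 - δ) * Real.exp ((z : ℝ) ^ δ * (1 + Real.log z)) + T / z := by
  have h1 := abs_card_filter_not_dvd_sub_le hδ0 hδ1 (Nat.primesLE z)
    (fun p hp => (Nat.mem_primesLE.1 hp).2) hT
  have h2 := mul_le_mul_of_nonneg_left (prod_one_add_rpow_le hδ0 hz)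
    (Real.rpow_nonneg hT (1 - δ))
  have h3 := card_filter_not_squarefree_le (N := ⌊T⌋₊) hz
  have h4 : (⌊T⌋₊ : ℝ) / z ≤ T / z := by
    gcongr
    exact Nat.floor_le hT
  have h5 : (#{m ∈ Icc 1 ⌊T⌋₊ | ∀ p ∈ Nat.primesLE z, ¬p ∣ m} : ℝ) =
      #{m ∈ Icc 1 ⌊T⌋₊ | (∀ p ∈ Nat.primesLE z, ¬p ∣ m) ∧ Squarefree m} +
      #{m ∈ Icc 1 ⌊T⌋₊ | (∀ p ∈ Nat.primesLE z, ¬p ∣ m) ∧ ¬Squarefree m} := by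
    rw [← filter_filter, ← filter_filter]
    exact_mod_cast (card_filter_add_card_filter_not _).symm
  have h6 : (0 : ℝ) ≤ T / z := by positivity
  rw [h5] at h1
  rw [abs_le] at *
  constructor
  · linarith [h1.1]
  · have : (0 : ℝ) ≤ #{m ∈ Icc 1 ⌊T⌋₊ | (∀ p ∈ Nat.primesLE z, ¬p ∣ m) ∧ ¬Squarefree m} := by
      positivity
    linarith [h1.2]

lemma card_Icc_filter_dvd (N d : ℕ) : #{m ∈ Icc 1 N | d ∣ m} = N / d := by
  rw [← Nat.Ioc_filter_dvd_card_eq_div N d]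
  rfl

lemma card_primeFactors_eq_sum {N m : ℕ} (hm : m ∈ Icc 1 N) :
    (#m.primeFactors : ℝ) = ∑ p ∈ Nat.primesLE N, if p ∣ m then (1 : ℝ) else 0 := by
  rw [← sum_filter, sum_const, nsmul_eq_mul, mul_one]
  rw [mem_Icc] at hm
  congr 2
  ext p
  rw [Nat.mem_primeFactors, mem_filter, Nat.mem_primesLE]
  refine ⟨fun h => ⟨⟨(Nat.le_of_dvd hm.1 h.2.1).trans hm.2, h.1⟩, h.2.1⟩,
    fun h => ⟨h.1.2, h.2, by omega⟩⟩

lemma sum_card_primeFactors_ge (N : ℕ) :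
    N * ∑ p ∈ Nat.primesLE N, 1 / (p : ℝ) - N ≤ ∑ m ∈ Icc 1 N, (#m.primeFactors : ℝ) := by
  rw [sum_congr rfl fun m hm => card_primeFactors_eq_sum hm, sum_comm]
  have h1 : ∑ p ∈ Nat.primesLE N, ((N : ℝ) / p - 1) ≤
      ∑ p ∈ Nat.primesLE N, ∑ m ∈ Icc 1 N, if p ∣ m then (1 : ℝ) else 0 := by
    refine sum_le_sum fun p _ => ?_
    rw [← sum_filter, sum_const, nsmul_eq_mul, mul_one, card_Icc_filter_dvd,
      ← Nat.floor_div_eq_div (K := ℝ)]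
    exact (Nat.sub_one_lt_floor _).le
  refine le_trans ?_ h1
  rw [sum_sub_distrib, sum_const, nsmul_eq_mul, mul_one, mul_sum]
  have h2 : (#(Nat.primesLE N) : ℝ) ≤ N := by
    have : Nat.primesLE N ⊆ Icc 1 N := fun p hp => by
      have := Nat.mem_primesLE.1 hp
      exact mem_Icc.2 ⟨this.2.one_le, this.1⟩
    have := card_le_card this
    rw [Nat.card_Icc, Nat.add_sub_cancel] at this
    exact_mod_cast this
  have h3 : ∑ p ∈ Nat.primesLE N, (N : ℝ) * (1 / p) = ∑ p ∈ Nat.primesLE N, (N : ℝ) / p :=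
    sum_congr rfl fun p _ => by ring
  rw [h3]
  linarith

lemma sum_card_primeFactors_sq_le (N : ℕ) :
    ∑ m ∈ Icc 1 N, (#m.primeFactors : ℝ) ^ 2 ≤
      N * (∑ p ∈ Nat.primesLE N, 1 / (p : ℝ)) ^ 2 + N * ∑ p ∈ Nat.primesLE N, 1 / (p : ℝ) := by
  have h1 : ∀ m ∈ Icc 1 N, (#m.primeFactors : ℝ) ^ 2 =
      ∑ p ∈ Nat.primesLE N, ∑ q ∈ Nat.primesLE N,
        (if p ∣ m then (1 : ℝ) else 0) * (if q ∣ m then (1 : ℝ) else 0) := fun m hm => by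
    rw [card_primeFactors_eq_sum hm, sq, sum_mul_sum]
  rw [sum_congr rfl h1, sum_comm, sq, sum_mul_sum, mul_sum, mul_sum, ← sum_add_distrib]
  refine sum_le_sum fun p hp => ?_
  rw [sum_comm, mul_sum]
  have hp' := (Nat.mem_primesLE.1 hp).2
  have h2 : ∀ q ∈ Nat.primesLE N, ∑ m ∈ Icc 1 N,
      (if p ∣ m then (1 : ℝ) else 0) * (if q ∣ m then (1 : ℝ) else 0) ≤
        N * (1 / (p : ℝ) * (1 / (q : ℝ))) + if q = p then N * (1 / (p : ℝ)) else 0 := by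
    intro q hq
    have hq' := (Nat.mem_primesLE.1 hq).2
    split_ifs with hqp
    · subst hqp
      have h3 : ∑ m ∈ Icc 1 N, (if q ∣ m then (1 : ℝ) else 0) * (if q ∣ m then (1 : ℝ) else 0) =
          (N / q : ℕ) := by
        rw [← card_Icc_filter_dvd, card_filter]
        push_cast
        exact sum_congr rfl fun m _ => by split_ifs <;> simp
      rw [h3]
      have h4 : ((N / q : ℕ) : ℝ) ≤ N * (1 / (q : ℝ)) := by
        rw [mul_one_div]
        exact Nat.cast_div_le
      have : 0 ≤ (N : ℝ) * (1 / (q : ℝ) * (1 / (q : ℝ))) := by positivity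
      linarith
    · have h3 : ∑ m ∈ Icc 1 N, (if p ∣ m then (1 : ℝ) else 0) * (if q ∣ m then (1 : ℝ) else 0) =
          (N / (p * q) : ℕ) := by
        rw [← card_Icc_filter_dvd, card_filter]
        push_cast
        refine sum_congr rfl fun m _ => ?_
        have hcop : p.Coprime q := (Nat.coprime_primes hp' hq').2 (Ne.symm hqp)
        have : p * q ∣ m ↔ p ∣ m ∧ q ∣ m :=
          ⟨fun h => ⟨(dvd_mul_right p q).trans h, (dvd_mul_left q p).trans h⟩,
            fun h => hcop.mul_dvd_of_dvd_of_dvd h.1 h.2⟩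
        simp only [this, ite_and]
        split_ifs <;> simp
      rw [h3, add_zero, one_div_mul_one_div, mul_one_div]
      exact_mod_cast Nat.cast_div_le (α := ℝ) (m := N) (n := p * q)
  refine (sum_le_sum h2).trans ?_
  rw [sum_add_distrib, sum_ite_eq' _ p, if_pos hp]

/-- The Turán–Kubilius inequality for `ω`. -/
theorem sum_sq_card_primeFactors_sub_le (N : ℕ) :
    ∑ m ∈ Icc 1 N, ((#m.primeFactors : ℝ) - ∑ p ∈ Nat.primesLE N, 1 / (p : ℝ)) ^ 2 ≤
      3 * N * ∑ p ∈ Nat.primesLE N, 1 / (p : ℝ) := by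
  have h1 := sum_card_primeFactors_ge N
  have h2 := sum_card_primeFactors_sq_le N
  set S := ∑ p ∈ Nat.primesLE N, 1 / (p : ℝ)
  have hS : 0 ≤ S := sum_nonneg fun _ _ => by positivity
  have h3 : ∑ m ∈ Icc 1 N, ((#m.primeFactors : ℝ) - S) ^ 2 =
      ∑ m ∈ Icc 1 N, (#m.primeFactors : ℝ) ^ 2 - 2 * S * ∑ m ∈ Icc 1 N, (#m.primeFactors : ℝ) +
        N * S ^ 2 := by
    rw [mul_sum, ← sum_sub_distrib]
    have : (N : ℝ) * S ^ 2 = ∑ m ∈ Icc 1 N, S ^ 2 := by simp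
    rw [this, ← sum_add_distrib]
    exact sum_congr rfl fun m _ => by ring
  rw [h3]
  nlinarith

lemma card_filter_le_abs_card_primeFactors_sub {N : ℕ} {η : ℝ} (hη : 0 < η)
    (hS : 0 < ∑ p ∈ Nat.primesLE N, 1 / (p : ℝ)) :
    (#{m ∈ Icc 1 N | η * ∑ p ∈ Nat.primesLE N, 1 / (p : ℝ) ≤
        |(#m.primeFactors : ℝ) - ∑ p ∈ Nat.primesLE N, 1 / (p : ℝ)|} : ℝ) ≤
      3 * N / (η ^ 2 * ∑ p ∈ Nat.primesLE N, 1 / (p : ℝ)) := by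
  have h1 := sum_sq_card_primeFactors_sub_le N
  set S := ∑ p ∈ Nat.primesLE N, 1 / (p : ℝ)
  have h2 : (#{m ∈ Icc 1 N | η * S ≤ |(#m.primeFactors : ℝ) - S|} : ℝ) * (η * S) ^ 2 ≤
      ∑ m ∈ Icc 1 N, ((#m.primeFactors : ℝ) - S) ^ 2 := by
    rw [← nsmul_eq_mul]
    refine (card_nsmul_le_sum _ (fun m : ℕ => ((#m.primeFactors : ℝ) - S) ^ 2) _ ?_).trans
      (sum_le_sum_of_subset_of_nonneg (filter_subset _ _) fun _ _ _ => sq_nonneg _)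
    intro m hm
    rw [← sq_abs ((#m.primeFactors : ℝ) - S)]
    have := (mem_filter.1 hm).2
    gcongr
  rw [le_div_iff₀ (by positivity)]
  refine le_of_mul_le_mul_right ?_ hS
  linarith

/-- The squarefree `M ≤ X` of the form `A * m` where `3 ≤ A ≤ y` and all prime factors of `m`
exceed `z`. -/
def smallTimesRough (X y z : ℕ) : Set ℕ :=
  {M | M ∈ Icc 1 X ∧ Squarefree M ∧ ∃ A m : ℕ, M = A * m ∧ 3 ≤ A ∧ A ≤ y ∧
    ∀ p : ℕ, p.Prime → p ∣ m → z < p}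

lemma coprime_of_le_of_forall_prime_lt {A m y z : ℕ} (hA0 : A ≠ 0) (hA : A ≤ y) (hyz : y ≤ z)
    (hm : ∀ p ∈ Nat.primesLE z, ¬p ∣ m) : A.Coprime m := by
  refine Nat.coprime_of_dvd fun p hp hpA hpm => hm p (Nat.mem_primesLE.2 ⟨?_, hp⟩) hpm
  exact (Nat.le_of_dvd (Nat.pos_of_ne_zero hA0) hpA).trans (hA.trans hyz)

lemma ncard_smallTimesRough {X y z : ℕ} (hyz : y ≤ z) :
    (smallTimesRough X y z).ncard = ∑ A ∈ Icc 3 y with Squarefree A,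
      #{m ∈ Icc 1 (X / A) | (∀ p ∈ Nat.primesLE z, ¬p ∣ m) ∧ Squarefree m} := by
  rw [← card_sigma, ← Set.ncard_coe_finset]
  symm
  refine Set.ncard_congr (fun q _ => q.1 * q.2) ?_ ?_ ?_
  · rintro ⟨A, m⟩ hq
    simp only [mem_coe, mem_sigma, mem_filter, mem_Icc] at hq
    obtain ⟨⟨⟨hA3, hAy⟩, hAs⟩, ⟨hm1, hmX⟩, hmp, hms⟩ := hq
    have hA0 : 0 < A := by omega
    have hcop := coprime_of_le_of_forall_prime_lt hA0.ne' hAy hyz hmp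
    refine ⟨mem_Icc.2 ⟨Nat.mul_pos hA0 hm1, ?_⟩, (Nat.squarefree_mul hcop).2 ⟨hAs, hms⟩,
      A, m, rfl, hA3, hAy, fun p hp hpm => ?_⟩
    · rw [mul_comm]
      exact (Nat.le_div_iff_mul_le hA0).1 hmX
    · by_contra h
      exact hmp p (Nat.mem_primesLE.2 ⟨not_lt.1 h, hp⟩) hpm
  · rintro ⟨A, m⟩ ⟨B, n⟩ hq hr h
    simp only [mem_coe, mem_sigma, mem_filter, mem_Icc] at hq hr h
    obtain ⟨⟨⟨hA3, hAy⟩, -⟩, -, hmp, -⟩ := hq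
    obtain ⟨⟨⟨hB3, hBy⟩, -⟩, -, hnp, -⟩ := hr
    have h1 : A ∣ B := (coprime_of_le_of_forall_prime_lt (by omega) hAy hyz hnp).dvd_of_dvd_mul_right
      (h ▸ dvd_mul_right A m)
    have h2 : B ∣ A := (coprime_of_le_of_forall_prime_lt (by omega) hBy hyz hmp).dvd_of_dvd_mul_right
      (h ▸ dvd_mul_right B n)
    obtain rfl := Nat.dvd_antisymm h1 h2
    obtain rfl := Nat.eq_of_mul_eq_mul_left (by omega) h
    rfl
  · rintro M ⟨hM, hs, A, m, rfl, hA3, hAy, hp⟩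
    rw [mem_Icc] at hM
    refine ⟨⟨A, m⟩, ?_, rfl⟩
    simp only [mem_coe, mem_sigma, mem_filter, mem_Icc]
    refine ⟨⟨⟨hA3, hAy⟩, hs.of_mul_left⟩, ⟨Nat.pos_of_mul_pos_left hM.1, ?_⟩, fun p hpz hpm => ?_,
      hs.of_mul_right⟩
    · rw [Nat.le_div_iff_mul_le (by omega), mul_comm]
      exact hM.2
    · have h1 := Nat.mem_primesLE.1 hpz
      exact absurd (hp p h1.2 hpm) (not_lt.2 h1.1)

theorem abs_ncard_smallTimesRough_sub_le {δ : ℝ} (hδ0 : 0 ≤ δ) (hδ1 : δ < 1) {X y z : ℕ}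
    (hz : 1 ≤ z) (hyz : y ≤ z) :
    |((smallTimesRough X y z).ncard : ℝ) -
        X * ((∏ p ∈ Nat.primesLE z, (1 - 1 / (p : ℝ))) *
          ∑ A ∈ Icc 3 y with Squarefree A, 1 / (A : ℝ))| ≤
      y * ((X : ℝ) ^ (1 - δ) * Real.exp ((z : ℝ) ^ δ * (1 + Real.log z)) + X / z) := by
  set E := (X : ℝ) ^ (1 - δ) * Real.exp ((z : ℝ) ^ δ * (1 + Real.log z)) + X / z with hE
  have hE0 : 0 ≤ E := by positivity
  rw [ncard_smallTimesRough hyz, mul_sum, mul_sum]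
  push_cast
  rw [← sum_sub_distrib]
  refine (abs_sum_le_sum_abs _ _).trans ?_
  have h1 : ∀ A ∈ (Icc 3 y).filter Squarefree,
      |(#{m ∈ Icc 1 (X / A) | (∀ p ∈ Nat.primesLE z, ¬p ∣ m) ∧ Squarefree m} : ℝ) -
        X * ((∏ p ∈ Nat.primesLE z, (1 - 1 / (p : ℝ))) * (1 / (A : ℝ)))| ≤ E := by
    intro A hA
    have hA3 := (mem_Icc.1 (mem_filter.1 hA).1).1
    have hA1 : (1 : ℝ) ≤ A := by exact_mod_cast (by omega : 1 ≤ A)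
    have h2 := abs_card_filter_squarefree_not_dvd_sub_le hδ0 hδ1 hz
      (show (0 : ℝ) ≤ X / A by positivity)
    rw [Nat.floor_div_eq_div] at h2
    have h3 : (X : ℝ) / A ≤ X := div_le_self (by positivity) hA1
    rw [show (X : ℝ) * ((∏ p ∈ Nat.primesLE z, (1 - 1 / (p : ℝ))) * (1 / (A : ℝ))) =
      X / A * ∏ p ∈ Nat.primesLE z, (1 - 1 / (p : ℝ)) by ring]
    refine h2.trans ?_
    rw [hE]
    have : 0 ≤ 1 - δ := by linarith
    gcongr
  refine (sum_le_card_nsmul _ _ _ h1).trans ?_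
  rw [nsmul_eq_mul]
  gcongr
  refine (card_filter_le _ _).trans ?_
  rw [Nat.card_Icc]
  omega

lemma tendsto_const_mul_rpow_atTop {c a : ℝ} (hc : 0 < c) (ha : 0 < a) :
    Tendsto (fun u : ℝ => (c * u) ^ a) atTop atTop :=
  (tendsto_rpow_atTop ha).comp (tendsto_id.const_mul_atTop hc)

lemma tendsto_log_floor_rpow_div_log {c a : ℝ} (hc : 0 < c) (ha : 0 < a) :
    Tendsto (fun u : ℝ => Real.log ⌊(c * u) ^ a⌋₊ / Real.log u) atTop (𝓝 a) := by
  have hv := tendsto_const_mul_rpow_atTop hc ha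
  have h1 := ((Real.continuousAt_log one_ne_zero).tendsto.comp
    (tendsto_nat_floor_div_atTop (R := ℝ))).comp hv
  have h2 : Tendsto (fun u : ℝ => (Real.log u)⁻¹) atTop (𝓝 0) :=
    tendsto_inv_atTop_zero.comp Real.tendsto_log_atTop
  have h3 := ((h1.add_const (a * Real.log c)).mul h2).add_const a
  rw [mul_zero, zero_add] at h3
  refine h3.congr' ?_
  filter_upwards [hv.eventually_ge_atTop 1, eventually_gt_atTop 1] with u hu hu1
  have hf : (⌊(c * u) ^ a⌋₊ : ℝ) ≠ 0 := by
    have := Nat.floor_pos.2 hu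
    positivity
  have hl : 0 < Real.log u := Real.log_pos hu1
  simp only [Function.comp_apply]
  rw [Real.log_div hf (by positivity), Real.log_rpow (by positivity),
    Real.log_mul hc.ne' (by positivity)]
  field_simp
  ring

lemma tendsto_floor_rpow_div_floor_rpow {c c' a b : ℝ} (hc : 0 < c) (hc' : 0 < c') (ha : 0 < a)
    (hab : a < b) :
    Tendsto (fun u : ℝ => (⌊(c * u) ^ a⌋₊ : ℝ) / ⌊(c' * u) ^ b⌋₊) atTop (𝓝 0) := by
  have h1 := (tendsto_nat_floor_div_atTop (R := ℝ)).comp (tendsto_const_mul_rpow_atTop hc ha)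
  have h2 := (tendsto_nat_floor_div_atTop (R := ℝ)).comp
    (tendsto_const_mul_rpow_atTop hc' (ha.trans hab))
  have h3 : Tendsto (fun u : ℝ => c ^ a / c' ^ b * u ^ (-(b - a))) atTop (𝓝 0) := by
    simpa using (tendsto_rpow_neg_atTop (show 0 < b - a by linarith)).const_mul (c ^ a / c' ^ b)
  have h4 := (h1.div h2 one_ne_zero).mul h3
  rw [mul_zero] at h4
  refine h4.congr' ?_
  filter_upwards [eventually_gt_atTop 0] with u hu
  have hpa : 0 < u ^ a := Real.rpow_pos_of_pos hu a
  have hpb : 0 < u ^ b := Real.rpow_pos_of_pos hu b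
  have hca : 0 < c ^ a := Real.rpow_pos_of_pos hc a
  have hcb : 0 < c' ^ b := Real.rpow_pos_of_pos hc' b
  simp only [Function.comp_apply, Pi.div_apply]
  rw [neg_sub, Real.rpow_sub hu, Real.mul_rpow hc.le hu.le, Real.mul_rpow hc'.le hu.le]
  field_simp

lemma sum_Icc_three_squarefree {y : ℕ} (hy : 2 ≤ y) :
    ∑ A ∈ Icc 3 y with Squarefree A, 1 / (A : ℝ) =
      ∑ A ∈ Icc 1 y with Squarefree A, 1 / (A : ℝ) - 3 / 2 := by
  have h : Icc 1 y = insert 1 (insert 2 (Icc 3 y)) := by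
    ext n
    simp only [mem_insert, mem_Icc]
    omega
  rw [sum_filter, sum_filter, h, sum_insert (by simp), sum_insert (by simp),
    if_pos squarefree_one, if_pos Nat.prime_two.prime.squarefree]
  push_cast
  ring

lemma tendsto_sum_Icc_three_squarefree_div_log :
    Tendsto (fun N : ℕ => (∑ a ∈ Icc 3 N with Squarefree a, 1 / (a : ℝ)) / Real.log N) atTop
      (𝓝 (6 / Real.pi ^ 2)) := by
  have hl : Tendsto (fun n : ℕ => 3 / 2 / Real.log n) atTop (𝓝 0) :=
    (Real.tendsto_log_atTop.comp tendsto_natCast_atTop_atTop).const_div_atTop _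
  have h := tendsto_sum_squarefree_div_log.sub hl
  rw [sub_zero] at h
  refine h.congr' ?_
  filter_upwards [eventually_ge_atTop 2] with n hn
  rw [sum_Icc_three_squarefree hn, sub_div]

lemma tendsto_log_sub_mul_add_sqrt_mul_atBot {δ C : ℝ} (hδ : 0 < δ) :
    Tendsto (fun u : ℝ => Real.log u - δ * u + u ^ (1 / 2 : ℝ) * (1 + C * Real.log u))
      atTop atBot := by
  have h1 : Tendsto (fun u : ℝ => Real.log u / u) atTop (𝓝 0) :=
    Real.isLittleO_log_id_atTop.tendsto_div_nhds_zero
  have h2 : Tendsto (fun u : ℝ => Real.log u / u ^ (1 / 2 : ℝ)) atTop (𝓝 0) :=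
    (isLittleO_log_rpow_atTop (by norm_num)).tendsto_div_nhds_zero
  have h3 : Tendsto (fun u : ℝ => u ^ (-(1 / 2) : ℝ)) atTop (𝓝 0) :=
    tendsto_rpow_neg_atTop (by norm_num)
  have h4 := ((h1.sub_const δ).add (h3.add (h2.const_mul C)))
  rw [show 0 - δ + (0 + C * 0) = -δ by ring] at h4
  have h5 := tendsto_id.atTop_mul_neg (neg_lt_zero.2 hδ) h4
  refine h5.congr' ?_
  filter_upwards [eventually_gt_atTop 0] with u hu
  have h6 : 0 < u ^ (1 / 2 : ℝ) := Real.rpow_pos_of_pos hu _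
  have h7 : u = u ^ (1 / 2 : ℝ) * u ^ (1 / 2 : ℝ) := by
    rw [← Real.rpow_add hu]; norm_num
  simp only [id]
  rw [Real.rpow_neg hu.le]
  set v := u ^ (1 / 2 : ℝ)
  set l := Real.log u
  rw [h7]
  field_simp

/-- The count of `M = A * m` with `A` up to a power of `log X`, and `m` free of primes up to a
larger power of `log X`. -/
theorem tendsto_ncard_smallTimesRough_div {c c' a C : ℝ} (hc : 0 < c) (hc1 : c ≤ 1) (hc' : 0 < c')
    (hc1' : c' ≤ 1) (ha : 0 < a) (ha1 : a ≤ 1) (hC : 1 < C) :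
    Tendsto (fun X : ℕ => ((smallTimesRough X ⌊(c * Real.log X) ^ a⌋₊
      ⌊(c' * Real.log X) ^ C⌋₊).ncard : ℝ) / X) atTop
      (𝓝 (Real.exp (-Real.eulerMascheroniConstant) * (6 / Real.pi ^ 2) * (a / C))) := by
  have hC0 : 0 < C := by linarith
  have hl : Tendsto (fun n : ℕ => Real.log n) atTop atTop :=
    Real.tendsto_log_atTop.comp tendsto_natCast_atTop_atTop
  have hyt : Tendsto (fun X : ℕ => ⌊(c * Real.log X) ^ a⌋₊) atTop atTop :=
    (tendsto_nat_floor_atTop (α := ℝ)).comp ((tendsto_const_mul_rpow_atTop hc ha).comp hl)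
  have hzt : Tendsto (fun X : ℕ => ⌊(c' * Real.log X) ^ C⌋₊) atTop atTop :=
    (tendsto_nat_floor_atTop (α := ℝ)).comp ((tendsto_const_mul_rpow_atTop hc' hC0).comp hl)
  have hyz := (tendsto_floor_rpow_div_floor_rpow hc hc' ha (ha1.trans_lt hC)).comp hl
  have hylog := (tendsto_log_floor_rpow_div_log hc ha).comp hl
  have hzlog := (tendsto_log_floor_rpow_div_log hc' hC0).comp hl
  simp only [Function.comp_def] at hyz hylog hzlog
  set y : ℕ → ℕ := fun X => ⌊(c * Real.log X) ^ a⌋₊ with hy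
  set z : ℕ → ℕ := fun X => ⌊(c' * Real.log X) ^ C⌋₊ with hz
  have hmain : Tendsto (fun X : ℕ => (∏ p ∈ Nat.primesLE (z X), (1 - 1 / (p : ℝ))) *
      ∑ A ∈ Icc 3 (y X) with Squarefree A, 1 / (A : ℝ)) atTop
      (𝓝 (Real.exp (-Real.eulerMascheroniConstant) * (6 / Real.pi ^ 2) * (a / C))) := by
    have h := ((tendsto_log_mul_prod_one_sub_inv.comp hzt).mul
      (tendsto_sum_Icc_three_squarefree_div_log.comp hyt)).mul (hylog.div hzlog hC0.ne')
    refine h.congr' ?_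
    filter_upwards [hyt.eventually_ge_atTop 2, hzt.eventually_ge_atTop 2,
      (Real.tendsto_log_atTop.comp hl).eventually_gt_atTop 0] with X h1 h2 h3
    have h1' : Real.log (y X) ≠ 0 := (Real.log_pos (by exact_mod_cast h1)).ne'
    have h2' : Real.log (z X) ≠ 0 := (Real.log_pos (by exact_mod_cast h2)).ne'
    have h3' : Real.log (Real.log X) ≠ 0 := ne_of_gt h3
    simp only [Function.comp_apply, Pi.div_apply]
    change Real.log (z X) * _ * (_ / Real.log (y X)) *
      (Real.log (y X) / _ / (Real.log (z X) / _)) = _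
    field_simp
  set δ : ℝ := 1 / (2 * C) with hδ
  have hδ0 : 0 < δ := by positivity
  have hδ1 : δ < 1 := by
    rw [hδ, div_lt_one (by positivity)]
    linarith
  have herr : Tendsto (fun X : ℕ => Real.exp (Real.log (Real.log X) - δ * Real.log X +
      Real.log X ^ (1 / 2 : ℝ) * (1 + C * Real.log (Real.log X))) + (y X : ℝ) / z X) atTop
      (𝓝 0) := by
    have := (Real.tendsto_exp_atBot.comp
      ((tendsto_log_sub_mul_add_sqrt_mul_atBot (C := C) hδ0).comp hl)).add hyz
    rwa [add_zero] at this
  have hdiff : Tendsto (fun X : ℕ => ((smallTimesRough X (y X) (z X)).ncard : ℝ) / X -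
      (∏ p ∈ Nat.primesLE (z X), (1 - 1 / (p : ℝ))) *
        ∑ A ∈ Icc 3 (y X) with Squarefree A, 1 / (A : ℝ)) atTop (𝓝 0) := by
    refine squeeze_zero_norm' ?_ herr
    filter_upwards [hyt.eventually_ge_atTop 1, hzt.eventually_ge_atTop 1,
      hyz.eventually_lt_const one_pos, hl.eventually_ge_atTop 1, eventually_ge_atTop 1]
      with X h1 h2 h3 h4 h5
    have hX0 : (0 : ℝ) < X := by exact_mod_cast h5
    have hz0 : (0 : ℝ) < z X := by exact_mod_cast h2
    have hL0 : 0 < Real.log X := by linarith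
    have hyz' : y X ≤ z X := by
      have : (y X : ℝ) < z X := by
        have := (div_lt_one hz0).1 h3
        exact this
      exact_mod_cast this.le
    have hyL : (y X : ℝ) ≤ Real.log X := by
      refine (Nat.floor_le (by positivity)).trans ?_
      calc (c * Real.log X) ^ a ≤ Real.log X ^ a := by
            gcongr
            exact mul_le_of_le_one_left hL0.le hc1
        _ ≤ Real.log X ^ (1 : ℝ) := Real.rpow_le_rpow_of_exponent_le h4 ha1
        _ = Real.log X := Real.rpow_one _
    have hzL : (z X : ℝ) ≤ Real.log X ^ C := by
      refine (Nat.floor_le (by positivity)).trans ?_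
      gcongr
      exact mul_le_of_le_one_left hL0.le hc1'
    have hzδ : (z X : ℝ) ^ δ ≤ Real.log X ^ (1 / 2 : ℝ) := by
      calc (z X : ℝ) ^ δ ≤ (Real.log X ^ C) ^ δ := by gcongr
        _ = Real.log X ^ (1 / 2 : ℝ) := by
            rw [← Real.rpow_mul hL0.le, hδ]
            congr 1
            field_simp
    have hzlog' : Real.log (z X) ≤ C * Real.log (Real.log X) := by
      rw [← Real.log_rpow hL0]
      exact Real.log_le_log hz0 hzL
    have hzlog0 : 0 ≤ Real.log (z X) := Real.log_natCast_nonneg _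
    have hpow : (X : ℝ) ^ (1 - δ) = X * Real.exp (-(δ * Real.log X)) := by
      rw [sub_eq_add_neg, Real.rpow_add hX0, Real.rpow_one, Real.rpow_def_of_pos hX0]
      ring_nf
    have h6 := abs_ncard_smallTimesRough_sub_le hδ0.le hδ1 h2 hyz' (X := X)
    rw [Real.norm_eq_abs]
    have h7 : ∀ b v : ℝ, b / X - v = (b - X * v) / X := fun b v => by field_simp
    rw [h7, abs_div, abs_of_pos hX0, div_le_iff₀ hX0]
    refine h6.trans ?_
    rw [hpow, add_mul, sub_add_eq_add_sub, sub_eq_add_neg, Real.exp_add, Real.exp_add,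
      Real.exp_log hL0, mul_add]
    have h8 : Real.exp ((z X : ℝ) ^ δ * (1 + Real.log (z X))) ≤
        Real.exp (Real.log X ^ (1 / 2 : ℝ) * (1 + C * Real.log (Real.log X))) := by
      gcongr
    refine add_le_add ?_ (le_of_eq (by ring))
    calc (y X : ℝ) * (X * Real.exp (-(δ * Real.log X)) *
          Real.exp ((z X : ℝ) ^ δ * (1 + Real.log (z X))))
        ≤ Real.log X * (X * Real.exp (-(δ * Real.log X)) *
          Real.exp (Real.log X ^ (1 / 2 : ℝ) * (1 + C * Real.log (Real.log X)))) := by gcongr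
      _ = _ := by ring
  have := hdiff.add hmain
  rw [zero_add] at this
  refine this.congr fun X => ?_
  ring

lemma finite_smallTimesRough (X y z : ℕ) : (smallTimesRough X y z).Finite :=
  (Icc 1 X).finite_toSet.subset fun _ hM => hM.1

lemma log_le_two_mul_log_of_sqrt_lt {X M : ℕ} (hX : 1 ≤ X) (h : X.sqrt < M) :
    Real.log X ≤ 2 * Real.log M := by
  have h1 : X ≤ M ^ 2 := by
    rw [sq]
    exact (Nat.sqrt_lt.1 h).le
  have h2 : Real.log X ≤ Real.log ((M : ℝ) ^ 2) :=
    Real.log_le_log (by exact_mod_cast hX) (by exact_mod_cast h1)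
  rwa [Real.log_pow] at h2

/-- The integers up to `X` at which `ω` deviates from its approximate mean by at least 5%. -/
noncomputable def atypicalOmega (X : ℕ) : Finset ℕ :=
  {m ∈ Icc 1 X | 1 / 20 * ∑ p ∈ Nat.primesLE X, 1 / (p : ℝ) ≤
    |(#m.primeFactors : ℝ) - ∑ p ∈ Nat.primesLE X, 1 / (p : ℝ)|}

lemma tendsto_sum_inv_primes_atTop :
    Tendsto (fun X : ℕ => ∑ p ∈ Nat.primesLE X, 1 / (p : ℝ)) atTop atTop := by
  have hll : Tendsto (fun X : ℕ => Real.log (Real.log X)) atTop atTop :=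
    Real.tendsto_log_atTop.comp (Real.tendsto_log_atTop.comp tendsto_natCast_atTop_atTop)
  refine (tendsto_sum_inv_primes_sub_log_log.add_atTop hll).congr fun X => ?_
  ring

lemma tendsto_card_atypicalOmega_div :
    Tendsto (fun X : ℕ => (#(atypicalOmega X) : ℝ) / X) atTop (𝓝 0) := by
  have h : Tendsto (fun X : ℕ => 1200 / ∑ p ∈ Nat.primesLE X, 1 / (p : ℝ)) atTop (𝓝 0) :=
    tendsto_sum_inv_primes_atTop.const_div_atTop _
  refine squeeze_zero' (Eventually.of_forall fun X => by positivity) ?_ h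
  filter_upwards [tendsto_sum_inv_primes_atTop.eventually_gt_atTop 0, eventually_ge_atTop 1]
    with X hS hX
  have hX0 : (0 : ℝ) < X := by exact_mod_cast hX
  rw [div_le_iff₀ hX0]
  refine (card_filter_le_abs_card_primeFactors_sub (by norm_num) hS).trans (le_of_eq ?_)
  field_simp
  norm_num

lemma eventually_card_primeFactors_mem_of_notMem_atypicalOmega :
    ∀ᶠ X : ℕ in atTop, ∀ M ∈ Icc 1 X, X.sqrt < M → M ∉ atypicalOmega X →
      0.9 * Real.log (Real.log M) < (#M.primeFactors : ℝ) ∧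
        (#M.primeFactors : ℝ) < 1.1 * Real.log (Real.log M) := by
  set K := Real.eulerMascheroniConstant -
    ∑' n : ℕ, if n.Prime then logDefect (1 / (n : ℝ)) else 0
  have hl : Tendsto (fun X : ℕ => Real.log X) atTop atTop :=
    Real.tendsto_log_atTop.comp tendsto_natCast_atTop_atTop
  filter_upwards [eventually_ge_atTop 1, hl.eventually_gt_atTop 0,
    (Real.tendsto_log_atTop.comp hl).eventually_gt_atTop (100 * (|K| + 2)),
    tendsto_sum_inv_primes_sub_log_log.eventually_lt_const (lt_add_one K),
    tendsto_sum_inv_primes_sub_log_log.eventually_const_lt (sub_one_lt K)]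
    with X hX hL hLL hK1 hK2 M hM hsq hbad
  have h1 := log_le_two_mul_log_of_sqrt_lt hX hsq
  rw [mem_Icc] at hM
  have h2 : Real.log M ≤ Real.log X :=
    Real.log_le_log (by exact_mod_cast hM.1) (by exact_mod_cast hM.2)
  have h3 : Real.log (Real.log M) ≤ Real.log (Real.log X) := Real.log_le_log (by linarith) h2
  have h4 : Real.log (Real.log X) ≤ Real.log 2 + Real.log (Real.log M) := by
    rw [← Real.log_mul (by norm_num) (by linarith)]
    exact Real.log_le_log hL h1
  have h5 := Real.log_two_lt_d9
  have h6 : |(#M.primeFactors : ℝ) - ∑ p ∈ Nat.primesLE X, 1 / (p : ℝ)| <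
      1 / 20 * ∑ p ∈ Nat.primesLE X, 1 / (p : ℝ) := by
    by_contra h
    exact hbad (mem_filter.2 ⟨mem_Icc.2 hM, not_lt.1 h⟩)
  rw [abs_lt] at h6
  simp only [Function.comp_apply] at hLL
  have h7 := neg_abs_le K
  have h8 := le_abs_self K
  constructor <;> linarith [h6.1, h6.2, abs_nonneg K]

lemma inOmega_subset {C : ℝ} (hC : 0 < C) {X : ℕ} (hX : 1 ≤ X) :
    {M | M ∈ Icc 1 X ∧ inOmega C M} ⊆ ↑(Icc 1 X.sqrt) ∪
      smallTimesRough X ⌊(1 * Real.log X) ^ (0.1 : ℝ)⌋₊ ⌊(1 / 2 * Real.log X) ^ C⌋₊ := by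
  rintro M ⟨hM, hs, -, -, A, m, hAm, hA3, hA, hm⟩
  rcases le_or_gt M X.sqrt with h | h
  · exact Or.inl (mem_coe.2 (mem_Icc.2 ⟨(mem_Icc.1 hM).1, h⟩))
  right
  have h1 := log_le_two_mul_log_of_sqrt_lt hX h
  have h0 := Real.log_natCast_nonneg X
  have hM' := mem_Icc.1 hM
  have h2 : Real.log M ≤ Real.log X :=
    Real.log_le_log (by exact_mod_cast hM'.1) (by exact_mod_cast hM'.2)
  have h3 : 0 ≤ Real.log M := by linarith
  refine ⟨hM, hs, A, m, hAm, hA3, Nat.le_floor ?_, fun p hp hpm => ?_⟩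
  · rw [one_mul]
    refine hA.trans ?_
    gcongr
  · refine (Nat.floor_lt (by positivity)).2 (lt_of_le_of_lt ?_ (hm p hp hpm))
    gcongr
    linarith

lemma eventually_smallTimesRough_subset {C : ℝ} (hC : 0 < C) :
    ∀ᶠ X : ℕ in atTop,
      smallTimesRough X ⌊(1 / 2 * Real.log X) ^ (0.1 : ℝ)⌋₊ ⌊(1 * Real.log X) ^ C⌋₊ ⊆
        {M | M ∈ Icc 1 X ∧ inOmega C M} ∪ (↑(Icc 1 X.sqrt) ∪ ↑(atypicalOmega X)) := by
  filter_upwards [eventually_card_primeFactors_mem_of_notMem_atypicalOmega, eventually_ge_atTop 1]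
    with X hω hX
  rintro M ⟨hM, hs, A, m, hAm, hA3, hA, hm⟩
  have hM' := mem_Icc.1 hM
  rcases le_or_gt M X.sqrt with h | h
  · exact Or.inr (Or.inl (mem_coe.2 (mem_Icc.2 ⟨hM'.1, h⟩)))
  by_cases hbad : M ∈ atypicalOmega X
  · exact Or.inr (Or.inr hbad)
  left
  have h1 := log_le_two_mul_log_of_sqrt_lt hX h
  have h0 := Real.log_natCast_nonneg X
  have h2 : Real.log M ≤ Real.log X :=
    Real.log_le_log (by exact_mod_cast hM'.1) (by exact_mod_cast hM'.2)
  have h3 : 0 ≤ Real.log M := by linarith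
  obtain ⟨h4, h5⟩ := hω M hM h hbad
  refine ⟨hM, hs, h4, h5, A, m, hAm, hA3, ?_, fun p hp hpm => ?_⟩
  · refine ((Nat.le_floor_iff (by positivity)).1 hA).trans ?_
    gcongr
    linarith
  · refine lt_of_le_of_lt ?_ (Nat.lt_of_floor_lt (hm p hp hpm))
    rw [one_mul]
    gcongr

lemma tendsto_sqrt_div : Tendsto (fun X : ℕ => (X.sqrt : ℝ) / X) atTop (𝓝 0) := by
  have h : Tendsto (fun X : ℕ => (√(X : ℝ))⁻¹) atTop (𝓝 0) :=
    tendsto_inv_atTop_zero.comp (Real.tendsto_sqrt_atTop.comp tendsto_natCast_atTop_atTop)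
  refine squeeze_zero (fun X => by positivity) (fun X => ?_) h
  rw [← Real.sqrt_div_self]
  gcongr
  exact Real.nat_sqrt_le_real_sqrt

open scoped Classical in
/-- Theorem 1.4: for every sufficiently large `C₀ > 2`, the set `Ω(C₀)` has asymptotic
density `e^(-γ) · 3 / (5 π² C₀)`.  (A "sufficiently large" cutoff in the definition of `Ω`
does not affect its density, so none is imposed here.) -/
theorem stmt_3 :
    ∃ c : ℝ, 2 < c ∧
      ∀ C₀ : ℝ, c ≤ C₀ →
        Filter.Tendsto
          (fun X : ℕ =>
            (((Finset.Icc 1 X).filter (fun M => inOmega C₀ M)).card : ℝ) / (X : ℝ))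
          Filter.atTop
          (nhds (Real.exp (-Real.eulerMascheroniConstant) * 3 /
            (5 * Real.pi ^ 2 * C₀))) := by

  refine ⟨3, by norm_num, fun C hC => ?_⟩
  have hC0 : 0 < C := by linarith
  have hu := (tendsto_ncard_smallTimesRough_div (c := 1) (c' := 1 / 2) (a := 0.1) (C := C)
    (by norm_num) (by norm_num) (by norm_num) (by norm_num) (by norm_num) (by norm_num)
    (by linarith)).add tendsto_sqrt_div
  have hl := (tendsto_ncard_smallTimesRough_div (c := 1 / 2) (c' := 1) (a := 0.1) (C := C)
    (by norm_num) (by norm_num) (by norm_num) (by norm_num) (by norm_num) (by norm_num)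
    (by linarith)).sub (tendsto_sqrt_div.add tendsto_card_atypicalOmega_div)
  have hlim : Real.exp (-Real.eulerMascheroniConstant) * (6 / Real.pi ^ 2) * (0.1 / C) =
      Real.exp (-Real.eulerMascheroniConstant) * 3 / (5 * Real.pi ^ 2 * C) := by
    field_simp
    norm_num
  rw [add_zero, hlim] at hu
  rw [add_zero, sub_zero, hlim] at hl
  have hset : ∀ X : ℕ, ((Icc 1 X).filter fun M => inOmega C M).card =
      {M | M ∈ Icc 1 X ∧ inOmega C M}.ncard := fun X => by
    rw [← Set.ncard_coe_finset, coe_filter]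
  have hsqrt : ∀ X : ℕ, ((Icc 1 X.sqrt : Finset ℕ) : Set ℕ).ncard = X.sqrt := fun X => by
    rw [Set.ncard_coe_finset, Nat.card_Icc, Nat.add_sub_cancel]
  refine tendsto_of_tendsto_of_tendsto_of_le_of_le' hl hu ?_ ?_
  · filter_upwards [eventually_smallTimesRough_subset hC0] with X hX
    have h1 := (Set.ncard_le_ncard hX (((Icc 1 X).finite_toSet.subset fun _ h => h.1).union
      ((finite_toSet _).union (finite_toSet _)))).trans (Set.ncard_union_le _ _)
    have h2 := Set.ncard_union_le (↑(Icc 1 X.sqrt) : Set ℕ) ↑(atypicalOmega X)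
    rw [hsqrt, Set.ncard_coe_finset] at h2
    rw [hset, ← add_div, ← sub_div]
    gcongr
    rw [sub_le_iff_le_add]
    exact_mod_cast h1.trans (Nat.add_le_add_left h2 _)
  · filter_upwards [eventually_ge_atTop 1] with X hX
    have h1 := (Set.ncard_le_ncard (inOmega_subset hC0 hX)
      ((finite_toSet _).union (finite_smallTimesRough _ _ _))).trans (Set.ncard_union_le _ _)
    rw [hsqrt, add_comm] at h1
    rw [hset, ← add_div]
    gcongr
    exact_mod_cast h1
end

section
/- For every fixed ε_0 ∈ (0,1) there is a constant K = K(ε_0) > 0 such that the following holds: if M = Ap with p a sufficiently large prime, gcd(A,p) = 1, and A ≤ p^{ε_0}, then, setting D = A·|R_A|^{−1}·p^{ε_0}, one has Σ_{l > D} K_l·l² ≤ K·A²·p^{1 − 0.47·ε_0}. -/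
open Finset

/-- The set of quadratic residues modulo `M`, as a finset of `ZMod M`. -/
def QR (M : ℕ) : Finset (ZMod M) := (Finset.range M).image (fun a : ℕ => ((a : ZMod M)) ^ 2)

/-- The "universe" finset of `ZMod M` (all residues), valid for any `M ≥ 1`. -/
def univM (M : ℕ) : Finset (ZMod M) := (Finset.range M).image (fun a : ℕ => (a : ZMod M))

/-- `RN_M(C₁, C₂)` for `C₁, C₂ ⊆ Z_M`: the set of `x ∈ Z_M` with `x + c₁ ∈ R_M` for all
`c₁ ∈ C₁` and `x + c₂ ∉ R_M` for all `c₂ ∈ C₂`. -/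
def RNsetZ (M : ℕ) (C₁ C₂ : Finset (ZMod M)) : Finset (ZMod M) :=
  (univM M).filter (fun x => (∀ c ∈ C₁, x + c ∈ QR M) ∧ (∀ c ∈ C₂, x + c ∉ QR M))

/-- `RN_M(C₁, C₂)` for sets `C₁, C₂` of non-negative integers, identified with their
residues in `Z_M`. -/
def RNset (M : ℕ) (C₁ C₂ : Finset ℕ) : Finset (ZMod M) :=
  (univM M).filter
    (fun x => (∀ c ∈ C₁, x + (c : ZMod M) ∈ QR M) ∧ (∀ c ∈ C₂, x + (c : ZMod M) ∉ QR M))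

/-- `N_M(C)` for a set `C` of non-negative integers (identified with residues in `Z_M`):
the set of `x ∈ Z_M` with `x + c ∉ R_M` for all `c ∈ C`. -/
def Nset (M : ℕ) (C : Finset ℕ) : Finset (ZMod M) :=
  (univM M).filter (fun x => ∀ c ∈ C, x + (c : ZMod M) ∉ QR M)

/-- `K_l`: the number of gaps of length `l` in `R_M`, i.e. the number of `x ∈ R_M` with
`x + l ∈ R_M` but `x + j ∉ R_M` for `1 ≤ j ≤ l - 1` (addition in `Z_M`). -/
def Kgap (M l : ℕ) : ℕ :=
  ((QR M).filter (fun x => x + (l : ZMod M) ∈ QR M ∧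
    ∀ j ∈ Finset.Ico 1 l, x + (j : ZMod M) ∉ QR M)).card

section Stepanov

open Polynomial

variable {K : Type*} [Field K]

/-- The linear operator with `derivative^[k] (f ^ e * u) = f ^ (e - k) * powDeriv f e k u`. -/
noncomputable def powDeriv (f : K[X]) (e : ℕ) : ℕ → K[X] →ₗ[K] K[X]
  | 0 => LinearMap.id
  | k + 1 => LinearMap.mulLeft K (((e - k : ℕ) : K[X]) * derivative f) ∘ₗ powDeriv f e k +
      LinearMap.mulLeft K f ∘ₗ derivative ∘ₗ powDeriv f e k

lemma powDeriv_succ (f : K[X]) (e k : ℕ) (u : K[X]) :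
    powDeriv f e (k + 1) u = ((e - k : ℕ) : K[X]) * derivative f * powDeriv f e k u +
      f * derivative (powDeriv f e k u) := rfl

lemma iterate_derivative_pow_mul (f u : K[X]) (e k : ℕ) (hk : k ≤ e) :
    derivative^[k] (f ^ e * u) = f ^ (e - k) * powDeriv f e k u := by
  induction k with
  | zero => simp [powDeriv]
  | succ k ih =>
    obtain ⟨m, hm⟩ : ∃ m, e - k = m + 1 := ⟨e - k - 1, by omega⟩
    have hm' : e - (k + 1) = m := by omega
    rw [Function.iterate_succ_apply', ih (by omega), powDeriv_succ, hm, hm', derivative_mul,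
      derivative_pow]
    simp only [Nat.add_sub_cancel, map_natCast]
    ring

lemma natDegree_powDeriv_le (f u : K[X]) (e k : ℕ) :
    (powDeriv f e k u).natDegree ≤ u.natDegree + k * f.natDegree := by
  induction k with
  | zero => simp [powDeriv]
  | succ k ih =>
    rw [powDeriv_succ]
    refine (natDegree_add_le _ _).trans (max_le ?_ ?_)
    · rw [mul_assoc]
      refine natDegree_mul_le.trans ?_
      rw [natDegree_natCast]
      have h1 := natDegree_mul_le (p := derivative f) (q := powDeriv f e k u)
      have h2 := natDegree_derivative_le f
      have : f.natDegree - 1 ≤ f.natDegree := Nat.sub_le _ _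
      nlinarith
    · refine natDegree_mul_le.trans ?_
      have h2 := natDegree_derivative_le (powDeriv f e k u)
      have : (powDeriv f e k u).natDegree - 1 ≤ (powDeriv f e k u).natDegree := Nat.sub_le _ _
      nlinarith

variable {p : ℕ} [Fact p.Prime]

lemma iterate_derivative_mul_X_pow_mul_char (u : (ZMod p)[X]) (j k : ℕ) :
    derivative^[k] (u * X ^ (j * p)) = derivative^[k] u * X ^ (j * p) := by
  induction k with
  | zero => rfl
  | succ k ih =>
    rw [Function.iterate_succ_apply', ih, derivative_mul, Function.iterate_succ_apply',
      derivative_X_pow]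
    simp

lemma stepanov_constant_term {f r s R S : (ZMod p)[X]} {α : ZMod p} {n c : ℕ}
    (h0 : f.coeff 0 ≠ 0) (hα : Odd (f.rootMultiplicity α)) (hc : 2 * c + 1 = p)
    (hn : f.natDegree + 2 * n < p) (hr : r.natDegree ≤ n) (hs : s.natDegree ≤ n)
    (h : (r + X ^ p * R) + f ^ c * (s + X ^ p * S) = 0) : r = 0 ∧ s = 0 := by
  have hf : f ≠ 0 := by rintro rfl; simp at h0
  obtain ⟨g, hg⟩ : X ∣ f - C (f.coeff 0) := X_dvd_sub_C
  have hfp : f ^ p = C (f.coeff 0) + X ^ p * g ^ p := by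
    have : f = C (f.coeff 0) + X * g := by rw [← hg]; ring
    have h2 : f ^ p = (C (f.coeff 0) + X * g) ^ p := by rw [← this]
    rw [h2, add_pow_char, mul_pow, ← C_pow, ZMod.pow_card]
  have key : f * (r + X ^ p * R) ^ 2 = f ^ p * (s + X ^ p * S) ^ 2 := by
    have : r + X ^ p * R = - (f ^ c * (s + X ^ p * S)) := by linear_combination h
    have hfc : f ^ p = f * (f ^ c) ^ 2 := by
      rw [← pow_mul, ← pow_succ']
      congr 1
      omega
    rw [this, hfc]; ring
  have hdvd : X ^ p ∣ f * r ^ 2 - C (f.coeff 0) * s ^ 2 := by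
    rw [hfp] at key
    refine ⟨g ^ p * (s + X ^ p * S) ^ 2 + C (f.coeff 0) * (2 * s * S + X ^ p * S ^ 2)
      - f * (2 * r * R + X ^ p * R ^ 2), ?_⟩
    linear_combination key
  have hdeg : (f * r ^ 2 - C (f.coeff 0) * s ^ 2).natDegree < p := by
    refine lt_of_le_of_lt (natDegree_sub_le _ _) (max_lt ?_ ?_)
    · refine lt_of_le_of_lt natDegree_mul_le ?_
      have := natDegree_pow_le (p := r) (n := 2)
      omega
    · refine lt_of_le_of_lt (natDegree_C_mul_le _ _) ?_
      have := natDegree_pow_le (p := s) (n := 2)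
      omega
  have heq : f * r ^ 2 = C (f.coeff 0) * s ^ 2 := by
    by_contra hne
    have := natDegree_le_of_dvd hdvd (sub_ne_zero.2 hne)
    rw [natDegree_X_pow] at this
    omega
  have hr0 : r = 0 := by
    by_contra hr0
    have hs0 : s ≠ 0 := by
      rintro rfl
      simp [hf, hr0] at heq
    have := congrArg (rootMultiplicity α) heq
    rw [rootMultiplicity_mul (mul_ne_zero hf (pow_ne_zero _ hr0)),
      rootMultiplicity_mul (mul_ne_zero (C_ne_zero.2 h0) (pow_ne_zero _ hs0)),
      rootMultiplicity_C, pow_two, pow_two, rootMultiplicity_mul (mul_ne_zero hr0 hr0),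
      rootMultiplicity_mul (mul_ne_zero hs0 hs0)] at this
    obtain ⟨m, hm⟩ := hα
    omega
  refine ⟨hr0, ?_⟩
  rw [hr0] at heq
  simpa [h0] using heq.symm

lemma stepanov_nonvanishing {f : (ZMod p)[X]} {α : ZMod p} {n c : ℕ}
    (h0 : f.coeff 0 ≠ 0) (hα : Odd (f.rootMultiplicity α)) (hc : 2 * c + 1 = p)
    (hn : f.natDegree + 2 * n < p) (J : ℕ) (r s : ℕ → (ZMod p)[X])
    (hr : ∀ j < J, (r j).natDegree ≤ n) (hs : ∀ j < J, (s j).natDegree ≤ n)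
    (h : ∑ j ∈ range J, (r j + f ^ c * s j) * X ^ (j * p) = 0) :
    ∀ j < J, r j = 0 ∧ s j = 0 := by
  induction J generalizing r s with
  | zero => simp
  | succ J ih =>
    rw [sum_range_succ'] at h
    have hsplit : ∑ j ∈ range J, (r (j + 1) + f ^ c * s (j + 1)) * X ^ ((j + 1) * p) =
        X ^ p * ∑ j ∈ range J, (r (j + 1) + f ^ c * s (j + 1)) * X ^ (j * p) := by
      rw [mul_sum]
      exact sum_congr rfl fun j _ => by ring
    have hsplit2 : ∑ j ∈ range J, (r (j + 1) + f ^ c * s (j + 1)) * X ^ (j * p) =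
        (∑ j ∈ range J, r (j + 1) * X ^ (j * p)) +
          f ^ c * ∑ j ∈ range J, s (j + 1) * X ^ (j * p) := by
      rw [mul_sum, ← sum_add_distrib]
      exact sum_congr rfl fun j _ => by ring
    have hz := stepanov_constant_term h0 hα hc hn (hr 0 (by omega)) (hs 0 (by omega))
      (R := ∑ j ∈ range J, r (j + 1) * X ^ (j * p))
      (S := ∑ j ∈ range J, s (j + 1) * X ^ (j * p)) (by
        rw [hsplit, hsplit2] at h
        simp only [zero_mul, pow_zero, mul_one] at h
        linear_combination h)
    have := ih (fun j => r (j + 1)) (fun j => s (j + 1)) (fun j hj => hr _ (by omega))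
      (fun j hj => hs _ (by omega)) (by
        rw [hsplit, hz.1, hz.2] at h
        simpa [Fact.out (p := p.Prime).ne_zero] using h)
    intro j hj
    cases j with
    | zero => exact hz
    | succ j => exact this j (by omega)


lemma exists_stepanov_coefficients (f : (ZMod p)[X]) (a : ZMod p) {n c l J : ℕ}
    (hdim : l * (n + J + l * f.natDegree) < J * (2 * (n + 1))) :
    ∃ r s : ℕ → (ZMod p)[X], (∀ j < J, (r j).natDegree ≤ n) ∧ (∀ j < J, (s j).natDegree ≤ n) ∧
      (¬ ∀ j < J, r j = 0 ∧ s j = 0) ∧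
      ∀ k < l, ∑ j ∈ range J,
        (powDeriv f l k (r j) + C a * powDeriv f (l + c) k (s j)) * X ^ j = 0 := by
  let σ : ℕ → (Fin J → degreeLT (ZMod p) (n + 1) × degreeLT (ZMod p) (n + 1)) →ₗ[ZMod p]
      (ZMod p)[X] := fun k =>
    { toFun := fun v => ∑ j : Fin J, (powDeriv f l k ((v j).1 : (ZMod p)[X]) +
        C a * powDeriv f (l + c) k ((v j).2 : (ZMod p)[X])) * X ^ (j : ℕ)
      map_add' := fun v w => by
        rw [← sum_add_distrib]
        refine sum_congr rfl fun j _ => ?_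
        simp only [Pi.add_apply, Prod.fst_add, Prod.snd_add, Submodule.coe_add, map_add]
        ring
      map_smul' := fun b v => by
        rw [RingHom.id_apply, smul_sum]
        refine sum_congr rfl fun j _ => ?_
        simp only [Pi.smul_apply, Prod.smul_fst, Prod.smul_snd, Submodule.coe_smul, map_smul]
        simp only [smul_eq_C_mul]
        ring }
  let Φ : (Fin J → degreeLT (ZMod p) (n + 1) × degreeLT (ZMod p) (n + 1)) →ₗ[ZMod p]
      (Fin l × Fin (n + J + l * f.natDegree) → ZMod p) :=
    LinearMap.pi fun i => lcoeff (ZMod p) (i.2 : ℕ) ∘ₗ σ i.1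
  have hker : LinearMap.ker Φ ≠ ⊥ := by
    apply LinearMap.ker_ne_bot_of_finrank_lt
    have hd : Module.finrank (ZMod p) (degreeLT (ZMod p) (n + 1)) = n + 1 := by
      rw [(degreeLTEquiv (ZMod p) (n + 1)).finrank_eq]; simp
    rw [Module.finrank_fintype_fun_eq_card, Module.finrank_pi_fintype]
    simp only [Module.finrank_prod, hd, Fintype.card_prod,
      Fintype.card_fin, sum_const, card_univ, smul_eq_mul]
    rw [← two_mul]
    exact hdim
  obtain ⟨v, hv, hv0⟩ := Submodule.exists_mem_ne_zero_of_ne_bot hker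
  have hdeg : ∀ u : degreeLT (ZMod p) (n + 1), (u : (ZMod p)[X]).natDegree ≤ n := by
    intro u
    have := mem_degreeLT.1 u.2
    by_cases hu : (u : (ZMod p)[X]) = 0
    · simp [hu]
    · exact Nat.lt_succ_iff.1 ((natDegree_lt_iff_degree_lt hu).2 this)
  refine ⟨fun j => if h : j < J then (v ⟨j, h⟩).1 else 0,
    fun j => if h : j < J then (v ⟨j, h⟩).2 else 0, ?_, ?_, ?_, ?_⟩
  · intro j hj; simpa [hj] using hdeg _
  · intro j hj; simpa [hj] using hdeg _
  · intro h
    apply hv0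
    funext j
    have := h j j.2
    simp only [j.2, dite_true, Fin.eta, ZeroMemClass.coe_eq_zero] at this
    exact Prod.ext this.1 this.2
  · intro k hk
    rw [sum_range]
    simp only [Fin.is_lt, dite_true, Fin.eta]
    change σ k v = 0
    ext i
    rw [coeff_zero]
    by_cases hi : i < n + J + l * f.natDegree
    · exact congrFun (LinearMap.mem_ker.1 hv) (⟨k, hk⟩, ⟨i, hi⟩)
    · apply coeff_eq_zero_of_natDegree_lt
      refine lt_of_lt_of_le ?_ (not_lt.1 hi)
      have hJ : 0 < J := by
        rcases Nat.eq_zero_or_pos J with rfl | h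
        · simp at hdim
        · exact h
      refine lt_of_le_of_lt (b := n + k * f.natDegree + (J - 1)) ?_ ?_
      · change (∑ j : Fin J, (powDeriv f l k ((v j).1 : (ZMod p)[X]) +
          C a * powDeriv f (l + c) k ((v j).2 : (ZMod p)[X])) * X ^ (j : ℕ)).natDegree ≤ _
        refine natDegree_sum_le_of_forall_le _ _ fun j _ => ?_
        refine natDegree_mul_le.trans ?_
        rw [natDegree_X_pow]
        refine add_le_add ((natDegree_add_le _ _).trans (max_le ?_ ?_)) (by omega)
        · exact (natDegree_powDeriv_le _ _ _ _).trans (Nat.add_le_add_right (hdeg _) _)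
        · exact (natDegree_C_mul_le _ _).trans
            ((natDegree_powDeriv_le _ _ _ _).trans (Nat.add_le_add_right (hdeg _) _))
      · have := Nat.mul_le_mul_right f.natDegree hk.le
        omega

/-- Stepanov's bound for the number of solutions of `f x ^ ((p - 1) / 2) = a`. -/
theorem stepanov_count {f : (ZMod p)[X]} {α a : ZMod p} {n c l J : ℕ}
    (h0 : f.coeff 0 ≠ 0) (hα : Odd (f.rootMultiplicity α)) (hc : 2 * c + 1 = p)
    (hn : f.natDegree + 2 * n < p) (hl : l ≤ p)
    (hdim : l * (n + J + l * f.natDegree) < J * (2 * (n + 1))) :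
    l * #{x : ZMod p | f.eval x ^ c = a} ≤ (l + c) * f.natDegree + J * p := by
  rcases Nat.eq_zero_or_pos l with rfl | hlpos
  · simp
  have hJ : 0 < J := by
    rcases Nat.eq_zero_or_pos J with rfl | h
    · simp at hdim
    · exact h
  have hpp : p.Prime := Fact.out
  obtain ⟨r, s, hr, hs, hrs, hσ⟩ := exists_stepanov_coefficients f a (c := c) hdim
  set F : (ZMod p)[X] := ∑ j ∈ range J, (f ^ l * r j + f ^ (l + c) * s j) * X ^ (j * p) with hF
  have hf : f ≠ 0 := by rintro rfl; simp at h0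
  have hF0 : F ≠ 0 := by
    intro hF0
    apply hrs
    apply stepanov_nonvanishing h0 hα hc hn J r s hr hs
    have : F = f ^ l * ∑ j ∈ range J, (r j + f ^ c * s j) * X ^ (j * p) := by
      rw [hF, mul_sum]
      exact sum_congr rfl fun j _ => by ring
    rw [this] at hF0
    exact (mul_eq_zero.1 hF0).resolve_left (pow_ne_zero _ hf)
  have hdegF : F.natDegree ≤ (l + c) * f.natDegree + J * p := by
    refine natDegree_sum_le_of_forall_le _ _ fun j hj => ?_
    have hj := mem_range.1 hj
    refine natDegree_mul_le.trans ?_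
    rw [natDegree_X_pow]
    have h1 : (f ^ l * r j + f ^ (l + c) * s j).natDegree ≤ (l + c) * f.natDegree + n := by
      refine (natDegree_add_le _ _).trans (max_le ?_ ?_)
      · refine natDegree_mul_le.trans (add_le_add (natDegree_pow_le.trans ?_) (hr j hj))
        exact Nat.mul_le_mul_right _ (by omega)
      · exact natDegree_mul_le.trans (add_le_add natDegree_pow_le (hs j hj))
    have h2 : j * p + p ≤ J * p := by
      have := Nat.mul_le_mul_right p (Nat.succ_le_of_lt hj)
      rwa [Nat.succ_mul] at this
    omega
  have hroot : ∀ x : ZMod p, f.eval x ^ c = a → l ≤ F.rootMultiplicity x := by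
    intro x hx
    obtain ⟨l', rfl⟩ : ∃ l', l = l' + 1 := ⟨l - 1, by omega⟩
    refine (lt_rootMultiplicity_iff_isRoot_iterate_derivative_of_mem_nonZeroDivisors hF0 ?_).2 ?_
    · rw [mem_nonZeroDivisors_iff_ne_zero, Ne, ZMod.natCast_eq_zero_iff, hpp.dvd_factorial]
      omega
    · intro k hk
      rw [hF, iterate_derivative_sum, IsRoot.def, eval_finsetSum]
      have hterm : ∀ j ∈ range J, (derivative^[k] ((f ^ (l' + 1) * r j +
          f ^ (l' + 1 + c) * s j) * X ^ (j * p))).eval x = f.eval x ^ (l' + 1 - k) *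
          ((powDeriv f (l' + 1) k (r j) + C a * powDeriv f (l' + 1 + c) k (s j)) * X ^ j).eval x
          := by
        intro j _
        rw [iterate_derivative_mul_X_pow_mul_char, iterate_map_add,
          iterate_derivative_pow_mul _ _ _ _ (by omega),
          iterate_derivative_pow_mul _ _ _ _ (by omega),
          show l' + 1 + c - k = (l' + 1 - k) + c by omega, pow_add]
        simp only [eval_mul, eval_add, eval_pow, eval_X, eval_C, hx]
        rw [mul_comm j p, pow_mul, ZMod.pow_card]
        ring
      rw [sum_congr rfl hterm, ← mul_sum, ← eval_finsetSum, hσ k (by omega)]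
      simp
  calc l * #{x : ZMod p | f.eval x ^ c = a}
      = ∑ x ∈ {x : ZMod p | f.eval x ^ c = a}, l := by rw [sum_const, smul_eq_mul, mul_comm]
    _ ≤ ∑ x ∈ {x : ZMod p | f.eval x ^ c = a}, F.roots.count x := by
        refine sum_le_sum fun x hx => ?_
        rw [count_roots]
        exact hroot x (mem_filter.1 hx).2
    _ ≤ ∑ x : ZMod p, F.roots.count x := sum_le_sum_of_subset (subset_univ _)
    _ = Multiset.card F.roots := by
        rw [Multiset.sum_count_eq_card]; simp
    _ ≤ F.natDegree := card_roots' F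
    _ ≤ _ := hdegF

end Stepanov

section CharacterSums

variable {p : ℕ} [Fact p.Prime]

lemma ringChar_zmod_ne_two (hp : p ≠ 2) : ringChar (ZMod p) ≠ 2 := by
  rwa [ZMod.ringChar_zmod_n]

lemma quadraticChar_pow_half (hp : p ≠ 2) {c : ℕ} (hc : 2 * c + 1 = p) (x : ZMod p) :
    (quadraticChar (ZMod p) x : ZMod p) = x ^ c := by
  rw [quadraticChar_eq_pow_of_char_ne_two' (ringChar_zmod_ne_two hp), ZMod.card]
  congr 1
  omega

open Polynomial in
lemma two_mul_card_prod_pow_eq_le (S : Finset (ZMod p)) (hS : S.Nonempty) (h0 : (0 : ZMod p) ∉ S)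
    (hd : 16 * #S ≤ Nat.sqrt p) {c : ℕ} (hc : 2 * c + 1 = p) (a : ZMod p) :
    2 * #{x : ZMod p | (∏ s ∈ S, (x + s)) ^ c = a} ≤ p + 16 * (#S * Nat.sqrt p) := by
  set f : (ZMod p)[X] := ∏ s ∈ S, (X + C s) with hf
  obtain ⟨α, hα⟩ := hS
  have hdeg : f.natDegree = #S := by
    rw [hf, natDegree_prod_of_monic _ _ fun s _ => monic_X_add_C s]
    simp
  have hroots : f.roots = S.val.map fun s => -s := by
    have : f = ((S.val.map fun s => -s).map fun a => X - C a).prod := by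
      rw [hf, Multiset.map_map, ← prod_map_val]
      simp
    rw [this, roots_multiset_prod_X_sub_C]
  have hmult : f.rootMultiplicity (-α) = 1 := by
    rw [← count_roots, hroots,
      Multiset.count_map_eq_count' _ _ neg_injective, Multiset.count_eq_one_of_mem S.nodup hα]
  have hcoeff : f.coeff 0 ≠ 0 := by
    rw [coeff_zero_eq_eval_zero, hf, eval_prod]
    simp only [eval_add, eval_X, eval_C, zero_add]
    exact prod_ne_zero_iff.2 fun s hs h => h0 (h ▸ hs)
  have hdpos : 0 < #S := card_pos.2 ⟨α, hα⟩
  set l := Nat.sqrt p with hl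
  set d := #S with hd'
  have hl1 : l * l ≤ p := Nat.sqrt_le p
  have hl2 : p ≤ l * l + l + l := Nat.sqrt_le_add p
  obtain ⟨n, hn⟩ : ∃ n, c = n + d :=
    ⟨c - d, by nlinarith [Nat.sub_add_cancel (show d ≤ c by nlinarith)]⟩
  obtain ⟨J, hJ⟩ : ∃ J, 2 * J = l + 4 * d + 4 ∨ 2 * J = l + 4 * d + 5 :=
    ⟨(l + 4 * d + 5) / 2, by omega⟩
  have hmain := stepanov_count (f := f) (α := -α) (a := a) (n := n) (c := c) (l := l) (J := J)
    hcoeff (by rw [hmult]; exact odd_one) hc (by rw [hdeg]; omega) (by nlinarith) (by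
      rw [hdeg]
      have hP : l * l + l + l + l ≤ 2 * (2 * n + 2) := by nlinarith
      have hJ' : l + 4 * d + 4 ≤ 2 * J := by omega
      obtain ⟨P, hP'⟩ : ∃ P, 2 * n + 2 = P + l := ⟨2 * n + 2 - l, by
        have : l ≤ 2 * n + 2 := by nlinarith
        omega⟩
      have h1 : l * l < 2 * P + 1 := by nlinarith
      nlinarith [Nat.mul_le_mul_right P hJ', Nat.mul_le_mul_left d (Nat.lt_succ_iff.1 h1)])
  rw [hdeg] at hmain
  have hcard : #{x : ZMod p | (∏ s ∈ S, (x + s)) ^ c = a} = #{x : ZMod p | f.eval x ^ c = a} := by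
    simp [hf, eval_prod]
  rw [hcard]
  set N := #{x : ZMod p | f.eval x ^ c = a}
  have hlpos : 0 < l := by omega
  refine Nat.le_of_mul_le_mul_left ?_ hlpos
  have hJ2 : 2 * J ≤ l + 4 * d + 5 := by omega
  have h3 : l * (2 * N) ≤ 2 * l * d + p * d + (l + 4 * d + 5) * p := by
    have := Nat.mul_le_mul_right p hJ2
    have h4 : 2 * c * d ≤ p * d := Nat.mul_le_mul_right d (by omega)
    nlinarith
  have h5 : (5 * d + 5) * p ≤ (5 * d + 5) * (l * l + l + l) := Nat.mul_le_mul_left _ hl2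
  have h6 : (5 * d + 5) ≤ 10 * d := by omega
  have h7 := Nat.mul_le_mul_right (l * l + l + l) h6
  have h8 : 16 * (l * d) ≤ d * (l * l) := by
    nlinarith [Nat.mul_le_mul_right (d * l) (show 16 ≤ l by omega)]
  nlinarith

/-- Weil's bound for the quadratic character of a product of distinct linear factors. -/
theorem abs_sum_quadraticChar_prod_le (S : Finset (ZMod p)) (hS : S.Nonempty)
    (h0 : (0 : ZMod p) ∉ S) (hd : 16 * #S ≤ Nat.sqrt p) :
    |∑ x : ZMod p, ∏ s ∈ S, quadraticChar (ZMod p) (x + s)| ≤ 17 * (#S * Nat.sqrt p) := by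
  have hdpos : 0 < #S := card_pos.2 hS
  have hp2 : p ≠ 2 := by
    rintro rfl
    have : Nat.sqrt 2 = 1 := by norm_num
    omega
  obtain ⟨c, hc⟩ : ∃ c, 2 * c + 1 = p := by
    obtain ⟨c, hc⟩ := (Fact.out : p.Prime).odd_of_ne_two hp2
    exact ⟨c, hc.symm⟩
  have hpos := two_mul_card_prod_pow_eq_le S hS h0 hd hc 1
  have hneg := two_mul_card_prod_pow_eq_le S hS h0 hd hc (-1)
  have hzero : #{x : ZMod p | ∏ s ∈ S, (x + s) = 0} ≤ #S := by
    refine (card_le_card (t := S.image fun s => -s) ?_).trans card_image_le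
    intro x hx
    rw [mem_filter, prod_eq_zero_iff] at hx
    obtain ⟨s, hs, h⟩ := hx.2
    exact mem_image.2 ⟨s, hs, by linear_combination -h⟩
  simp_rw [← map_prod]
  have hsum : ∀ a : ZMod p, ((#{x : ZMod p | (∏ s ∈ S, (x + s)) ^ c = a} : ℕ) : ℤ) =
      ∑ x : ZMod p, if (∏ s ∈ S, (x + s)) ^ c = a then 1 else 0 := by
    intro a; rw [card_filter]; push_cast; rfl
  have hsum0 : ((#{x : ZMod p | ∏ s ∈ S, (x + s) = 0} : ℕ) : ℤ) =
      ∑ x : ZMod p, if ∏ s ∈ S, (x + s) = 0 then 1 else 0 := by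
    rw [card_filter]; push_cast; rfl
  have hcard : ∑ _x : ZMod p, (1 : ℤ) = p := by simp
  have hval : ∀ y : ZMod p, (y = 0 ∧ quadraticChar (ZMod p) y = 0) ∨
      (y ^ c = 1 ∧ quadraticChar (ZMod p) y = 1) ∨
      (y ^ c = -1 ∧ quadraticChar (ZMod p) y = -1) := by
    intro y
    by_cases hy : y = 0
    · exact Or.inl ⟨hy, by rw [hy]; simp⟩
    · rcases quadraticChar_dichotomy hy with h | h
      · exact Or.inr (Or.inl ⟨by rw [← quadraticChar_pow_half hp2 hc, h]; simp, h⟩)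
      · exact Or.inr (Or.inr ⟨by rw [← quadraticChar_pow_half hp2 hc, h]; simp, h⟩)
  have hup : ∑ x : ZMod p, quadraticChar (ZMod p) (∏ s ∈ S, (x + s)) ≤
      2 * (#{x : ZMod p | (∏ s ∈ S, (x + s)) ^ c = 1} : ℕ) - p +
        (#{x : ZMod p | ∏ s ∈ S, (x + s) = 0} : ℕ) := by
    rw [hsum, hsum0, ← hcard, mul_sum, ← sum_sub_distrib, ← sum_add_distrib]
    refine sum_le_sum fun x _ => ?_
    rcases hval (∏ s ∈ S, (x + s)) with ⟨h1, h2⟩ | ⟨h1, h2⟩ | ⟨h1, h2⟩ <;> rw [h2] <;>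
      simp only [h1] <;> split_ifs <;> norm_num
  have hlow : -∑ x : ZMod p, quadraticChar (ZMod p) (∏ s ∈ S, (x + s)) ≤
      2 * (#{x : ZMod p | (∏ s ∈ S, (x + s)) ^ c = -1} : ℕ) - p +
        (#{x : ZMod p | ∏ s ∈ S, (x + s) = 0} : ℕ) := by
    rw [hsum, hsum0, ← hcard, mul_sum, ← sum_neg_distrib, ← sum_sub_distrib, ← sum_add_distrib]
    refine sum_le_sum fun x _ => ?_
    rcases hval (∏ s ∈ S, (x + s)) with ⟨h1, h2⟩ | ⟨h1, h2⟩ | ⟨h1, h2⟩ <;> rw [h2] <;>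
      simp only [h1] <;> split_ifs <;> norm_num
  have hle : #S ≤ #S * Nat.sqrt p := Nat.le_mul_of_pos_right _ (by omega)
  zify at hpos hneg hzero hle
  rw [abs_le]
  constructor <;> linarith

open scoped Classical in
/-- The `x` such that the quadratic character takes the value `σ` at `x + 1, …, x + k`. -/
noncomputable def runStarts (p : ℕ) [Fact p.Prime] (σ : ℤ) (k : ℕ) : Finset (ZMod p) :=
  univ.filter fun x => ∀ i ∈ Icc 1 k, quadraticChar (ZMod p) (x + (i : ZMod p)) = σ

/-- Few residue classes start a run of `k` equal values of the quadratic character. -/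
theorem two_pow_mul_card_run_le {k : ℕ} (hk : 16 * k ≤ Nat.sqrt p) {σ : ℤ} (hσ : |σ| = 1) :
    2 ^ k * #(runStarts p σ k) ≤
      p + 2 ^ k * (17 * (k * Nat.sqrt p)) := by
  have hσ2 : σ * σ = 1 := by rw [← abs_mul_abs_self, hσ]; norm_num
  have hkp : k < p := by
    have h1 := Nat.sqrt_le_self p
    have h2 := (Fact.out : p.Prime).pos
    omega
  have hinj : ∀ T ∈ (Icc 1 k).powerset, Set.InjOn (fun i : ℕ => (i : ZMod p)) T := by
    intro T hT i hi j hj hij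
    have hi := mem_Icc.1 (mem_powerset.1 hT hi)
    have hj := mem_Icc.1 (mem_powerset.1 hT hj)
    have := (ZMod.natCast_eq_natCast_iff' i j p).1 hij
    rwa [Nat.mod_eq_of_lt (by omega), Nat.mod_eq_of_lt (by omega)] at this
  have hT : ∀ T ∈ (Icc 1 k).powerset,
      |∑ x : ZMod p, ∏ i ∈ T, (σ * quadraticChar (ZMod p) (x + (i : ZMod p)))| ≤
        if T = ∅ then (p : ℤ) else 17 * (k * Nat.sqrt p) := by
    intro T hT
    split_ifs with hTe
    · simp [hTe]
    · have hTk : #T ≤ k := by simpa using card_le_card (mem_powerset.1 hT)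
      have hcard : #(T.image fun i : ℕ => (i : ZMod p)) = #T := card_image_of_injOn (hinj T hT)
      have := abs_sum_quadraticChar_prod_le (T.image fun i : ℕ => (i : ZMod p))
        ((nonempty_iff_ne_empty.2 hTe).image _) (by
          intro h
          obtain ⟨i, hi, h⟩ := mem_image.1 h
          have hi := mem_Icc.1 (mem_powerset.1 hT hi)
          rw [ZMod.natCast_eq_zero_iff] at h
          have := Nat.le_of_dvd (by omega) h
          omega) (by omega)
      rw [hcard] at this
      simp_rw [prod_image (hinj T hT)] at this
      simp_rw [prod_mul_distrib, prod_const, ← mul_sum, abs_mul, abs_pow, hσ, one_pow, one_mul]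
      refine this.trans ?_
      have : (#T : ℤ) ≤ k := by exact_mod_cast hTk
      gcongr
  have hle : (2 : ℤ) ^ k * (#(runStarts p σ k) : ℕ) ≤
      ∑ x : ZMod p, ∏ i ∈ Icc 1 k, (1 + σ * quadraticChar (ZMod p) (x + (i : ZMod p))) := by
    rw [runStarts, card_filter]
    push_cast
    rw [mul_sum]
    refine sum_le_sum fun x _ => ?_
    split_ifs with h
    · rw [prod_congr rfl fun i hi => by rw [h i hi, hσ2]]
      simp [one_add_one_eq_two]
    · rw [mul_zero]
      refine prod_nonneg fun i _ => ?_
      have h1 : |quadraticChar (ZMod p) (x + (i : ZMod p))| ≤ 1 := by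
        by_cases hz : x + (i : ZMod p) = 0
        · rw [hz]; simp
        · rcases quadraticChar_dichotomy hz with h | h <;> rw [h] <;> norm_num
      have h2 : |σ * quadraticChar (ZMod p) (x + (i : ZMod p))| ≤ 1 := by rwa [abs_mul, hσ, one_mul]
      linarith [(abs_le.1 h2).1]
  simp_rw [prod_one_add] at hle
  rw [sum_comm] at hle
  have hfin : ∑ T ∈ (Icc 1 k).powerset, ∑ x : ZMod p,
      ∏ i ∈ T, (σ * quadraticChar (ZMod p) (x + (i : ZMod p))) ≤
      p + 2 ^ k * (17 * (k * Nat.sqrt p)) := by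
    refine (sum_le_sum fun T h => (le_abs_self _).trans (hT T h)).trans ?_
    refine (sum_le_sum (g := fun T => (if T = ∅ then (p : ℤ) else 0) + 17 * (k * Nat.sqrt p))
      fun T _ => ?_).trans ?_
    · split_ifs
      · have : (0 : ℤ) ≤ 17 * (k * Nat.sqrt p) := by positivity
        linarith
      · simp
    · rw [sum_add_distrib, sum_ite_eq']
      simp
  have := hle.trans hfin
  exact_mod_cast this

end CharacterSums

section Runs

variable {p : ℕ} [Fact p.Prime]

lemma sum_quadraticChar_mul_shift_nonpos (hp : p ≠ 2) {i j : ZMod p} (hij : i ≠ j) :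
    ∑ y : ZMod p, quadraticChar (ZMod p) (y + i) * quadraticChar (ZMod p) (y + j) ≤ 0 := by
  set t := j - i with ht
  have ht0 : t ≠ 0 := sub_ne_zero.2 hij.symm
  have h1 : ∑ y : ZMod p, quadraticChar (ZMod p) (y + i) * quadraticChar (ZMod p) (y + j) =
      ∑ y : ZMod p, quadraticChar (ZMod p) y * quadraticChar (ZMod p) (y + t) := by
    refine Fintype.sum_equiv (Equiv.addRight i) _ _ fun y => ?_
    rw [Equiv.coe_addRight, ht, add_assoc, add_sub_cancel]
  have h2 : ∑ y : ZMod p, quadraticChar (ZMod p) y * quadraticChar (ZMod p) (y + t) =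
      ∑ y ∈ univ.erase (0 : ZMod p), quadraticChar (ZMod p) (1 + t * y⁻¹) := by
    rw [← add_sum_erase _ _ (mem_univ (0 : ZMod p))]
    simp only [MulChar.map_zero, zero_mul, zero_add]
    refine sum_congr rfl fun y hy => ?_
    have hy0 : y ≠ 0 := (mem_erase.1 hy).1
    rw [← map_mul, show y * (y + t) = y ^ 2 * (1 + t * y⁻¹) by field_simp, map_mul,
      quadraticChar_sq_one' hy0, one_mul]
  have h3 : ∑ y ∈ univ.erase (0 : ZMod p), quadraticChar (ZMod p) (1 + t * y⁻¹) =
      ∑ u ∈ univ.erase (1 : ZMod p), quadraticChar (ZMod p) u := by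
    refine sum_bij' (fun y _ => 1 + t * y⁻¹) (fun u _ => t * (u - 1)⁻¹) ?_ ?_ ?_ ?_ ?_
    · intro y hy
      have hy0 : y ≠ 0 := (mem_erase.1 hy).1
      simp [ht0, hy0]
    · intro u hu
      have hu0 : u - 1 ≠ 0 := sub_ne_zero.2 (mem_erase.1 hu).1
      simp [ht0, hu0]
    · intro y hy
      have hy0 : y ≠ 0 := (mem_erase.1 hy).1
      field_simp
      simp [ht0]
    · intro u hu
      have hu0 : u - 1 ≠ 0 := sub_ne_zero.2 (mem_erase.1 hu).1
      field_simp
      simp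
    · intros; rfl
  have h4 := add_sum_erase univ (fun u => quadraticChar (ZMod p) u) (mem_univ (1 : ZMod p))
  rw [quadraticChar_sum_zero (ringChar_zmod_ne_two hp), map_one] at h4
  rw [h1, h2, h3]
  linarith

open scoped Classical in
/-- The second moment bound for the set of shifts of `J` consisting of nonresidues. -/
theorem card_nonresidue_shift_mul_card_le (hp : p ≠ 2) (J : Finset ℕ) (hJ : ∀ j ∈ J, j < p) :
    #{y : ZMod p | ∀ j ∈ J, quadraticChar (ZMod p) (y + (j : ZMod p)) = -1} * #J ≤ p := by
  rcases J.eq_empty_or_nonempty with rfl | hne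
  · simp
  set B : Finset (ZMod p) :=
    {y : ZMod p | ∀ j ∈ J, quadraticChar (ZMod p) (y + (j : ZMod p)) = -1} with hB
  have hlow : (#B : ℤ) * (#J) ^ 2 ≤
      ∑ y : ZMod p, (∑ j ∈ J, quadraticChar (ZMod p) (y + (j : ZMod p))) ^ 2 := by
    calc (#B : ℤ) * (#J) ^ 2
        = ∑ y ∈ B, (∑ j ∈ J, quadraticChar (ZMod p) (y + (j : ZMod p))) ^ 2 := by
          rw [sum_congr rfl (g := fun _ => ((#J : ℤ)) ^ 2)]
          · simp
          · intro y hy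
            rw [sum_congr rfl fun j hj => (mem_filter.1 hy).2 j hj]
            simp
      _ ≤ _ := sum_le_sum_of_subset_of_nonneg (subset_univ _) fun _ _ _ => sq_nonneg _
  have hup : ∑ y : ZMod p, (∑ j ∈ J, quadraticChar (ZMod p) (y + (j : ZMod p))) ^ 2 ≤
      (p : ℤ) * #J := by
    simp_rw [pow_two, sum_mul_sum]
    rw [sum_comm]
    simp_rw [sum_comm (s := (univ : Finset (ZMod p)))]
    calc _ ≤ ∑ i ∈ J, ∑ j ∈ J, (if i = j then (p : ℤ) else 0) := by
          refine sum_le_sum fun i hi => sum_le_sum fun j hj => ?_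
          split_ifs with hij
          · subst hij
            refine (sum_le_sum (g := fun _ => (1 : ℤ)) fun y _ => ?_).trans (by simp)
            by_cases hz : y + (i : ZMod p) = 0
            · rw [hz]; simp
            · rcases quadraticChar_dichotomy hz with h | h <;> rw [h] <;> norm_num
          · apply sum_quadraticChar_mul_shift_nonpos hp
            intro h
            have := (ZMod.natCast_eq_natCast_iff' i j p).1 h
            rw [Nat.mod_eq_of_lt (hJ i hi), Nat.mod_eq_of_lt (hJ j hj)] at this
            exact hij this
      _ = _ := by
          simp only [sum_ite_eq]
          rw [sum_congr rfl fun i hi => if_pos hi]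
          simp [mul_comm]
  have h := hlow.trans hup
  have hJpos : 0 < #J := card_pos.2 hne
  refine Nat.le_of_mul_le_mul_right ?_ hJpos
  zify
  linarith [h, pow_two (#J : ℤ), mul_assoc (#B : ℤ) #J #J]

lemma sum_gcd_le (n : ℕ) :
    ∑ a ∈ Icc 1 n, ∑ b ∈ Icc 1 n, (Nat.gcd a b : ℝ) ≤ n ^ 2 * (1 + Real.log n) := by
  have h1 : ∀ a ∈ Icc 1 n, ∀ b ∈ Icc 1 n, (Nat.gcd a b : ℝ) ≤
      ∑ d ∈ Icc 1 n, if d ∣ a ∧ d ∣ b then (d : ℝ) else 0 := by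
    intro a ha b hb
    have ha := mem_Icc.1 ha
    have hmem : Nat.gcd a b ∈ Icc 1 n := mem_Icc.2
      ⟨Nat.gcd_pos_of_pos_left _ ha.1, (Nat.gcd_le_left _ ha.1).trans ha.2⟩
    refine le_trans (le_of_eq ?_) (single_le_sum (f := fun d : ℕ =>
      if d ∣ a ∧ d ∣ b then (d : ℝ) else 0) (fun d _ => by positivity) hmem)
    simp [Nat.gcd_dvd_left, Nat.gcd_dvd_right]
  have hcount : ∀ d ∈ Icc 1 n, (#{a ∈ Icc 1 n | d ∣ a} : ℝ) ≤ n / d := by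
    intro d hd
    have : #{a ∈ Icc 1 n | d ∣ a} = n / d := by
      rw [← Nat.Ioc_filter_dvd_card_eq_div]
      rfl
    rw [this]
    exact Nat.cast_div_le
  calc ∑ a ∈ Icc 1 n, ∑ b ∈ Icc 1 n, (Nat.gcd a b : ℝ)
      ≤ ∑ a ∈ Icc 1 n, ∑ b ∈ Icc 1 n, ∑ d ∈ Icc 1 n,
          (if d ∣ a then 1 else 0) * (if d ∣ b then 1 else 0) * (d : ℝ) := by
        refine sum_le_sum fun a ha => sum_le_sum fun b hb => (h1 a ha b hb).trans (le_of_eq ?_)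
        refine sum_congr rfl fun d _ => ?_
        split_ifs <;> simp_all
    _ = ∑ d ∈ Icc 1 n, (#{a ∈ Icc 1 n | d ∣ a} : ℝ) * #{a ∈ Icc 1 n | d ∣ a} * d := by
        simp_rw [card_filter]
        push_cast
        simp_rw [sum_mul_sum, sum_mul]
        symm
        rw [sum_comm]
        exact sum_congr rfl fun a _ => sum_comm
    _ ≤ ∑ d ∈ Icc 1 n, (n : ℝ) ^ 2 * (d : ℝ)⁻¹ := by
        refine sum_le_sum fun d hd => ?_
        have hd1 : (0 : ℝ) < d := by exact_mod_cast (mem_Icc.1 hd).1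
        have := hcount d hd
        calc _ ≤ (n / d : ℝ) * (n / d) * d := by gcongr
          _ = _ := by field_simp
    _ ≤ n ^ 2 * (1 + Real.log n) := by
        rw [← mul_sum]
        have := harmonic_le_one_add_log n
        rw [harmonic_eq_sum_Icc] at this
        push_cast at this
        gcongr

end Runs

section LongRuns

lemma card_le_div_add_one {L d : ℕ} {X : Finset ℕ} (hX : X ⊆ Icc 1 L)
    (h : ∀ x ∈ X, ∀ y ∈ X, x ≡ y [MOD d]) : #X ≤ L / d + 1 := by
  rw [← card_range (L / d + 1)]
  refine card_le_card_of_injOn (fun x => x / d) (fun x hx => ?_) fun x hx y hy hxy => ?_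
  · have := (mem_Icc.1 (hX hx)).2
    simp only [coe_range, Set.mem_Iio]
    exact Nat.lt_succ_of_le (Nat.div_le_div_right this)
  · have h1 : x % d = y % d := h x hx y hy
    have hxy : x / d = y / d := hxy
    rw [← Nat.div_add_mod x d, ← Nat.div_add_mod y d, h1, hxy]

lemma sq_sum_card_le {α β : Type*} [DecidableEq β] (s : Finset α) (W : Finset β) (f : α → β)
    (hf : ∀ x ∈ s, f x ∈ W) : #s ^ 2 ≤ #W * ∑ x ∈ s, #{y ∈ s | f y = f x} := by
  have h1 : ∑ x ∈ s, #{y ∈ s | f y = f x} = ∑ w ∈ W, #{y ∈ s | f y = w} ^ 2 := by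
    rw [← sum_fiberwise_of_maps_to hf]
    refine sum_congr rfl fun w _ => ?_
    rw [sum_congr rfl (g := fun _ => #{y ∈ s | f y = w})]
    · rw [sum_const, smul_eq_mul, pow_two]
    · intro x hx
      rw [(mem_filter.1 hx).2]
  rw [h1, card_eq_sum_card_fiberwise hf]
  exact sq_sum_le_card_mul_sum_sq

variable {p : ℕ} [Fact p.Prime]

lemma natCast_zmod_ne_zero {a : ℕ} (h0 : 0 < a) (h : a < p) : (a : ZMod p) ≠ 0 := by
  rw [Ne, ZMod.natCast_eq_zero_iff]
  exact fun hd => (Nat.le_of_dvd h0 hd).not_gt h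

lemma mem_runStarts {σ : ℤ} {k : ℕ} {x : ZMod p} :
    x ∈ runStarts p σ k ↔ ∀ i ∈ Icc 1 k, quadraticChar (ZMod p) (x + (i : ZMod p)) = σ := by
  simp [runStarts]

lemma card_quotient_coincidences_le (N : ZMod p) {Q L a b : ℕ} (hQL : 4 * (Q * L) < p)
    (ha : a ∈ Ioc Q (2 * Q)) (hb : b ∈ Ioc Q (2 * Q)) :
    Q * #{x ∈ Icc 1 L ×ˢ Icc 1 L | (N + (x.2 : ZMod p)) * a = (N + (x.1 : ZMod p)) * b} ≤
      L * Nat.gcd a b + Q := by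
  rw [mem_Ioc] at ha hb
  set P := {x ∈ Icc 1 L ×ˢ Icc 1 L | (N + (x.2 : ZMod p)) * a = (N + (x.1 : ZMod p)) * b} with hP
  have key : ∀ x ∈ P, ∀ y ∈ P,
      ((x.1 : ℤ) - y.1) * b = ((x.2 : ℤ) - y.2) * a := by
    intro x hx y hy
    rw [hP, mem_filter, mem_product, mem_Icc, mem_Icc] at hx hy
    obtain ⟨⟨⟨_, _⟩, _, _⟩, hx⟩ := hx
    obtain ⟨⟨⟨_, _⟩, _, _⟩, hy⟩ := hy
    have hz : ((((x.1 : ℤ) - y.1) * b - ((x.2 : ℤ) - y.2) * a : ℤ) : ZMod p) = 0 := by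
      push_cast
      linear_combination hy - hx
    rw [ZMod.intCast_zmod_eq_zero_iff_dvd] at hz
    refine sub_eq_zero.1 (Int.eq_zero_of_abs_lt_dvd hz ?_)
    have h1 : |((x.1 : ℤ) - y.1) * b| ≤ L * (2 * Q) := by
      rw [abs_mul]
      refine mul_le_mul ?_ ?_ (abs_nonneg _) (by positivity)
      · rw [abs_le]; constructor <;> omega
      · rw [abs_le]; constructor <;> omega
    have h2 : |((x.2 : ℤ) - y.2) * a| ≤ L * (2 * Q) := by
      rw [abs_mul]
      refine mul_le_mul ?_ ?_ (abs_nonneg _) (by positivity)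
      · rw [abs_le]; constructor <;> omega
      · rw [abs_le]; constructor <;> omega
    have h3 : (4 : ℤ) * (Q * L) < p := by exact_mod_cast hQL
    have := abs_sub (((x.1 : ℤ) - y.1) * b) (((x.2 : ℤ) - y.2) * a)
    linarith
  have hinj : Set.InjOn Prod.fst (P : Set (ℕ × ℕ)) := by
    intro x hx y hy hxy
    have h := key x hx y hy
    rw [hxy, sub_self, zero_mul, eq_comm, mul_eq_zero] at h
    ext
    · exact hxy
    · omega
  set g := Nat.gcd a b with hg
  have hgpos : 0 < g := Nat.gcd_pos_of_pos_left _ (by omega)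
  have hdpos : 0 < a / g := Nat.div_pos (Nat.gcd_le_left _ (by omega)) hgpos
  have hcard : #(P.image Prod.fst) ≤ L / (a / g) + 1 := by
    refine card_le_div_add_one (fun m hm => ?_) ?_
    · obtain ⟨x, hx, rfl⟩ := mem_image.1 hm
      exact (mem_product.1 (mem_filter.1 hx).1).1
    · intro m hm n hn
      obtain ⟨x, hx, rfl⟩ := mem_image.1 hm
      obtain ⟨y, hy, rfl⟩ := mem_image.1 hn
      have h : b * x.1 ≡ b * y.1 [MOD a] := by
        rw [← Int.natCast_modEq_iff, Int.modEq_iff_dvd]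
        refine ⟨y.2 - x.2, ?_⟩
        push_cast
        linear_combination -key x hx y hy
      exact Nat.ModEq.cancel_left_div_gcd (by omega) h
  rw [card_image_of_injOn hinj] at hcard
  have hag : a / g * g = a := Nat.div_mul_cancel (Nat.gcd_dvd_left _ _)
  calc Q * #P ≤ Q * (L / (a / g) + 1) := by gcongr
    _ = Q * (L / (a / g)) + Q := by ring
    _ ≤ (a / g * g) * (L / (a / g)) + Q := by
        gcongr
        omega
    _ = (a / g * (L / (a / g))) * g + Q := by ring
    _ ≤ L * g + Q := by
        gcongr
        exact Nat.mul_div_le _ _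

lemma sum_card_quotient_coincidences_le (N : ZMod p) {Q L : ℕ} (hp : 4 * (Q * L) < p) :
    (Q : ℝ) * (∑ a ∈ Ioc Q (2 * Q), ∑ b ∈ Ioc Q (2 * Q),
      #{x ∈ Icc 1 L ×ˢ Icc 1 L |
        (N + (x.2 : ZMod p)) * a = (N + (x.1 : ZMod p)) * b} : ℕ) ≤
      L * ((2 * Q) ^ 2 * (1 + Real.log (2 * Q))) + Q * Q * Q := by
  calc _ ≤ ((∑ a ∈ Ioc Q (2 * Q), ∑ b ∈ Ioc Q (2 * Q), (L * Nat.gcd a b + Q) : ℕ) : ℝ) := by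
        rw [← Nat.cast_mul, Nat.cast_le, mul_sum]
        refine sum_le_sum fun a ha => ?_
        rw [mul_sum]
        exact sum_le_sum fun b hb => card_quotient_coincidences_le N hp ha hb
    _ = L * (∑ a ∈ Ioc Q (2 * Q), ∑ b ∈ Ioc Q (2 * Q), (Nat.gcd a b : ℝ)) + Q * Q * Q := by
        push_cast
        simp only [sum_add_distrib, ← mul_sum, sum_const, Nat.card_Ioc]
        simp [two_mul]
        ring
    _ ≤ _ := by
        gcongr
        refine le_trans ?_ ((sum_gcd_le (2 * Q)).trans_eq (by rw [Nat.cast_mul, Nat.cast_ofNat]))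
        have hsub : Ioc Q (2 * Q) ⊆ Icc 1 (2 * Q) := fun a ha => by
          rw [mem_Ioc] at ha
          rw [mem_Icc]
          omega
        refine (sum_le_sum fun a _ => sum_le_sum_of_subset_of_nonneg hsub
          fun _ _ _ => by positivity).trans ?_
        exact sum_le_sum_of_subset_of_nonneg hsub fun _ _ _ => by positivity

/-- A long run of equal values of the quadratic character produces many short ones (Burgess). -/
theorem mul_le_card_runStarts_of_run {N : ZMod p} {σ : ℤ} (hσ : |σ| = 1) {H Q L k : ℕ}
    (hQ : 1 ≤ Q) (hQL : Q ≤ L) (hp : 4 * (Q * L) < p) (hH : L + 2 * Q * k ≤ H)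
    (hN : ∀ i ∈ Icc 1 H, quadraticChar (ZMod p) (N + (i : ZMod p)) = σ) :
    (Q * L : ℝ) ≤ 5 * (1 + Real.log (2 * Q)) *
      ((#(runStarts p 1 k) : ℝ) + #(runStarts p (-1) k)) := by
  have hL : 1 ≤ L := hQ.trans hQL
  have h2Q : 2 * Q < p := by nlinarith
  set s := Ioc Q (2 * Q) ×ˢ Icc 1 L with hs
  have hne : ∀ a ∈ Ioc Q (2 * Q), (a : ZMod p) ≠ 0 := fun a ha => by
    rw [mem_Ioc] at ha
    exact natCast_zmod_ne_zero (by omega) (by omega)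
  have hW : ∀ x ∈ s, (N + (x.2 : ZMod p)) / (x.1 : ZMod p) ∈
      runStarts p 1 k ∪ runStarts p (-1) k := by
    rintro ⟨a, m⟩ hx
    obtain ⟨ha, hm⟩ := mem_product.1 hx
    have ha0 := hne a ha
    simp only [mem_Ioc, mem_Icc] at ha hm
    have hval : ∀ i ∈ Icc 1 k, quadraticChar (ZMod p)
        ((N + (m : ZMod p)) / (a : ZMod p) + (i : ZMod p)) =
          σ * quadraticChar (ZMod p) (a : ZMod p)⁻¹ := by
      intro i hi
      rw [mem_Icc] at hi
      have hmem : m + i * a ∈ Icc 1 H := by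
        rw [mem_Icc]
        have : i * a ≤ k * (2 * Q) := Nat.mul_le_mul hi.2 ha.2
        constructor
        · omega
        · nlinarith
      rw [← hN _ hmem, ← map_mul]
      congr 1
      push_cast
      field_simp
      ring
    rw [mem_union, mem_runStarts, mem_runStarts]
    have hsa : |σ * quadraticChar (ZMod p) (a : ZMod p)⁻¹| = 1 := by
      rw [abs_mul, hσ, one_mul]
      rcases quadraticChar_dichotomy (inv_ne_zero ha0) with h | h <;> rw [h] <;> norm_num
    rcases (abs_eq one_pos.le).1 hsa with h | h
    · exact Or.inl fun i hi => by rw [hval i hi, h]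
    · exact Or.inr fun i hi => by rw [hval i hi, h]
  have hCS := sq_sum_card_le s _ _ hW
  have hcs : #s = Q * L := by
    rw [hs, card_product, Nat.card_Ioc, Nat.card_Icc]
    congr 1
    omega
  have hT : ∑ x ∈ s, #{y ∈ s | (N + (y.2 : ZMod p)) / (y.1 : ZMod p) =
      (N + (x.2 : ZMod p)) / (x.1 : ZMod p)} = ∑ a ∈ Ioc Q (2 * Q), ∑ b ∈ Ioc Q (2 * Q),
        #{x ∈ Icc 1 L ×ˢ Icc 1 L |
          (N + (x.2 : ZMod p)) * a = (N + (x.1 : ZMod p)) * b} := by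
    simp_rw [card_filter]
    rw [hs]
    simp_rw [sum_product]
    refine sum_congr rfl fun a ha => ?_
    rw [sum_comm]
    refine sum_congr rfl fun b hb => ?_
    refine sum_congr rfl fun m _ => sum_congr rfl fun n _ => ?_
    congr 1
    rw [div_eq_div_iff (hne b hb) (hne a ha)]
  have hlog : 0 ≤ Real.log (2 * Q) := Real.log_nonneg (by
    have : (1 : ℝ) ≤ Q := by exact_mod_cast hQ
    linarith)
  have hQr : (1 : ℝ) ≤ Q := by exact_mod_cast hQ
  have hQLr : (Q : ℝ) ≤ L := by exact_mod_cast hQL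
  have hTle := sum_card_quotient_coincidences_le N hp
  rw [hT, hcs] at hCS
  generalize (∑ a ∈ Ioc Q (2 * Q), ∑ b ∈ Ioc Q (2 * Q), #{x ∈ Icc 1 L ×ˢ Icc 1 L |
        (N + (x.2 : ZMod p)) * a = (N + (x.1 : ZMod p)) * b}) = T at hTle hCS
  have hU : (#(runStarts p 1 k ∪ runStarts p (-1) k) : ℝ) ≤
      (#(runStarts p 1 k) : ℝ) + #(runStarts p (-1) k) := by
    rw [← Nat.cast_add, Nat.cast_le]
    exact card_union_le _ _
  have hCSr : ((Q : ℝ) * L) ^ 2 ≤ #(runStarts p 1 k ∪ runStarts p (-1) k) * (T : ℝ) := by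
    rw [← Nat.cast_mul, ← Nat.cast_mul, ← Nat.cast_pow, Nat.cast_le]
    exact hCS
  have hT5 : (T : ℝ) ≤ 5 * (1 + Real.log (2 * Q)) * (Q * L) := by
    refine le_of_mul_le_mul_left (hTle.trans ?_) (by linarith : (0 : ℝ) < Q)
    have : (Q : ℝ) * Q * Q ≤ Q * Q * L * (1 + Real.log (2 * Q)) := by
      calc (Q : ℝ) * Q * Q ≤ Q * Q * L := by gcongr
        _ ≤ Q * Q * L * (1 + Real.log (2 * Q)) := le_mul_of_one_le_right (by positivity)
          (by linarith)
    linarith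
  have hpos : (0 : ℝ) < Q * L := by
    have : (0 : ℝ) < L := by linarith
    have : (0 : ℝ) < Q := by linarith
    positivity
  refine le_of_mul_le_mul_right ?_ hpos
  calc (Q * L : ℝ) * (Q * L) = ((Q : ℝ) * L) ^ 2 := by ring
    _ ≤ _ := hCSr
    _ ≤ ((#(runStarts p 1 k) : ℝ) + #(runStarts p (-1) k)) *
        (5 * (1 + Real.log (2 * Q)) * (Q * L)) := by gcongr
    _ = _ := by ring

end LongRuns

section Asymptotics

open Filter

lemma eventually_mul_log_le_rpow (C : ℝ) {r : ℝ} (hr : 0 < r) :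
    ∀ᶠ n : ℕ in atTop, C * Real.log n ≤ (n : ℝ) ^ r := by
  have h := ((isLittleO_log_rpow_atTop hr).const_mul_left C).bound one_pos
  filter_upwards [tendsto_natCast_atTop_atTop.eventually h] with n hn
  rw [one_mul, Real.norm_of_nonneg (Real.rpow_nonneg n.cast_nonneg r)] at hn
  exact (le_abs_self _).trans hn

lemma eventually_const_le_rpow (C : ℝ) {r : ℝ} (hr : 0 < r) :
    ∀ᶠ n : ℕ in atTop, C ≤ (n : ℝ) ^ r :=
  tendsto_natCast_atTop_atTop.eventually ((tendsto_rpow_atTop hr).eventually_ge_atTop C)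

lemma one_le_log_of_three_le {n : ℕ} (hn : 3 ≤ n) : 1 ≤ Real.log n := by
  have h3 : (3 : ℝ) ≤ n := by exact_mod_cast hn
  rw [Real.le_log_iff_exp_le (by linarith)]
  linarith [Real.exp_one_lt_d9]

lemma natLog_two_add_one_le {n : ℕ} (hn : 3 ≤ n) :
    ((Nat.log 2 n + 1 : ℕ) : ℝ) ≤ 3 * Real.log n := by
  have h1 := one_le_log_of_three_le hn
  have h2 : ((Nat.log 2 n : ℕ) : ℝ) ≤ Real.log n / Real.log 2 := by
    simpa [Real.logb] using Real.natLog_le_logb n 2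
  have h3 := Real.log_two_gt_d9
  have h4 : Real.log n / Real.log 2 ≤ 2 * Real.log n := by
    rw [div_le_iff₀ (by linarith)]
    nlinarith
  push_cast
  linarith

lemma runStarts_subset {p : ℕ} [Fact p.Prime] {σ : ℤ} {k h : ℕ} (hkh : k ≤ h) :
    runStarts p σ h ⊆ runStarts p σ k := fun x hx => by
  rw [mem_runStarts] at hx ⊢
  exact fun i hi => hx i (Icc_subset_Icc_right hkh hi)

theorem eventually_card_runStarts_le : ∀ᶠ p : ℕ in atTop, ∀ [Fact p.Prime], ∀ σ : ℤ, |σ| = 1 →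
    ∀ h : ℕ, Nat.log 2 p + 1 ≤ h → (#(runStarts p σ h) : ℝ) ≤ (p : ℝ) ^ (0.501 : ℝ) := by
  filter_upwards [eventually_mul_log_le_rpow 100 (r := 0.001) (by norm_num),
    eventually_ge_atTop 3] with p hlog hp3 _ σ hσ h hh
  set k := Nat.log 2 p + 1 with hk
  have hk3 : (k : ℝ) ≤ 3 * Real.log p := natLog_two_add_one_le hp3
  have hp1 : (1 : ℝ) ≤ p := by exact_mod_cast (by omega : 1 ≤ p)
  have hlog1 := one_le_log_of_three_le hp3
  have hks : 16 * k ≤ Nat.sqrt p := by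
    rw [Nat.le_sqrt, ← Nat.cast_le (α := ℝ)]
    push_cast
    calc (16 * k : ℝ) * (16 * k) ≤ (p : ℝ) ^ (0.001 : ℝ) * (p : ℝ) ^ (0.001 : ℝ) := by
          gcongr <;> linarith
      _ = (p : ℝ) ^ (0.002 : ℝ) := by
          rw [← Real.rpow_add (by linarith)]
          norm_num
      _ ≤ (p : ℝ) ^ (1 : ℝ) := Real.rpow_le_rpow_of_exponent_le hp1 (by norm_num)
      _ = p := Real.rpow_one _
  have hpk : p ≤ 2 ^ k := (Nat.lt_pow_succ_log_self (by norm_num) p).le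
  have hcount : #(runStarts p σ k) ≤ 18 * (k * Nat.sqrt p) := by
    have h1 := two_pow_mul_card_run_le hks hσ
    have hpos : 0 < 2 ^ k := by positivity
    have hks1 : 1 ≤ k * Nat.sqrt p :=
      Nat.mul_pos (by omega) (by omega)
    refine Nat.le_of_mul_le_mul_left (h1.trans ?_) hpos
    nlinarith
  have hsub : #(runStarts p σ h) ≤ 18 * (k * Nat.sqrt p) :=
    (card_le_card (runStarts_subset hh)).trans hcount
  calc (#(runStarts p σ h) : ℝ) ≤ 18 * (k * Nat.sqrt p) := by exact_mod_cast hsub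
    _ ≤ 18 * (3 * Real.log p * Real.sqrt p) := by
        gcongr
        exact Real.nat_sqrt_le_real_sqrt
    _ = (54 * Real.log p) * (p : ℝ) ^ (0.5 : ℝ) := by
        rw [Real.sqrt_eq_rpow]
        norm_num
        ring
    _ ≤ (p : ℝ) ^ (0.001 : ℝ) * (p : ℝ) ^ (0.5 : ℝ) := by
        gcongr
        linarith
    _ = (p : ℝ) ^ (0.501 : ℝ) := by
        rw [← Real.rpow_add (by linarith)]
        norm_num

theorem eventually_run_length_lt : ∀ᶠ p : ℕ in atTop, ∀ [Fact p.Prime], ∀ σ : ℤ, |σ| = 1 →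
    ∀ H : ℕ, (runStarts p σ H).Nonempty → (H : ℝ) < (p : ℝ) ^ (0.255 : ℝ) := by
  filter_upwards [eventually_mul_log_le_rpow 100 (r := 0.001) (by norm_num),
    eventually_ge_atTop 3, eventually_card_runStarts_le] with p hlog hp3 hcard _ σ hσ H ⟨N, hN⟩
  by_contra! hH
  have hp0 : (0 : ℝ) < p := by exact_mod_cast (by omega : 0 < p)
  have hp1 : (1 : ℝ) ≤ p := by exact_mod_cast (by omega : 1 ≤ p)
  have hlog1 := one_le_log_of_three_le hp3
  set k := Nat.log 2 p + 1 with hk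
  have hk3 : (k : ℝ) ≤ 3 * Real.log p := natLog_two_add_one_le hp3
  have hk1 : (1 : ℝ) ≤ k := by exact_mod_cast (by omega : 1 ≤ k)
  set Q := ⌈(p : ℝ) ^ (0.253 : ℝ)⌉₊ with hQ
  have hq1 : (1 : ℝ) ≤ (p : ℝ) ^ (0.253 : ℝ) := Real.one_le_rpow hp1 (by norm_num)
  have hQlow : (p : ℝ) ^ (0.253 : ℝ) ≤ Q := Nat.le_ceil _
  have hQup : (Q : ℝ) ≤ 2 * (p : ℝ) ^ (0.253 : ℝ) := by
    have := (Nat.ceil_lt_add_one (by linarith : (0 : ℝ) ≤ (p : ℝ) ^ (0.253 : ℝ))).le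
    rw [hQ]
    linarith
  have hQ1 : 1 ≤ Q := Nat.ceil_pos.2 (by linarith)
  have hsmall : 4 * (Q * (Q * k)) < p := by
    rw [← Nat.cast_lt (α := ℝ)]
    push_cast
    calc (4 * (Q * (Q * k)) : ℝ)
        ≤ 4 * ((2 * (p : ℝ) ^ (0.253 : ℝ)) * ((2 * (p : ℝ) ^ (0.253 : ℝ)) *
            (3 * Real.log p))) := by gcongr
      _ = 48 * Real.log p * ((p : ℝ) ^ (0.253 : ℝ) * (p : ℝ) ^ (0.253 : ℝ)) := by ring
      _ ≤ (p : ℝ) ^ (0.001 : ℝ) * ((p : ℝ) ^ (0.253 : ℝ) * (p : ℝ) ^ (0.253 : ℝ)) := by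
          gcongr
          linarith
      _ = (p : ℝ) ^ (0.507 : ℝ) := by
          rw [← Real.rpow_add hp0, ← Real.rpow_add hp0]
          norm_num
      _ < (p : ℝ) ^ (1 : ℝ) := Real.rpow_lt_rpow_of_exponent_lt
          (by exact_mod_cast (by omega : 1 < p)) (by norm_num)
      _ = p := Real.rpow_one _
  have hlen : Q * k + 2 * Q * k ≤ H := by
    rw [← Nat.cast_le (α := ℝ)]
    push_cast
    calc (Q * k + 2 * Q * k : ℝ) = 3 * (Q * k) := by ring
      _ ≤ 3 * (2 * (p : ℝ) ^ (0.253 : ℝ) * (3 * Real.log p)) := by gcongr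
      _ = 18 * Real.log p * (p : ℝ) ^ (0.253 : ℝ) := by ring
      _ ≤ (p : ℝ) ^ (0.001 : ℝ) * (p : ℝ) ^ (0.253 : ℝ) := by
          gcongr
          linarith
      _ = (p : ℝ) ^ (0.254 : ℝ) := by
          rw [← Real.rpow_add hp0]
          norm_num
      _ ≤ (p : ℝ) ^ (0.255 : ℝ) := Real.rpow_le_rpow_of_exponent_le hp1 (by norm_num)
      _ ≤ H := hH
  have hmain := mul_le_card_runStarts_of_run hσ hQ1 (Nat.le_mul_of_pos_right Q (by omega))
    hsmall hlen (mem_runStarts.1 hN)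
  have hR1 := hcard 1 (by norm_num) k le_rfl
  have hR2 := hcard (-1) (by norm_num) k le_rfl
  have hlogQ : Real.log (2 * Q) ≤ Real.log p := by
    have hQr : (1 : ℝ) ≤ Q := by exact_mod_cast hQ1
    refine Real.log_le_log (by linarith) ?_
    have h2 : (4 * (Q * (Q * k)) : ℝ) < p := by exact_mod_cast hsmall
    have h3 : (1 : ℝ) ≤ Q * k := by nlinarith
    nlinarith
  have hupper : (Q * (Q * k : ℕ) : ℝ) ≤ (p : ℝ) ^ (0.502 : ℝ) := by
    calc _ ≤ _ := hmain
      _ ≤ 5 * (Real.log p + Real.log p) *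
          ((p : ℝ) ^ (0.501 : ℝ) + (p : ℝ) ^ (0.501 : ℝ)) := by
          gcongr
      _ = 20 * Real.log p * (p : ℝ) ^ (0.501 : ℝ) := by ring
      _ ≤ (p : ℝ) ^ (0.001 : ℝ) * (p : ℝ) ^ (0.501 : ℝ) := by
          gcongr
          linarith
      _ = _ := by
          rw [← Real.rpow_add hp0]
          norm_num
  have hlower : (p : ℝ) ^ (0.506 : ℝ) ≤ (Q * (Q * k : ℕ) : ℝ) := by
    push_cast
    calc (p : ℝ) ^ (0.506 : ℝ) = (p : ℝ) ^ (0.253 : ℝ) * ((p : ℝ) ^ (0.253 : ℝ) * 1) := by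
          rw [mul_one, ← Real.rpow_add hp0]
          norm_num
      _ ≤ Q * (Q * k) := by gcongr
  have hlt : (p : ℝ) ^ (0.502 : ℝ) < (p : ℝ) ^ (0.506 : ℝ) :=
    Real.rpow_lt_rpow_of_exponent_lt (by exact_mod_cast (by omega : 1 < p)) (by norm_num)
  linarith

end Asymptotics

section Gaps

lemma mem_univM {M : ℕ} (hM : M ≠ 0) (x : ZMod M) : x ∈ univM M := by
  have : NeZero M := ⟨hM⟩
  exact mem_image.2 ⟨x.val, mem_range.2 (ZMod.val_lt x), ZMod.natCast_zmod_val x⟩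

lemma card_Kgap_sum_le {M m : ℕ} (hM : M ≠ 0) (hm : 1 ≤ m) (S : Finset ℕ) :
    ∑ l ∈ S, Kgap M l * (l + 1 - m) ≤ #(Nset M (Ico 1 m)) := by
  set G : ℕ → Finset (ZMod M) := fun l => (QR M).filter (fun x => x + (l : ZMod M) ∈ QR M ∧
    ∀ j ∈ Ico 1 l, x + (j : ZMod M) ∉ QR M) with hG
  have hcard : ∑ l ∈ S, Kgap M l * (l + 1 - m) =
      #(S.sigma fun l => G l ×ˢ range (l + 1 - m)) := by
    rw [card_sigma]
    refine sum_congr rfl fun l _ => ?_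
    rw [card_product, card_range]
    rfl
  rw [hcard]
  have hval : ∀ q ∈ S.sigma fun l => G l ×ˢ range (l + 1 - m),
      q.2.1 ∈ QR M ∧ q.2.1 + (q.1 : ZMod M) ∈ QR M ∧
        (∀ j ∈ Ico 1 q.1, q.2.1 + (j : ZMod M) ∉ QR M) ∧ q.2.2 + m ≤ q.1 := by
    rintro ⟨l, x, s⟩ hq
    simp only [hG, mem_sigma, mem_product, mem_filter, mem_range] at hq
    refine ⟨hq.2.1.1, hq.2.1.2.1, hq.2.1.2.2, ?_⟩
    dsimp only
    omega
  refine card_le_card_of_injOn (fun q => q.2.1 + (q.2.2 : ZMod M)) (fun q hq => ?_) ?_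
  · obtain ⟨-, -, h3, h4⟩ := hval q hq
    refine mem_filter.2 ⟨mem_univM hM _, fun j hj => ?_⟩
    rw [mem_Ico] at hj
    rw [add_assoc, ← Nat.cast_add]
    exact h3 _ (mem_Ico.2 ⟨by omega, by omega⟩)
  · have hle : ∀ q ∈ S.sigma fun l => G l ×ˢ range (l + 1 - m),
        ∀ r ∈ S.sigma fun l => G l ×ˢ range (l + 1 - m),
          q.2.1 + (q.2.2 : ZMod M) = r.2.1 + (r.2.2 : ZMod M) → r.2.2 ≤ q.2.2 := by
      intro q hq r hr h
      by_contra! hlt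
      obtain ⟨h1, -, -, -⟩ := hval q hq
      obtain ⟨-, -, h3, h4⟩ := hval r hr
      refine h3 (r.2.2 - q.2.2) (mem_Ico.2 ⟨by omega, by omega⟩) ?_
      rw [Nat.cast_sub hlt.le, ← add_sub_assoc, ← h, add_sub_cancel_right]
      exact h1
    have hle' : ∀ q ∈ S.sigma fun l => G l ×ˢ range (l + 1 - m),
        ∀ r ∈ S.sigma fun l => G l ×ˢ range (l + 1 - m), q.2.1 = r.2.1 → r.1 ≤ q.1 := by
      intro q hq r hr h
      by_contra! hlt
      obtain ⟨-, h2, -, h4⟩ := hval q hq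
      obtain ⟨-, -, h3, -⟩ := hval r hr
      rw [h] at h2
      exact h3 q.1 (mem_Ico.2 ⟨by omega, hlt⟩) h2
    rintro ⟨l, x, s⟩ hq ⟨l', x', s'⟩ hr h
    have hs : s = s' := le_antisymm (hle _ hr _ hq h.symm) (hle _ hq _ hr h)
    subst hs
    have hx : x = x' := add_right_cancel h
    subst hx
    have hl : l = l' := le_antisymm (hle' _ hr _ hq rfl) (hle' _ hq _ hr rfl)
    subst hl
    rfl

lemma sq_sub_le_two_mul_sum {t l M : ℕ} (htl : t ≤ l) (hlM : l ≤ M) :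
    (l - t) ^ 2 ≤ 2 * ∑ m ∈ Ioc t M, (l + 1 - m) := by
  obtain ⟨n, rfl⟩ := Nat.exists_eq_add_of_le htl
  have h : 2 * ∑ m ∈ Ioc t (t + n), (t + n + 1 - m) = n * (n + 1) := by
    clear hlM htl
    induction n with
    | zero => simp
    | succ n ih =>
      rw [← add_assoc, sum_Ioc_succ_top (by omega)]
      have : ∑ m ∈ Ioc t (t + n), (t + n + 1 + 1 - m) =
          ∑ m ∈ Ioc t (t + n), (t + n + 1 - m) + n := by
        rw [sum_congr rfl (g := fun m => (t + n + 1 - m) + 1), sum_add_distrib]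
        · simp
        · intro m hm
          have := (mem_Ioc.1 hm).2
          omega
      rw [this, mul_add, mul_add, ih]
      have : t + n + 1 + 1 - (t + n + 1) = 1 := by omega
      rw [this]
      ring
  have h2 : ∑ m ∈ Ioc t (t + n), (t + n + 1 - m) ≤ ∑ m ∈ Ioc t M, (t + n + 1 - m) :=
    sum_le_sum_of_subset (Ioc_subset_Ioc_right hlM)
  rw [Nat.add_sub_cancel_left]
  nlinarith

/-- The second moment of the long gaps is controlled by the number of starting points of
intervals free of quadratic residues. -/
lemma sum_Kgap_mul_sq_le {M : ℕ} (hM : M ≠ 0) {D : ℝ} (hD : 0 ≤ D) {S : Finset ℕ}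
    (hSM : ∀ l ∈ S, l ≤ M)
    (hSD : ∀ l ∈ S, D < l) :
    ∑ l ∈ S, (Kgap M l : ℝ) * (l : ℝ) ^ 2 ≤
      32 * ∑ m ∈ Ioc ⌊3 * D / 4⌋₊ M, (#(Nset M (Ico 1 m)) : ℝ) := by
  set t := ⌊3 * D / 4⌋₊ with ht
  have htD : (t : ℝ) ≤ 3 * D / 4 := Nat.floor_le (by linarith)
  have hl : ∀ l ∈ S, (l : ℝ) ^ 2 ≤ 32 * ((∑ m ∈ Ioc t M, (l + 1 - m) : ℕ) : ℝ) := by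
    intro l hl
    have h1 := hSD l hl
    have htl : t ≤ l := by
      rw [← Nat.cast_le (α := ℝ)]
      linarith
    have h2 : (((l - t) ^ 2 : ℕ) : ℝ) ≤ ((2 * ∑ m ∈ Ioc t M, (l + 1 - m) : ℕ) : ℝ) :=
      Nat.cast_le.2 (sq_sub_le_two_mul_sum htl (hSM l hl))
    rw [Nat.cast_pow, Nat.cast_sub htl, Nat.cast_mul, Nat.cast_ofNat] at h2
    have h3 : (l : ℝ) / 4 ≤ l - t := by linarith
    have h4 : (l / 4 : ℝ) ^ 2 ≤ (l - t : ℝ) ^ 2 := by gcongr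
    linarith
  calc ∑ l ∈ S, (Kgap M l : ℝ) * (l : ℝ) ^ 2
      ≤ ∑ l ∈ S, (Kgap M l : ℝ) * (32 * ((∑ m ∈ Ioc t M, (l + 1 - m) : ℕ) : ℝ)) := by
        refine sum_le_sum fun l h => ?_
        have := hl l h
        gcongr
    _ = 32 * ∑ m ∈ Ioc t M, ((∑ l ∈ S, Kgap M l * (l + 1 - m) : ℕ) : ℝ) := by
        rw [← Nat.cast_sum, sum_comm, Nat.cast_sum, mul_sum]
        refine sum_congr rfl fun l _ => ?_
        rw [← mul_sum, Nat.cast_mul]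
        ring
    _ ≤ _ := by
        gcongr with m hm
        have := (mem_Ioc.1 hm).1
        exact card_Kgap_sum_le hM (by omega) S

lemma mem_QR_iff {M : ℕ} (hM : M ≠ 0) (x : ZMod M) : x ∈ QR M ↔ IsSquare x := by
  have : NeZero M := ⟨hM⟩
  rw [QR, mem_image]
  constructor
  · rintro ⟨a, _, rfl⟩
    exact ⟨a, pow_two _⟩
  · rintro ⟨r, rfl⟩
    exact ⟨r.val, mem_range.2 (ZMod.val_lt r), by rw [ZMod.natCast_zmod_val, pow_two]⟩

lemma le_of_Nset_nonempty {M m : ℕ} (hM : M ≠ 0) (h : (Nset M (Ico 1 m)).Nonempty) :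
    m ≤ 2 * Nat.sqrt M + 1 := by
  have : NeZero M := ⟨hM⟩
  obtain ⟨z, hz⟩ := h
  have hz := (mem_filter.1 hz).2
  by_contra! hlt
  set v := z.val with hv
  have hvM : v < M := ZMod.val_lt z
  have hs : Nat.sqrt v ≤ Nat.sqrt M := Nat.sqrt_le_sqrt hvM.le
  have h1 : v < (Nat.sqrt v + 1) * (Nat.sqrt v + 1) := Nat.lt_succ_sqrt v
  have h2 : Nat.sqrt v * Nat.sqrt v ≤ v := Nat.sqrt_le v
  refine hz ((Nat.sqrt v + 1) * (Nat.sqrt v + 1) - v) (mem_Ico.2 ⟨by omega, ?_⟩) ?_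
  · have : (Nat.sqrt v + 1) * (Nat.sqrt v + 1) = Nat.sqrt v * Nat.sqrt v + 2 * Nat.sqrt v + 1 := by
      ring
    omega
  · rw [mem_QR_iff hM]
    refine ⟨((Nat.sqrt v + 1 : ℕ) : ZMod M), ?_⟩
    rw [Nat.cast_sub h1.le, hv, ZMod.natCast_zmod_val]
    push_cast
    ring

open scoped Classical in
lemma card_Nset_le_mul {A p : ℕ} [NeZero A] [Fact p.Prime] (hAp : Nat.Coprime A p) {m b : ℕ}
    (hb : ∀ a : ZMod A, #{y : ZMod p | ∀ j ∈ Ico 1 m, IsSquare (a + (j : ZMod A)) →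
      quadraticChar (ZMod p) (y + (j : ZMod p)) = -1} ≤ b) :
    #(Nset (A * p) (Ico 1 m)) ≤ A * b := by
  have hM : A * p ≠ 0 := mul_ne_zero (NeZero.ne A) (NeZero.ne p)
  set e := ZMod.chineseRemainder hAp with he
  rw [mul_comm A b]
  have hA : #(univ : Finset (ZMod A)) = A := by rw [card_univ, ZMod.card]
  conv_rhs => rw [← hA]
  refine card_le_mul_card_image_of_maps_to (f := fun z => (e z).1) (fun _ _ => mem_univ _) b
    fun a _ => (le_trans (card_le_card_of_injOn (fun z => (e z).2) ?_ ?_) (hb a))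
  · intro z hz
    obtain ⟨hzN, rfl⟩ := mem_filter.1 hz
    have hzN := (mem_filter.1 hzN).2
    refine mem_filter.2 ⟨mem_univ _, fun j hj hsq => ?_⟩
    rw [quadraticChar_neg_one_iff_not_isSquare]
    intro hsq2
    refine hzN j hj ((mem_QR_iff hM _).2 ?_)
    obtain ⟨r, hr⟩ := hsq
    obtain ⟨s, hs⟩ := hsq2
    refine ⟨e.symm (r, s), e.injective ?_⟩
    rw [map_mul, e.apply_symm_apply, map_add, map_natCast]
    exact Prod.ext hr hs
  · intro z hz w hw hzw
    exact e.injective (Prod.ext ((mem_filter.1 hz).2.trans (mem_filter.1 hw).2.symm) hzw)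

end Gaps

section Fibers

lemma QR_nonempty {A : ℕ} (hA : A ≠ 0) : (QR A).Nonempty :=
  ⟨0, (mem_QR_iff hA 0).2 ⟨0, by simp⟩⟩

lemma two_mul_card_QR_le (A : ℕ) : 2 * #(QR A) ≤ A + 2 := by
  have h : QR A ⊆ (range (A / 2 + 1)).image fun a : ℕ => (a : ZMod A) ^ 2 := by
    intro x hx
    obtain ⟨a, ha, rfl⟩ := mem_image.1 hx
    rw [mem_range] at ha
    by_cases h : a ≤ A / 2
    · exact mem_image.2 ⟨a, mem_range.2 (by omega), rfl⟩
    · refine mem_image.2 ⟨A - a, mem_range.2 (by omega), ?_⟩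
      rw [Nat.cast_sub ha.le, ZMod.natCast_self, zero_sub, neg_sq]
  have := (card_le_card h).trans card_image_le
  rw [card_range] at this
  omega

lemma div_mul_card_QR_le {A : ℕ} [NeZero A] (m : ℕ) (a : ZMod A)
    [DecidablePred fun j : ℕ => IsSquare (a + (j : ZMod A))] :
    (m - 1) / A * #(QR A) ≤ #((Ico 1 m).filter fun j : ℕ => IsSquare (a + (j : ZMod A))) := by
  have hA : 0 < A := Nat.pos_of_ne_zero (NeZero.ne A)
  rw [← card_range ((m - 1) / A), ← card_product]
  refine card_le_card_of_injOn (fun x => (x.2 - a - 1).val + A * x.1 + 1) (fun x hx => ?_) ?_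
  · obtain ⟨h1, h2⟩ := mem_product.1 hx
    rw [mem_range] at h1
    have hv := ZMod.val_lt (x.2 - a - 1)
    have h3 : A * (x.1 + 1) ≤ m - 1 :=
      (Nat.mul_le_mul_left A h1).trans (Nat.mul_div_le _ _)
    refine mem_filter.2 ⟨mem_Ico.2 ⟨Nat.le_add_left 1 _, ?_⟩, ?_⟩
    · dsimp only
      rw [mul_add, mul_one] at h3
      omega
    · rw [← mem_QR_iff (NeZero.ne A)]
      convert h2 using 1
      push_cast
      rw [ZMod.natCast_zmod_val, ZMod.natCast_self]
      ring
  · rintro ⟨i, q⟩ _ ⟨i', q'⟩ _ h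
    have h : (q - a - 1).val + A * i = (q' - a - 1).val + A * i' := Nat.succ_injective h
    have h1 := congrArg (· / A) h
    have h2 := congrArg (· % A) h
    simp only [Nat.add_mul_div_left _ _ hA, Nat.add_mul_mod_self_left,
      Nat.div_eq_of_lt (ZMod.val_lt _), Nat.mod_eq_of_lt (ZMod.val_lt _), zero_add] at h1 h2
    have h3 := ZMod.val_injective A h2
    rw [Prod.mk.injEq]
    exact ⟨h1, by simpa using h3⟩

lemma natCast_ne_zero_of_coprime {A p : ℕ} [Fact p.Prime] (hAp : Nat.Coprime A p) :
    (A : ZMod p) ≠ 0 := by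
  rw [Ne, ZMod.natCast_eq_zero_iff]
  exact fun h => (Nat.Prime.coprime_iff_not_dvd Fact.out).1 hAp.symm h

variable {A p : ℕ} [NeZero A] [Fact p.Prime]

lemma card_Nset_le_of_lt (hAp : Nat.Coprime A p) (hp : p ≠ 2) {m : ℕ} (hm : A < m)
    (hM : 2 * Nat.sqrt (A * p) + 1 ≤ p) :
    (#(Nset (A * p) (Ico 1 m)) : ℝ) ≤ 2 * A ^ 2 * p / #(QR A) * (m : ℝ)⁻¹ := by
  classical
  have hA : 0 < A := Nat.pos_of_ne_zero (NeZero.ne A)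
  have hρ : 0 < #(QR A) := card_pos.2 (QR_nonempty hA.ne')
  rcases (Nset (A * p) (Ico 1 m)).eq_empty_or_nonempty with h0 | hne
  · rw [h0]
    simp only [card_empty, Nat.cast_zero]
    positivity
  have hmp : m ≤ p := (le_of_Nset_nonempty (mul_ne_zero hA.ne' (NeZero.ne p)) hne).trans hM
  have hmpos : 0 < m := by omega
  have hb := card_Nset_le_mul hAp (m := m) (b := 2 * A * p / (m * #(QR A))) fun a => by
    rw [Nat.le_div_iff_mul_le (by positivity)]
    set J := (Ico 1 m).filter fun j : ℕ => IsSquare (a + (j : ZMod A)) with hJ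
    have h1 := card_nonresidue_shift_mul_card_le hp J fun j hj => by
      have := (mem_Ico.1 (mem_filter.1 hj).1).2
      omega
    have h2 : (m - 1) / A * #(QR A) ≤ #J := div_mul_card_QR_le m a
    have h3 : m ≤ 2 * A * ((m - 1) / A) := by
      have h4 := Nat.lt_mul_div_succ (m - 1) hA
      have h5 : 1 ≤ (m - 1) / A := (Nat.one_le_div_iff hA).2 (by omega)
      have h6 : A * 1 ≤ A * ((m - 1) / A) := Nat.mul_le_mul_left A h5
      rw [mul_add] at h4
      rw [mul_assoc]
      omega
    have h7 : m * #(QR A) ≤ 2 * A * #J := by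
      calc m * #(QR A) ≤ 2 * A * ((m - 1) / A) * #(QR A) := by gcongr
        _ = 2 * A * ((m - 1) / A * #(QR A)) := by ring
        _ ≤ _ := by gcongr
    have h8 : #{y : ZMod p | ∀ j ∈ Ico 1 m, IsSquare (a + (j : ZMod A)) →
        quadraticChar (ZMod p) (y + (j : ZMod p)) = -1} ≤
        #{y : ZMod p | ∀ j ∈ J, quadraticChar (ZMod p) (y + (j : ZMod p)) = -1} := by
      refine card_le_card fun y hy => mem_filter.2 ⟨mem_univ _, fun j hj => ?_⟩
      exact (mem_filter.1 hy).2 j (mem_filter.1 hj).1 (mem_filter.1 hj).2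
    calc _ ≤ #{y : ZMod p | ∀ j ∈ J, quadraticChar (ZMod p) (y + (j : ZMod p)) = -1} *
          (2 * A * #J) := Nat.mul_le_mul h8 h7
      _ = 2 * A * (#{y : ZMod p | ∀ j ∈ J, quadraticChar (ZMod p) (y + (j : ZMod p)) = -1} *
          #J) := by ring
      _ ≤ 2 * A * p := Nat.mul_le_mul_left _ h1
  calc (#(Nset (A * p) (Ico 1 m)) : ℝ) ≤ A * ((2 * A * p / (m * #(QR A)) : ℕ) : ℝ) := by
        rw [← Nat.cast_mul, Nat.cast_le]
        exact hb
    _ ≤ A * (((2 * A * p : ℕ) : ℝ) / ((m * #(QR A) : ℕ) : ℝ)) := by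
        gcongr
        exact Nat.cast_div_le
    _ = _ := by
        push_cast
        field_simp

lemma card_Nset_le_mul_card_runStarts (hAp : Nat.Coprime A p) (m : ℕ) :
    #(Nset (A * p) (Ico 1 m)) ≤
      A * #(runStarts p (-quadraticChar (ZMod p) (A : ZMod p)) ((m - 1) / A)) := by
  classical
  have hA : 0 < A := Nat.pos_of_ne_zero (NeZero.ne A)
  have hA0 : (A : ZMod p) ≠ 0 := natCast_ne_zero_of_coprime hAp
  refine card_Nset_le_mul hAp fun a => ?_
  set v := (-a - 1).val with hv
  have hvA : v < A := ZMod.val_lt _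
  refine card_le_card_of_injOn (fun y => (y + v + 1) / (A : ZMod p) - 1) (fun y hy => ?_) ?_
  · have hy := (mem_filter.1 hy).2
    rw [mem_coe, mem_runStarts]
    intro i hi
    obtain ⟨i, rfl⟩ : ∃ i' : ℕ, i = i' + 1 :=
      ⟨i - 1, by have := (mem_Icc.1 hi).1; omega⟩
    have hi := (mem_Icc.1 hi).2
    have h3 : A * (i + 1) ≤ m - 1 :=
      (Nat.mul_le_mul_left A hi).trans (Nat.mul_div_le _ _)
    rw [mul_add, mul_one] at h3
    have h4 := hy (v + 1 + A * i) (mem_Ico.2 ⟨by omega, by omega⟩) ⟨0, by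
      push_cast
      rw [hv, ZMod.natCast_zmod_val, ZMod.natCast_self]
      ring⟩
    have hinv : quadraticChar (ZMod p) (A : ZMod p)⁻¹ = quadraticChar (ZMod p) (A : ZMod p) := by
      have h5 : quadraticChar (ZMod p) (A : ZMod p) ^ 2 = 1 := quadraticChar_sq_one hA0
      have h6 : quadraticChar (ZMod p) (A : ZMod p) *
          quadraticChar (ZMod p) (A : ZMod p)⁻¹ = 1 := by
        rw [← map_mul, mul_inv_cancel₀ hA0, map_one]
      linear_combination quadraticChar (ZMod p) (A : ZMod p) * h6 -
        quadraticChar (ZMod p) (A : ZMod p)⁻¹ * h5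
    rw [neg_eq_neg_one_mul, ← h4, ← hinv, ← map_mul]
    congr 1
    push_cast
    field_simp
    ring
  · intro y _ z _ h
    have h : (y + v + 1) / (A : ZMod p) - 1 = (z + v + 1) / (A : ZMod p) - 1 := h
    rw [sub_left_inj, div_left_inj' hA0] at h
    exact add_right_cancel (add_right_cancel h)

end Fibers

section LargeGaps

open Filter

lemma two_mul_sqrt_add_one_le {A p : ℕ} {ε : ℝ} (hp : 1 ≤ p)
    (hA : (A : ℝ) ≤ (p : ℝ) ^ ε) (h3 : 3 ≤ (p : ℝ) ^ ((1 - ε) / 2)) (hε : 0 < ε) :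
    2 * Nat.sqrt (A * p) + 1 ≤ p := by
  have hp1 : (1 : ℝ) ≤ p := by exact_mod_cast hp
  have hp0 : (0 : ℝ) < p := by linarith
  have h1 : ((Nat.sqrt (A * p) : ℕ) : ℝ) ≤ (p : ℝ) ^ ((1 + ε) / 2) := by
    calc ((Nat.sqrt (A * p) : ℕ) : ℝ) ≤ Real.sqrt ((A * p : ℕ) : ℝ) :=
          Real.nat_sqrt_le_real_sqrt
      _ ≤ Real.sqrt ((p : ℝ) ^ (1 + ε)) := by
          refine Real.sqrt_le_sqrt ?_
          rw [Nat.cast_mul, add_comm, Real.rpow_add hp0, Real.rpow_one]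
          gcongr
      _ = (p : ℝ) ^ ((1 + ε) / 2) := by
          rw [Real.sqrt_eq_rpow, ← Real.rpow_mul hp0.le]
          congr 1
          ring
  have h2 : (1 : ℝ) ≤ (p : ℝ) ^ ((1 + ε) / 2) := Real.one_le_rpow hp1 (by linarith)
  rw [← Nat.cast_le (α := ℝ)]
  push_cast
  calc (2 * (Nat.sqrt (A * p) : ℕ) + 1 : ℝ) ≤ 3 * (p : ℝ) ^ ((1 + ε) / 2) := by linarith
    _ ≤ (p : ℝ) ^ ((1 - ε) / 2) * (p : ℝ) ^ ((1 + ε) / 2) := by gcongr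
    _ = p := by
        rw [← Real.rpow_add hp0]
        ring_nf
        exact Real.rpow_one _

/-- The case of many quadratic residues modulo `A`. -/
lemma eventually_sum_card_Nset_le_of_many_residues {ε : ℝ} (hε : 0 < ε) (hε1 : ε < 1) :
    ∀ᶠ p : ℕ in atTop, ∀ [Fact p.Prime], ∀ A : ℕ, A ≠ 0 → Nat.Coprime A p →
      (A : ℝ) ≤ (p : ℝ) ^ ε → (p : ℝ) ^ (0.475 * ε) ≤ #(QR A) → ∀ D : ℝ,
      D = A * (#(QR A) : ℝ)⁻¹ * (p : ℝ) ^ ε →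
      ∑ m ∈ Ioc ⌊3 * D / 4⌋₊ (A * p), (#(Nset (A * p) (Ico 1 m)) : ℝ) ≤
        2 * (A : ℝ) ^ 2 * (p : ℝ) ^ (1 - 0.47 * ε) := by
  filter_upwards [eventually_const_le_rpow 3 (r := (1 - ε) / 2) (by linarith),
    eventually_const_le_rpow 6 (r := 0.475 * ε) (by positivity),
    eventually_mul_log_le_rpow 3 (r := 0.005 * ε) (by positivity), eventually_ge_atTop 3]
    with p h3 h6 hlog hp3 _ A hA0 hAp hA hρ D hD
  have : NeZero A := ⟨hA0⟩
  have hp1 : (1 : ℝ) ≤ p := by exact_mod_cast (by omega : 1 ≤ p)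
  have hp0 : (0 : ℝ) < p := by linarith
  have hApos : (0 : ℝ) < A := by exact_mod_cast Nat.pos_of_ne_zero hA0
  have hlog1 := one_le_log_of_three_le hp3
  have hM := two_mul_sqrt_add_one_le (by omega) hA h3 hε
  have hρA : (2 * #(QR A) : ℝ) ≤ A + 2 := by exact_mod_cast two_mul_card_QR_le A
  set ρ : ℝ := (#(QR A) : ℝ) with hρdef
  have hρ6 : 6 ≤ ρ := h6.trans hρ
  have hDA : 5 / 3 * A ≤ D := by
    have h1 : 5 / 3 * ρ ≤ A := by linarith
    have h2 : 5 / 3 ≤ A * ρ⁻¹ := by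
      rw [← div_eq_mul_inv, le_div_iff₀ (by linarith)]
      exact h1
    rw [hD]
    gcongr
  have hm : ∀ m ∈ Ioc ⌊3 * D / 4⌋₊ (A * p), A < m := by
    intro m hm
    have h1 := (Nat.floor_lt (by linarith)).1 (mem_Ioc.1 hm).1
    rw [← Nat.cast_lt (α := ℝ)]
    linarith
  have hlogM : Real.log ((A * p : ℕ) : ℝ) ≤ 2 * Real.log p := by
    have hAp1 : (A : ℝ) ≤ p := hA.trans (by
      simpa using Real.rpow_le_rpow_of_exponent_le hp1 hε1.le)
    rw [Nat.cast_mul, Real.log_mul hApos.ne' hp0.ne']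
    have := Real.log_le_log hApos hAp1
    linarith
  have hharm : ∑ m ∈ Ioc ⌊3 * D / 4⌋₊ (A * p), (m : ℝ)⁻¹ ≤ 3 * Real.log p := by
    have h1 := harmonic_le_one_add_log (A * p)
    rw [harmonic_eq_sum_Icc, Rat.cast_sum] at h1
    have h2 : ∑ m ∈ Ioc ⌊3 * D / 4⌋₊ (A * p), (m : ℝ)⁻¹ ≤
        ∑ m ∈ Icc 1 (A * p), (((m : ℚ)⁻¹ : ℚ) : ℝ) := by
      simp only [Rat.cast_inv, Rat.cast_natCast]
      refine sum_le_sum_of_subset_of_nonneg (fun m hm => ?_) fun _ _ _ => by positivity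
      rw [mem_Ioc] at hm
      exact mem_Icc.2 ⟨by omega, hm.2⟩
    linarith
  calc ∑ m ∈ Ioc ⌊3 * D / 4⌋₊ (A * p), (#(Nset (A * p) (Ico 1 m)) : ℝ)
      ≤ ∑ m ∈ Ioc ⌊3 * D / 4⌋₊ (A * p), 2 * A ^ 2 * p / ρ * (m : ℝ)⁻¹ :=
        sum_le_sum fun m h => card_Nset_le_of_lt hAp (by omega) (hm m h) hM
    _ = 2 * A ^ 2 * p / ρ * ∑ m ∈ Ioc ⌊3 * D / 4⌋₊ (A * p), (m : ℝ)⁻¹ := by rw [mul_sum]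
    _ ≤ 2 * A ^ 2 * p / (p : ℝ) ^ (0.475 * ε) * (p : ℝ) ^ (0.005 * ε) := by
        gcongr
        exact hharm.trans hlog
    _ = 2 * (A : ℝ) ^ 2 * (p : ℝ) ^ (1 - 0.47 * ε) := by
        have : (p : ℝ) ^ (1 - 0.47 * ε) =
            p / (p : ℝ) ^ (0.475 * ε) * (p : ℝ) ^ (0.005 * ε) := by
          rw [← Real.rpow_one_sub' hp0.le (by nlinarith), ← Real.rpow_add hp0]
          congr 1
          ring
        rw [this]
        ring

/-- The case of few quadratic residues modulo `A`. -/
lemma eventually_sum_card_Nset_le_of_few_residues {ε : ℝ} (hε : 0 < ε) (hε1 : ε < 1) :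
    ∀ᶠ p : ℕ in atTop, ∀ [Fact p.Prime], ∀ A : ℕ, A ≠ 0 → Nat.Coprime A p →
      (#(QR A) : ℝ) < (p : ℝ) ^ (0.475 * ε) → ∀ D : ℝ,
      D = A * (#(QR A) : ℝ)⁻¹ * (p : ℝ) ^ ε →
      ∑ m ∈ Ioc ⌊3 * D / 4⌋₊ (A * p), (#(Nset (A * p) (Ico 1 m)) : ℝ) ≤
        2 * (A : ℝ) ^ 2 * (p : ℝ) ^ (1 - 0.47 * ε) := by
  filter_upwards [eventually_card_runStarts_le, eventually_run_length_lt,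
    eventually_mul_log_le_rpow 6 (r := 0.525 * ε) (by positivity),
    eventually_const_le_rpow (8 / 3) (r := 0.001) (by norm_num), eventually_ge_atTop 3]
    with p hcard hrun hlog hconst hp3 _ A hA0 hAp hρ D hD
  have : NeZero A := ⟨hA0⟩
  have hp1 : (1 : ℝ) ≤ p := by exact_mod_cast (by omega : 1 ≤ p)
  have hp1' : (1 : ℝ) < p := by exact_mod_cast (by omega : 1 < p)
  have hp0 : (0 : ℝ) < p := by linarith
  have hAnat : 0 < A := Nat.pos_of_ne_zero hA0
  have hApos : (0 : ℝ) < A := by exact_mod_cast hAnat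
  have hlog1 := one_le_log_of_three_le hp3
  have hρ0 : (0 : ℝ) < #(QR A) := by exact_mod_cast card_pos.2 (QR_nonempty hA0)
  set σ : ℤ := -quadraticChar (ZMod p) (A : ZMod p) with hσdef
  have hσ : |σ| = 1 := by
    rw [hσdef, abs_neg]
    rcases quadraticChar_dichotomy (natCast_ne_zero_of_coprime hAp) with h | h <;>
      rw [h] <;> norm_num
  have hDlow : A * (p : ℝ) ^ (0.525 * ε) ≤ D := by
    have h1 : (p : ℝ) ^ ε = (p : ℝ) ^ (0.475 * ε) * (p : ℝ) ^ (0.525 * ε) := by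
      rw [← Real.rpow_add hp0]
      congr 1
      ring
    have h2 : 1 ≤ (#(QR A) : ℝ)⁻¹ * (p : ℝ) ^ (0.475 * ε) := by
      rw [← div_eq_inv_mul, one_le_div hρ0]
      exact hρ.le
    rw [hD, h1]
    calc A * (p : ℝ) ^ (0.525 * ε) = A * 1 * (p : ℝ) ^ (0.525 * ε) := by ring
      _ ≤ A * ((#(QR A) : ℝ)⁻¹ * (p : ℝ) ^ (0.475 * ε)) * (p : ℝ) ^ (0.525 * ε) := by gcongr
      _ = _ := by ring
  have hD0 : 0 ≤ D := le_trans (by positivity) hDlow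
  have key : ∀ m ∈ Ioc ⌊3 * D / 4⌋₊ (A * p), (Nset (A * p) (Ico 1 m)).Nonempty →
      (A * (3 / 4 * (p : ℝ) ^ (0.525 * ε)) < m ∧ (m : ℝ) ≤ 2 * A * (p : ℝ) ^ (0.255 : ℝ)) ∧
      (#(Nset (A * p) (Ico 1 m)) : ℝ) ≤ A * (p : ℝ) ^ (0.501 : ℝ) := by
    intro m hm hne
    have h1 : 3 * D / 4 < m := (Nat.floor_lt (by linarith)).1 (mem_Ioc.1 hm).1
    have hmlow : A * (3 / 4 * (p : ℝ) ^ (0.525 * ε)) < m := by linarith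
    set h := (m - 1) / A with hh
    have hmh : (m : ℝ) ≤ A * (h + 1) := by
      have h4 := Nat.lt_mul_div_succ (m - 1) hAnat
      have : m ≤ A * (h + 1) := by
        rw [hh]
        omega
      exact_mod_cast this
    have hkh : Nat.log 2 p + 1 ≤ h := by
      have h5 : 3 / 4 * (p : ℝ) ^ (0.525 * ε) < h + 1 :=
        lt_of_mul_lt_mul_left (hmlow.trans_le hmh) hApos.le
      have h6 := natLog_two_add_one_le hp3
      rw [← Nat.cast_le (α := ℝ)]
      linarith
    have hle := card_Nset_le_mul_card_runStarts hAp m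
    rw [← hσdef, ← hh] at hle
    have hrne : (runStarts p σ h).Nonempty := by
      rw [← card_pos]
      have := hle.trans_lt' (card_pos.2 hne)
      exact Nat.pos_of_mul_pos_left this
    have hhlt := hrun σ hσ h hrne
    have hone : 1 ≤ (p : ℝ) ^ (0.255 : ℝ) := Real.one_le_rpow hp1 (by norm_num)
    refine ⟨⟨hmlow, hmh.trans ?_⟩, ?_⟩
    · calc (A * (h + 1) : ℝ) ≤ A * (2 * (p : ℝ) ^ (0.255 : ℝ)) := by
            gcongr
            linarith
        _ = _ := by ring
    · calc (#(Nset (A * p) (Ico 1 m)) : ℝ) ≤ A * #(runStarts p σ h) := by exact_mod_cast hle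
        _ ≤ _ := by
          gcongr
          exact hcard σ hσ h hkh
  have hbound : ∑ m ∈ Ioc ⌊3 * D / 4⌋₊ (A * p), (#(Nset (A * p) (Ico 1 m)) : ℝ) ≤
      2 * A ^ 2 * (p : ℝ) ^ (0.756 : ℝ) := by
    have hX : (0 : ℝ) ≤ 2 * A * (p : ℝ) ^ (0.255 : ℝ) := by positivity
    calc _ ≤ ∑ m ∈ (Ioc ⌊3 * D / 4⌋₊ (A * p)).filter
            (fun m => (Nset (A * p) (Ico 1 m)).Nonempty), A * (p : ℝ) ^ (0.501 : ℝ) := by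
          rw [sum_filter]
          refine sum_le_sum fun m hm => ?_
          split_ifs with hne
          · exact (key m hm hne).2
          · rw [not_nonempty_iff_eq_empty.1 hne]
            simp
      _ ≤ ∑ m ∈ Icc 1 ⌊2 * A * (p : ℝ) ^ (0.255 : ℝ)⌋₊, A * (p : ℝ) ^ (0.501 : ℝ) := by
          refine sum_le_sum_of_subset_of_nonneg (fun m hm => ?_) fun _ _ _ => by positivity
          obtain ⟨hm, hne⟩ := mem_filter.1 hm
          have h1 := (mem_Ioc.1 hm).1
          exact mem_Icc.2 ⟨by omega, (Nat.le_floor_iff hX).2 (key m hm hne).1.2⟩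
      _ = ⌊2 * A * (p : ℝ) ^ (0.255 : ℝ)⌋₊ * (A * (p : ℝ) ^ (0.501 : ℝ)) := by
          rw [sum_const, Nat.card_Icc, nsmul_eq_mul, Nat.add_sub_cancel]
      _ ≤ 2 * A * (p : ℝ) ^ (0.255 : ℝ) * (A * (p : ℝ) ^ (0.501 : ℝ)) := by
          gcongr
          exact Nat.floor_le hX
      _ = 2 * A ^ 2 * ((p : ℝ) ^ (0.255 : ℝ) * (p : ℝ) ^ (0.501 : ℝ)) := by ring
      _ = _ := by
          rw [← Real.rpow_add hp0]
          norm_num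
  by_cases hex : ∃ m ∈ Ioc ⌊3 * D / 4⌋₊ (A * p), (Nset (A * p) (Ico 1 m)).Nonempty
  · obtain ⟨m, hm, hne⟩ := hex
    obtain ⟨⟨h1, h2⟩, -⟩ := key m hm hne
    have h3 : A * (3 / 4 * (p : ℝ) ^ (0.525 * ε)) < A * (2 * (p : ℝ) ^ (0.255 : ℝ)) := by
      linarith
    have h4 := lt_of_mul_lt_mul_left h3 hApos.le
    have h5 : (p : ℝ) ^ (0.525 * ε) < (p : ℝ) ^ (0.256 : ℝ) := by
      calc (p : ℝ) ^ (0.525 * ε) < 8 / 3 * (p : ℝ) ^ (0.255 : ℝ) := by linarith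
        _ ≤ (p : ℝ) ^ (0.001 : ℝ) * (p : ℝ) ^ (0.255 : ℝ) := by gcongr
        _ = _ := by
          rw [← Real.rpow_add hp0]
          norm_num
    have h6 : 0.525 * ε < 0.256 := (Real.rpow_lt_rpow_left_iff hp1').1 h5
    refine hbound.trans ?_
    gcongr
    linarith
  · push Not at hex
    rw [sum_eq_zero fun m hm => by
      rw [hex m hm]
      simp]
    positivity

end LargeGaps

open scoped Classical in
/-- Lemma 4.6: for fixed `ε₀ ∈ (0,1)`, if `M = Ap` with `p` a sufficiently large prime,
`gcd(A,p) = 1` and `A ≤ p^(ε₀)`, then with `D = A·|R_A|⁻¹·p^(ε₀)` one has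
`Σ_(l > D) K_l·l² ≤ K·A²·p^(1 - 0.47 ε₀)`.  (Since `K_l = 0` for `l > M`, the sum over
`l > D` is the finite sum over `D < l ≤ M`.) -/
theorem stmt_14 :
    ∀ ε₀ : ℝ, 0 < ε₀ → ε₀ < 1 →
      ∃ K : ℝ, 0 < K ∧ ∃ N : ℕ,
        ∀ M A p : ℕ, p.Prime → N ≤ p → Nat.gcd A p = 1 → (A : ℝ) ≤ (p : ℝ) ^ ε₀ →
          M = A * p →
          Finset.sum
              ((Finset.Icc 1 M).filter
                (fun l : ℕ => (A : ℝ) * ((QR A).card : ℝ)⁻¹ * (p : ℝ) ^ ε₀ < (l : ℝ)))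
              (fun l : ℕ => (Kgap M l : ℝ) * (l : ℝ) ^ 2) ≤
            K * (A : ℝ) ^ 2 * (p : ℝ) ^ (1 - 0.47 * ε₀) := by
  intro ε₀ h0 h1
  have h := (eventually_sum_card_Nset_le_of_many_residues h0 h1).and
    (eventually_sum_card_Nset_le_of_few_residues h0 h1)
  obtain ⟨N, hN⟩ := Filter.eventually_atTop.1 h
  refine ⟨64, by norm_num, N, ?_⟩
  rintro M A p hp hNp hgcd hA rfl
  obtain ⟨hmany, hfew⟩ := hN p hNp
  have : Fact p.Prime := ⟨hp⟩
  have hA0 : A ≠ 0 := by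
    rintro rfl
    rw [Nat.gcd_zero_left] at hgcd
    exact hp.one_lt.ne' hgcd
  set D : ℝ := (A : ℝ) * ((QR A).card : ℝ)⁻¹ * (p : ℝ) ^ ε₀ with hD
  have hmain : ∑ m ∈ Ioc ⌊3 * D / 4⌋₊ (A * p), (#(Nset (A * p) (Ico 1 m)) : ℝ) ≤
      2 * (A : ℝ) ^ 2 * (p : ℝ) ^ (1 - 0.47 * ε₀) := by
    rcases le_or_gt ((p : ℝ) ^ (0.475 * ε₀)) #(QR A) with hρ | hρ
    · exact hmany A hA0 hgcd hA hρ D hD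
    · exact hfew A hA0 hgcd hρ D hD
  refine (sum_Kgap_mul_sq_le (mul_ne_zero hA0 hp.ne_zero) (D := D) (by positivity)
    (fun l hl => (mem_Icc.1 (mem_filter.1 hl).1).2) fun l hl => (mem_filter.1 hl).2).trans ?_
  linarith
end
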